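/- Boundary value problem (C) with compatibility condition for 2D magnetohydrostatics: Let Ω = 𝕊¹ × (0,L), α ∈ (0,1), and suppose (B₀,p₀) ∈ C^{2,α}(Ω;ℝ²) × C^{2,α}(Ω) solves the MHS equations with B̄₀² := inf_{Ω̄} |B₀²| > 0 and curl B₀ = 0; set J₀ := ∫_𝒞 B₀·n dS and write P := p + |B|²/2, P₀ := p₀ + |B₀|²/2 for the total pressures. There exist ε > 0, M > 0 sufficiently small and K > 0 (depending only on α, L, B̄₀²) such that: if ‖B₀¹‖_{C^{2,α}(Ω)} ≤ ε and h⁻ ∈ C^{2,α}(∂Ω₋), h⁺ ∈ C^{2,α}(∂Ω₊), f⁻ ∈ C^{2,α}(∂Ω₋), J ∈ ℝ satisfy ‖h⁻‖_{C^{2,α}(∂Ω₋)} + ‖h⁺‖_{C^{2,α}(∂Ω₊)} + ‖f⁻‖_{C^{2,α}(∂Ω₋)} + |J − J₀| ≤ KM, then there exists a unique (B,p) ∈ C^{2,α}(Ω;ℝ²) × C^{2,α}(Ω) solving the MHS equations with ‖B − B₀‖_{C^{2,α}(Ω)} ≤ M and satisfying P = P₀ + h⁻ on ∂Ω₋, P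 = P₀ + h⁺ on ∂Ω₊, B·n = B₀·n + f⁻ on ∂Ω₋, and ∫_𝒞 B·n dS = J, if and only if h⁺(0) = Λ(h⁻,h⁺,f⁻,J), where Λ(h⁻,h⁺,f⁻,J) := P̃(0,L) − P₀(0,L) and P̃ = p̃ + |B̃|²/2 comes from the unique solution (B̃,p̃) with ‖B̃ − B₀‖_{C^{2,α}(Ω)} ≤ M of the MHS equations satisfying P̃ = P₀ + h⁻ on ∂Ω₋, ∂ₓP̃ = ∂ₓP₀ + ∂ₓh⁺ on ∂Ω₊, B̃·n = B₀·n + f⁻ on ∂Ω₋ and ∫_𝒞 B̃·n dS = J. -/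

import Mathlib

open Set
open scoped ENNReal

noncomputable section

namespace EulerBVP

/-- The closed strip `Ω̄ = ℝ × [0, L]`, modelling `𝕊¹ × [0,L]`
(functions on it are required to be 1-periodic in the first variable). -/
def strip (L : ℝ) : Set (ℝ × ℝ) := Set.univ ×ˢ Set.Icc 0 L

/-- Uniform α-Hölder seminorm of `f` on `s`, valued in `ℝ≥0∞`. -/
def hSemi {E F : Type*} [NormedAddCommGroup E] [NormedAddCommGroup F]
    (a : ℝ) (s : Set E) (f : E → F) : ℝ≥0∞ :=
  ⨆ x ∈ s, ⨆ y ∈ s, ENNReal.ofReal (‖f x - f y‖ / ‖x - y‖ ^ a)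

/-- `C^{k,α}` norm of `f` on `s`: sup norms of the derivatives (within `s`) up to
order `k`, plus the `α`-Hölder seminorm of the order-`k` derivative. -/
def hNorm {E F : Type*} [NormedAddCommGroup E] [NormedSpace ℝ E]
    [NormedAddCommGroup F] [NormedSpace ℝ F]
    (k : ℕ) (a : ℝ) (s : Set E) (f : E → F) : ℝ≥0∞ :=
  (Finset.range (k + 1)).sum
      (fun i => ⨆ x ∈ s, (‖iteratedFDerivWithin ℝ i f s x‖₊ : ℝ≥0∞))
    + hSemi a s (iteratedFDerivWithin ℝ k f s)

/-- Membership in the Hölder space `C^{k,α}(s)`. -/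
def MemC {E F : Type*} [NormedAddCommGroup E] [NormedSpace ℝ E]
    [NormedAddCommGroup F] [NormedSpace ℝ F]
    (k : ℕ) (a : ℝ) (s : Set E) (f : E → F) : Prop :=
  ContDiffOn ℝ k f s ∧ hNorm k a s f < ⊤

/-- 1-periodicity in the first (circle) variable. -/
def PerX {F : Type*} (f : ℝ × ℝ → F) : Prop := ∀ x y, f (x + 1, y) = f (x, y)

/-- 1-periodicity for functions on the boundary circle. -/
def Per {F : Type*} (f : ℝ → F) : Prop := ∀ x, f (x + 1) = f x

/-- Partial derivative in the first variable (within the strip). -/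
def pdx (L : ℝ) (f : ℝ × ℝ → ℝ) (z : ℝ × ℝ) : ℝ := fderivWithin ℝ f (strip L) z (1, 0)

/-- Partial derivative in the second variable (within the strip). -/
def pdy (L : ℝ) (f : ℝ × ℝ → ℝ) (z : ℝ × ℝ) : ℝ := fderivWithin ℝ f (strip L) z (0, 1)

/-- First component of a planar vector field. -/
def c1 (v : ℝ × ℝ → ℝ × ℝ) : ℝ × ℝ → ℝ := fun z => (v z).1

/-- Second component of a planar vector field. -/
def c2 (v : ℝ × ℝ → ℝ × ℝ) : ℝ × ℝ → ℝ := fun z => (v z).2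

/-- Divergence `∂ₓ v¹ + ∂_y v²`. -/
def divF (L : ℝ) (v : ℝ × ℝ → ℝ × ℝ) (z : ℝ × ℝ) : ℝ := pdx L (c1 v) z + pdy L (c2 v) z

/-- Scalar curl `∂ₓ v² − ∂_y v¹`. -/
def curlF (L : ℝ) (v : ℝ × ℝ → ℝ × ℝ) (z : ℝ × ℝ) : ℝ := pdx L (c2 v) z - pdy L (c1 v) z

/-- Squared Euclidean length `|v|²` of a planar vector field. -/
def sq (v : ℝ × ℝ → ℝ × ℝ) (z : ℝ × ℝ) : ℝ := (v z).1 ^ 2 + (v z).2 ^ 2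

/-- The steady incompressible Euler equations `v·∇v = −∇p`, `div v = 0` on the strip. -/
def Euler (L : ℝ) (v : ℝ × ℝ → ℝ × ℝ) (p : ℝ × ℝ → ℝ) : Prop :=
  ∀ z ∈ strip L,
    ((v z).1 * pdx L (c1 v) z + (v z).2 * pdy L (c1 v) z = - pdx L p z) ∧
    ((v z).1 * pdx L (c2 v) z + (v z).2 * pdy L (c2 v) z = - pdy L p z) ∧
    divF L v z = 0

/-- The magnetohydrostatic equations `B × j = −∇p`, `j = curl B`, `div B = 0` on the strip;
in 2D, `B × j = (−B² j, B¹ j)`. -/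
def MHS (L : ℝ) (B : ℝ × ℝ → ℝ × ℝ) (p : ℝ × ℝ → ℝ) : Prop :=
  ∀ z ∈ strip L,
    (-(B z).2 * curlF L B z = - pdx L p z) ∧
    ((B z).1 * curlF L B z = - pdy L p z) ∧
    divF L B z = 0

/-- Flux across the segment `𝒞 = {0} × [0,L]`:  `∫_𝒞 w·n dS = −∫₀^L w¹(0,y) dy`. -/
def fluxC (L : ℝ) (w : ℝ × ℝ → ℝ × ℝ) : ℝ := - ∫ y in (0:ℝ)..L, (w (0, y)).1

/-- A velocity/pressure pair of class `C^{k,α}` on the strip, periodic in `x`. -/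
def VP (L : ℝ) (k : ℕ) (a : ℝ) (v : ℝ × ℝ → ℝ × ℝ) (p : ℝ × ℝ → ℝ) : Prop :=
  PerX v ∧ PerX p ∧ MemC k a (strip L) v ∧ MemC k a (strip L) p

/-- Boundary data of class `C^{k,α}(𝕊¹)`: a 1-periodic function in `C^{k,α}(ℝ)`. -/
def BData (k : ℕ) (a : ℝ) (f : ℝ → ℝ) : Prop := Per f ∧ MemC k a (Set.univ : Set ℝ) f

/-- A magnetic field/pressure pair of class `C^{k,α}` on the strip, periodic in `x`. -/
def BP (L : ℝ) (k : ℕ) (a : ℝ) (B : ℝ × ℝ → ℝ × ℝ) (p : ℝ × ℝ → ℝ) : Prop :=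
  PerX B ∧ PerX p ∧ MemC k a (strip L) B ∧ MemC k a (strip L) p

/-- Solution of the MHS equations with the solvable-variant boundary conditions of
problem (C), written with the total pressure `P = p + |B|²/2`:
`P = P₀ + h⁻` on `∂Ω₋`, `∂ₓP = ∂ₓP₀ + ∂ₓh⁺` on `∂Ω₊`, `B·n = B₀·n + f⁻` on `∂Ω₋`,
flux `J`, within `C^{2,α}`-distance `M` of `B₀`. -/
def SolMCmod (L a M : ℝ) (B₀ : ℝ × ℝ → ℝ × ℝ) (p₀ : ℝ × ℝ → ℝ) (hm hp fm : ℝ → ℝ) (J : ℝ)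
    (B : ℝ × ℝ → ℝ × ℝ) (p : ℝ × ℝ → ℝ) : Prop :=
  BP L 2 a B p ∧ MHS L B p ∧
  hNorm 2 a (strip L) (fun z => B z - B₀ z) ≤ ENNReal.ofReal M ∧
  (∀ x, p (x, 0) + sq B (x, 0) / 2 = p₀ (x, 0) + sq B₀ (x, 0) / 2 + hm x) ∧
  (∀ x, deriv (fun t => p (t, L) + sq B (t, L) / 2) x
      = deriv (fun t => p₀ (t, L) + sq B₀ (t, L) / 2) x + deriv hp x) ∧
  (∀ x, -(B (x, 0)).2 = -(B₀ (x, 0)).2 + fm x) ∧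
  fluxC L B = J

/-- Solution of the MHS equations with the boundary conditions of problem (C), written
with the total pressure `P = p + |B|²/2`: `P = P₀ + h⁻` on `∂Ω₋`, `P = P₀ + h⁺` on `∂Ω₊`,
`B·n = B₀·n + f⁻` on `∂Ω₋`, flux `J`, within `C^{2,α}`-distance `M` of `B₀`. -/
def SolMC (L a M : ℝ) (B₀ : ℝ × ℝ → ℝ × ℝ) (p₀ : ℝ × ℝ → ℝ) (hm hp fm : ℝ → ℝ) (J : ℝ)
    (B : ℝ × ℝ → ℝ × ℝ) (p : ℝ × ℝ → ℝ) : Prop :=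
  BP L 2 a B p ∧ MHS L B p ∧
  hNorm 2 a (strip L) (fun z => B z - B₀ z) ≤ ENNReal.ofReal M ∧
  (∀ x, p (x, 0) + sq B (x, 0) / 2 = p₀ (x, 0) + sq B₀ (x, 0) / 2 + hm x) ∧
  (∀ x, p (x, L) + sq B (x, L) / 2 = p₀ (x, L) + sq B₀ (x, L) / 2 + hp x) ∧
  (∀ x, -(B (x, 0)).2 = -(B₀ (x, 0)).2 + fm x) ∧
  fluxC L B = J

section HolderCalculus

set_option linter.unusedSectionVars false

open Filter Topology MeasureTheory

variable {E : Type*} [NormedAddCommGroup E] [NormedSpace ℝ E] {a : ℝ}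

/-- `f` is bounded by `S` and `a`-Hölder with constant `S`. -/
def Hol (a S : ℝ) (f : ℝ → E) : Prop :=
  (∀ x, ‖f x‖ ≤ S) ∧ ∀ x x', ‖f x - f x'‖ ≤ S * |x - x'| ^ a

/-- The difference quotients of `f` are bounded by `S` in the `a`-Hölder norm. -/
def DQ (a S : ℝ) (f : ℝ → E) : Prop := ∀ h, Hol a (S * |h|) (fun x => f (x + h) - f x)

lemma Hol.nonneg {S : ℝ} {f : ℝ → E} (h : Hol a S f) : 0 ≤ S := (norm_nonneg _).trans (h.1 0)

lemma Hol.mono {S T : ℝ} {f : ℝ → E} (h : Hol a S f) (hST : S ≤ T) : Hol a T f :=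
  ⟨fun x => (h.1 x).trans hST, fun x x' => (h.2 x x').trans (by gcongr)⟩

lemma Hol.zero : Hol a 0 (fun _ => (0 : E)) := ⟨by simp, by simp⟩

lemma Hol.add {S T : ℝ} {f g : ℝ → E} (hf : Hol a S f) (hg : Hol a T g) :
    Hol a (S + T) (fun x => f x + g x) := by
  refine ⟨fun x => (norm_add_le _ _).trans (add_le_add (hf.1 x) (hg.1 x)), fun x x' => ?_⟩
  rw [add_sub_add_comm, add_mul]
  exact (norm_add_le _ _).trans (add_le_add (hf.2 x x') (hg.2 x x'))

lemma Hol.neg {S : ℝ} {f : ℝ → E} (hf : Hol a S f) : Hol a S (fun x => -f x) := by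
  refine ⟨fun x => by simpa using hf.1 x, fun x x' => ?_⟩
  rw [← neg_sub', norm_neg]; exact hf.2 x x'

lemma Hol.sub {S T : ℝ} {f g : ℝ → E} (hf : Hol a S f) (hg : Hol a T g) :
    Hol a (S + T) (fun x => f x - g x) := by
  simpa [sub_eq_add_neg] using hf.add hg.neg

lemma Hol.smul_const {S : ℝ} {f : ℝ → E} (hf : Hol a S f) (c : ℝ) :
    Hol a (|c| * S) (fun x => c • f x) := by
  refine ⟨fun x => ?_, fun x x' => ?_⟩
  · rw [norm_smul]; exact mul_le_mul_of_nonneg_left (hf.1 x) (abs_nonneg _)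
  · rw [← smul_sub, norm_smul, mul_assoc]
    exact mul_le_mul_of_nonneg_left (hf.2 x x') (abs_nonneg _)

lemma Hol.const_mul {S : ℝ} {f : ℝ → ℝ} (hf : Hol a S f) (c : ℝ) :
    Hol a (|c| * S) (fun x => c * f x) := hf.smul_const c

lemma Hol.mul {S T : ℝ} {f g : ℝ → ℝ} (hf : Hol a S f) (hg : Hol a T g) :
    Hol a (2 * S * T) (fun x => f x * g x) := by
  have hS := hf.nonneg
  have hT := hg.nonneg
  refine ⟨fun x => ?_, fun x x' => ?_⟩
  · rw [norm_mul]
    have := mul_le_mul (hf.1 x) (hg.1 x) (norm_nonneg _) hS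
    nlinarith [mul_nonneg hS hT]
  · have e : f x * g x - f x' * g x' = (f x - f x') * g x + f x' * (g x - g x') := by ring
    have hd : 0 ≤ |x - x'| ^ a := by positivity
    rw [e]
    refine (norm_add_le _ _).trans ?_
    rw [norm_mul, norm_mul]
    have h1 := mul_le_mul (hf.2 x x') (hg.1 x) (norm_nonneg _) (by positivity)
    have h2 := mul_le_mul (hf.1 x') (hg.2 x x') (norm_nonneg _) hS
    calc _ ≤ _ := add_le_add h1 h2
      _ = _ := by ring

lemma Hol.shift {S : ℝ} {f : ℝ → E} (hf : Hol a S f) (h : ℝ) : Hol a S (fun x => f (x + h)) :=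
  ⟨fun x => hf.1 _, fun x x' => by simpa using hf.2 (x + h) (x' + h)⟩

lemma Hol.continuous (ha : 0 < a) {S : ℝ} {f : ℝ → E} (hf : Hol a S f) : Continuous f := by
  rw [continuous_iff_continuousAt]
  intro x
  rw [ContinuousAt, tendsto_iff_norm_sub_tendsto_zero]
  refine squeeze_zero (fun _ => norm_nonneg _) (fun y => hf.2 y x) ?_
  have h : Continuous (fun y : ℝ => S * |y - x| ^ a) := by
    refine continuous_const.mul ?_
    exact (continuous_id.sub continuous_const).abs.rpow_const (fun _ => Or.inr ha.le)
  have := h.tendsto x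
  simpa [Real.zero_rpow ha.ne'] using this

lemma Hol.limit {S : ℝ} {f : ℕ → ℝ → E} {g : ℝ → E} (hf : ∀ n, Hol a S (f n))
    (h : ∀ x, Tendsto (fun n => f n x) atTop (𝓝 (g x))) : Hol a S g :=
  ⟨fun x => le_of_tendsto (h x).norm (Eventually.of_forall fun n => (hf n).1 x),
    fun x x' => le_of_tendsto ((h x).sub (h x')).norm (Eventually.of_forall fun n => (hf n).2 x x')⟩

lemma hol_of_lip (ha : a ∈ Ioo (0 : ℝ) 1) {N K : ℝ} {f : ℝ → E} (hN : ∀ x, ‖f x‖ ≤ N)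
    (hK : ∀ x x', ‖f x - f x'‖ ≤ K * |x - x'|) : Hol a (2 * N + K) f := by
  have hN0 : 0 ≤ N := (norm_nonneg _).trans (hN 0)
  have hK0 : 0 ≤ K := by simpa using (norm_nonneg _).trans (hK 1 0)
  refine ⟨fun x => (hN x).trans (by linarith), fun x x' => ?_⟩
  rcases le_total |x - x'| 1 with h | h
  · have h1 : |x - x'| ≤ |x - x'| ^ a := by
      simpa using Real.rpow_le_rpow_of_exponent_ge_of_imp (abs_nonneg _) h ha.2.le
        (fun _ h0 => absurd h0 one_ne_zero)
    have : 0 ≤ |x - x'| ^ a := by positivity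
    nlinarith [hK x x', mul_le_mul_of_nonneg_left h1 hK0]
  · have h1 : 1 ≤ |x - x'| ^ a := Real.one_le_rpow h ha.1.le
    have := norm_sub_le (f x) (f x')
    nlinarith [hN x, hN x']

lemma Hol.const' (c : E) : Hol a ‖c‖ (fun _ => c) :=
  ⟨fun _ => le_rfl, fun x x' => by rw [sub_self, norm_zero]; positivity⟩

lemma two_rpow_le (ha : a ∈ Ioo (0 : ℝ) 1) {d e : ℝ} (hd : 0 ≤ d) (he : 0 ≤ e)
    (hde : d ≤ 2 * e) : d ^ a ≤ 2 * e ^ a := by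
  calc d ^ a ≤ (2 * e) ^ a := Real.rpow_le_rpow hd hde ha.1.le
    _ = 2 ^ a * e ^ a := Real.mul_rpow (by norm_num) he
    _ ≤ 2 * e ^ a := by
      gcongr
      simpa using Real.rpow_le_rpow_of_exponent_le (x := 2) (by norm_num) ha.2.le

lemma abs_add_lip {σ : ℝ → ℝ} (hσ : ∀ x x', |σ x - σ x'| ≤ |x - x'|) (x x' : ℝ) :
    |x + σ x - (x' + σ x')| ≤ 2 * |x - x'| := by
  rw [add_sub_add_comm]
  have := abs_add_le (x - x') (σ x - σ x')
  linarith [hσ x x']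

lemma Hol.comp (ha : a ∈ Ioo (0 : ℝ) 1) {S : ℝ} {f : ℝ → E} {σ : ℝ → ℝ} (hf : Hol a S f)
    (hσ : ∀ x x', |σ x - σ x'| ≤ |x - x'|) : Hol a (2 * S) (fun x => f (x + σ x)) := by
  have hS := hf.nonneg
  refine ⟨fun x => (hf.1 _).trans (by linarith), fun x x' => (hf.2 _ _).trans ?_⟩
  have := two_rpow_le ha (abs_nonneg _) (abs_nonneg _) (abs_add_lip hσ x x')
  nlinarith [mul_le_mul_of_nonneg_left this hS]

lemma DQ.nonneg {S : ℝ} {f : ℝ → E} (h : DQ a S f) : 0 ≤ S := by simpa using (h 1).nonneg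

lemma DQ.lip {S : ℝ} {f : ℝ → E} (h : DQ a S f) (x x' : ℝ) : ‖f x - f x'‖ ≤ S * |x - x'| := by
  simpa using (h (x - x')).1 x'

lemma DQ.mono {S T : ℝ} {f : ℝ → E} (h : DQ a S f) (hST : S ≤ T) : DQ a T f :=
  fun k => (h k).mono (by gcongr)

lemma DQ.add {S T : ℝ} {f g : ℝ → E} (hf : DQ a S f) (hg : DQ a T g) :
    DQ a (S + T) (fun x => f x + g x) := fun h => by
  have := (hf h).add (hg h)
  simpa only [add_sub_add_comm, add_mul] using this

lemma DQ.neg {S : ℝ} {f : ℝ → E} (hf : DQ a S f) : DQ a S (fun x => -f x) := fun h => by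
  have := (hf h).neg
  simpa only [neg_sub'] using this

lemma DQ.sub {S T : ℝ} {f g : ℝ → E} (hf : DQ a S f) (hg : DQ a T g) :
    DQ a (S + T) (fun x => f x - g x) := by
  simpa [sub_eq_add_neg] using hf.add hg.neg

lemma DQ.smul_const {S : ℝ} {f : ℝ → E} (hf : DQ a S f) (c : ℝ) :
    DQ a (|c| * S) (fun x => c • f x) := fun h => by
  have := (hf h).smul_const c
  simpa only [smul_sub, mul_assoc] using this

lemma DQ.const_mul {S : ℝ} {f : ℝ → ℝ} (hf : DQ a S f) (c : ℝ) :
    DQ a (|c| * S) (fun x => c * f x) := hf.smul_const c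

lemma DQ.const (c : E) : DQ a 0 (fun _ => c) := fun h => by simpa using Hol.zero

lemma DQ.shift {S : ℝ} {f : ℝ → E} (hf : DQ a S f) (h : ℝ) : DQ a S (fun x => f (x + h)) := by
  intro k
  have := (hf k).shift h
  simpa only [add_right_comm] using this

lemma DQ.mul {S T : ℝ} {f g : ℝ → ℝ} (hf : Hol a S f) (hf' : DQ a S f) (hg : Hol a T g)
    (hg' : DQ a T g) : DQ a (4 * S * T) (fun x => f x * g x) := fun h => by
  have h1 := (hf' h).mul (hg.shift h)
  have h2 := hf.mul (hg' h)
  have := h1.add h2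
  refine ⟨fun x => ?_, fun x x' => ?_⟩
  · convert this.1 x using 1
    · congr 1; ring
    · ring
  · convert this.2 x x' using 1
    · congr 1; ring
    · ring

lemma DQ.limit {S : ℝ} {f : ℕ → ℝ → E} {g : ℝ → E} (hf : ∀ n, DQ a S (f n))
    (h : ∀ x, Tendsto (fun n => f n x) atTop (𝓝 (g x))) : DQ a S g :=
  fun k => Hol.limit (fun n => hf n k) (fun x => (h (x + k)).sub (h x))

lemma DQ.four_point {K : ℝ} {f : ℝ → E} (hf : DQ a K f) (a₁ b₁ a₂ b₂ : ℝ) :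
    ‖f a₁ - f b₁ - (f a₂ - f b₂)‖
      ≤ K * |a₁ - b₁| * |b₁ - b₂| ^ a + K * |a₁ - b₁ - (a₂ - b₂)| := by
  have h1 := (hf (a₁ - b₁)).2 b₁ b₂
  have h2 := hf.lip (b₂ + (a₁ - b₁)) a₂
  have e : b₁ + (a₁ - b₁) = a₁ := by ring
  have e2 : b₂ + (a₁ - b₁) - a₂ = a₁ - b₁ - (a₂ - b₂) := by ring
  beta_reduce at h1
  rw [e] at h1
  rw [e2] at h2
  have e3 : f a₁ - f b₁ - (f a₂ - f b₂)
      = (f a₁ - f b₁ - (f (b₂ + (a₁ - b₁)) - f b₂)) + (f (b₂ + (a₁ - b₁)) - f a₂) := by abel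
  rw [e3]
  exact (norm_add_le _ _).trans (add_le_add h1 h2)

lemma DQ.comp_sub (ha : a ∈ Ioo (0 : ℝ) 1) {K D : ℝ} {f : ℝ → E} {σ ς : ℝ → ℝ} (hf : DQ a K f)
    (hς : ∀ x x', |ς x - ς x'| ≤ |x - x'|) (hD : Hol a D (fun x => σ x - ς x)) :
    Hol a (3 * K * D) (fun x => f (x + σ x) - f (x + ς x)) := by
  have hK := hf.nonneg
  have hD0 := hD.nonneg
  refine ⟨fun x => (hf.lip _ _).trans ?_, fun x x' => (hf.four_point _ _ _ _).trans ?_⟩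
  · have := hD.1 x
    rw [add_sub_add_left_eq_sub]
    rw [Real.norm_eq_abs] at this
    nlinarith [mul_le_mul_of_nonneg_left this hK, mul_nonneg hK hD0]
  · have h1 := hD.1 x
    have h2 := hD.2 x x'
    have h3 := two_rpow_le ha (abs_nonneg _) (abs_nonneg _) (abs_add_lip hς x x')
    rw [add_sub_add_left_eq_sub, add_sub_add_left_eq_sub]
    rw [Real.norm_eq_abs] at h1 h2
    calc _ ≤ K * D * (2 * |x - x'| ^ a) + K * (D * |x - x'| ^ a) := by gcongr
      _ = _ := by ring

lemma DQ.comp (ha : a ∈ Ioo (0 : ℝ) 1) {K : ℝ} {f : ℝ → E} {σ : ℝ → ℝ} (hf : DQ a K f)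
    (hσ : DQ a 1 σ) : DQ a (6 * K) (fun x => f (x + σ x)) := by
  intro h
  have hl : ∀ x x', |σ x - σ x'| ≤ |x - x'| := fun x x' => by simpa using hσ.lip x x'
  have hD : Hol a (2 * |h|) (fun x => (h + σ (x + h)) - σ x) := by
    have := (Hol.const' (a := a) h).add (hσ h)
    refine ⟨fun x => ?_, fun x x' => ?_⟩
    · convert this.1 x using 1
      · congr 1; ring
      · rw [Real.norm_eq_abs]; ring
    · convert this.2 x x' using 1
      · congr 1; ring
      · rw [Real.norm_eq_abs]; ring
  have := hf.comp_sub ha hl hD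
  convert this using 1
  · ring
  · funext x; beta_reduce; rw [add_assoc]

/-- Any point is at distance at most one from a representative modulo the period. -/
lemma per_add_int {F : Type*} {f : ℝ → F} (hf : Function.Periodic f 1) (x : ℝ) (n : ℤ) :
    f (x + n) = f x := by simpa using hf.int_mul n x

lemma abs_sub_le_of_per {K : ℝ} {f : ℝ → E} (hf : Function.Periodic f 1)
    (hK : ∀ x x', ‖f x - f x'‖ ≤ K * |x - x'|) (x x' : ℝ) : ‖f x - f x'‖ ≤ K := by
  have hK0 : 0 ≤ K := by simpa using (norm_nonneg _).trans (hK 1 0)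
  have h := hK (x + ((⌊x' - x⌋ : ℤ) : ℝ)) x'
  rw [per_add_int hf] at h
  refine h.trans ?_
  have h1 := Int.floor_le (x' - x)
  have h2 := Int.lt_floor_add_one (x' - x)
  have : |x + (⌊x' - x⌋ : ℝ) - x'| ≤ 1 := by rw [abs_le]; constructor <;> linarith
  nlinarith

/-- Average over one period. -/
def avg (f : ℝ → ℝ) : ℝ := ∫ x in (0 : ℝ)..1, f x

lemma abs_avg_le {S : ℝ} {f : ℝ → ℝ} (hf : ∀ x, |f x| ≤ S) : |avg f| ≤ S := by
  have := intervalIntegral.norm_integral_le_of_norm_le_const (a := (0 : ℝ)) (b := 1) (f := f)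
    (C := S) (fun x _ => hf x)
  simpa [avg] using this

lemma Hol.sub_avg {S : ℝ} {f : ℝ → ℝ} (hf : Hol a S f) :
    Hol a (2 * S) (fun x => f x - avg f) := by
  have h := hf.sub (Hol.const' (a := a) (avg f))
  refine h.mono ?_
  have := abs_avg_le (f := f) hf.1
  rw [Real.norm_eq_abs]; linarith

lemma DQ.sub_avg {S : ℝ} {f : ℝ → ℝ} (hf : DQ a S f) : DQ a S (fun x => f x - avg f) := by
  simpa using hf.sub (DQ.const (avg f))

lemma DQ.continuous {S : ℝ} {f : ℝ → E} (hf : DQ a S f) : Continuous f := by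
  refine (LipschitzWith.of_dist_le_mul (K := ⟨S, hf.nonneg⟩) fun x y => ?_).continuous
  rw [dist_eq_norm, Real.dist_eq]; exact hf.lip x y

/-- A function with vanishing average and Lipschitz bound `K` is bounded by `K`. -/
lemma abs_le_of_avg_zero {K : ℝ} {f : ℝ → ℝ} (hc : Continuous f) (hf : Function.Periodic f 1)
    (hK : ∀ x x', ‖f x - f x'‖ ≤ K * |x - x'|) (h0 : avg f = 0) (x : ℝ) : |f x| ≤ K := by
  have : f x = avg (fun y => f x - f y) := by
    have h1 : avg (fun y => f x - f y) = f x - avg f := by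
      unfold avg
      rw [intervalIntegral.integral_sub (by simp) (hc.intervalIntegrable _ _)]; simp
    rw [h1, h0, sub_zero]
  rw [this]
  exact abs_avg_le fun y => abs_sub_le_of_per hf hK x y

lemma lip_of_hasDerivAt {S : ℝ} {f f' : ℝ → E} (h : ∀ x, HasDerivAt f (f' x) x)
    (hS : ∀ x, ‖f' x‖ ≤ S) (x x' : ℝ) : ‖f x - f x'‖ ≤ S * |x - x'| := by
  have := convex_univ.norm_image_sub_le_of_norm_hasDerivWithin_le (f := f) (f' := f') (C := S)
    (fun x _ => (h x).hasDerivWithinAt) (fun x _ => hS x) (mem_univ x') (mem_univ x)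
  simpa using this

/-- Difference quotient bounds follow from Hölder bounds on the derivative. -/
lemma DQ.of_hasDerivAt {S : ℝ} {f f' : ℝ → E} (h : ∀ x, HasDerivAt f (f' x) x)
    (hS : Hol a S f') : DQ a S f := by
  intro k
  refine ⟨fun x => by simpa using lip_of_hasDerivAt h hS.1 (x + k) x, fun x x' => ?_⟩
  have key : ∀ y, HasDerivAt (fun s => f (x + s) - f (x' + s)) (f' (x + y) - f' (x' + y)) y :=
    fun y => ((h (x + y)).comp_const_add x y).sub ((h (x' + y)).comp_const_add x' y)
  have := lip_of_hasDerivAt key (S := S * |x - x'| ^ a)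
    (fun y => by simpa using hS.2 (x + y) (x' + y)) k 0
  calc _ = ‖f (x + k) - f (x' + k) - (f (x + 0) - f (x' + 0))‖ := by
        congr 1; simp only [add_zero]; abel
    _ ≤ _ := this
    _ = _ := by rw [sub_zero]; ring

end HolderCalculus

section Kernel

open Filter Topology MeasureTheory

/-- The positive frequencies `2 * π * i * (n + 1)`. -/
def om (n : ℕ) : ℂ := 2 * Real.pi * (n + 1 : ℝ) * Complex.I

/-- Decay rates `2 * π * (n + 1)`. -/
def mu (n : ℕ) : ℝ := 2 * Real.pi * (n + 1)

lemma mu_pos (n : ℕ) : 0 < mu n := by unfold mu; positivity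

lemma om_eq (n : ℕ) : om n = mu n * Complex.I := by unfold om mu; push_cast; ring

lemma norm_om (n : ℕ) : ‖om n‖ = mu n := by
  rw [om_eq, norm_mul, Complex.norm_I, mul_one, Complex.norm_real, Real.norm_eq_abs,
    abs_of_pos (mu_pos n)]

/-- Fourier coefficient at frequency `n + 1`. -/
def cf (n : ℕ) (f : ℝ → ℂ) : ℂ := ∫ s in (0 : ℝ)..1, f s * Complex.exp (-(om n * s))

lemma norm_exp_om (n : ℕ) (z : ℂ) : ‖Complex.exp (om n * z)‖ = Real.exp (-(mu n * z.im)) := by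
  rw [Complex.norm_exp, om_eq]; congr 1; simp

lemma norm_exp_om_real (n : ℕ) (x : ℝ) : ‖Complex.exp (om n * x)‖ = 1 := by
  rw [norm_exp_om]; simp

lemma norm_exp_neg_om_real (n : ℕ) (x : ℝ) : ‖Complex.exp (-(om n * x))‖ = 1 := by
  have := norm_exp_om_real n (-x)
  simpa using this

lemma norm_cf_le {n : ℕ} {f : ℝ → ℂ} {S : ℝ} (hf : ∀ x, ‖f x‖ ≤ S) : ‖cf n f‖ ≤ S := by
  have := intervalIntegral.norm_integral_le_of_norm_le_const (a := (0 : ℝ)) (b := 1)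
    (f := fun s : ℝ => f s * Complex.exp (-(om n * s)))
    (C := S) (fun x _ => by rw [norm_mul, norm_exp_neg_om_real, mul_one]; exact hf x)
  simpa [cf] using this

lemma exp_om_add_one (n : ℕ) (z : ℂ) : Complex.exp (om n * (z + 1)) = Complex.exp (om n * z) := by
  rw [mul_add, Complex.exp_add]
  have : Complex.exp (om n * 1) = 1 := by
    rw [Complex.exp_eq_one_iff]
    exact ⟨n + 1, by unfold om; push_cast; ring⟩
  rw [this, mul_one]

lemma summable_mu_exp {t : ℝ} (ht : 0 < t) : Summable fun n => mu n * Real.exp (-(mu n * t)) := by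
  have h : Summable fun n : ℕ => (n : ℝ) ^ 1 * (Real.exp (-(2 * Real.pi * t))) ^ n :=
    summable_pow_mul_geometric_of_norm_lt_one 1 (by
      rw [Real.norm_eq_abs, abs_of_pos (Real.exp_pos _), Real.exp_lt_one_iff]
      have := Real.pi_pos; nlinarith [mul_pos this ht])
  have h2 := ((summable_nat_add_iff 1).2 h).mul_left (2 * Real.pi)
  refine h2.congr fun n => ?_
  rw [← Real.exp_nat_mul]
  unfold mu
  push_cast
  rw [pow_one, ← mul_assoc]
  congr 2
  ring

/-- The kernel `∑ ωₙ e^{ωₙ z}`. -/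
def ker (z : ℂ) : ℂ := ∑' n, om n * Complex.exp (om n * z)

lemma summable_ker {z : ℂ} (hz : 0 < z.im) : Summable fun n => om n * Complex.exp (om n * z) := by
  refine Summable.of_norm ((summable_mu_exp hz).congr fun n => ?_)
  rw [norm_mul, norm_om, norm_exp_om]

lemma ker_eq {z : ℂ} (hz : 0 < z.im) :
    ker z = 2 * Real.pi * Complex.I * (Complex.exp (2 * Real.pi * Complex.I * z) /
      (1 - Complex.exp (2 * Real.pi * Complex.I * z)) ^ 2) := by
  set q := Complex.exp (2 * Real.pi * Complex.I * z) with hq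
  have hq1 : ‖q‖ < 1 := by
    rw [hq, Complex.norm_exp, Real.exp_lt_one_iff]
    simp
    have := Real.pi_pos; positivity
  rw [← tsum_coe_mul_geometric_of_norm_lt_one hq1]
  have hs := (hasSum_coe_mul_geometric_of_norm_lt_one hq1).summable
  rw [hs.tsum_eq_zero_add, Nat.cast_zero, zero_mul, zero_add, ← tsum_mul_left]
  unfold ker
  refine tsum_congr fun n => ?_
  rw [hq, ← Complex.exp_nat_mul]
  unfold om
  push_cast
  rw [show 2 * (Real.pi : ℂ) * (n + 1) * Complex.I * z
    = (n + 1) * (2 * Real.pi * Complex.I * z) by ring]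
  ring

lemma norm_ker_le {x t : ℝ} (hx : |x| ≤ 1 / 2) (ht : 0 < t) :
    ‖ker (x + t * Complex.I)‖ ≤ 1 / (t ^ 2 + x ^ 2) := by
  rw [ker_eq (by simpa using ht)]
  set r := Real.exp (-(2 * Real.pi * t)) with hr
  have hr0 : 0 < r := Real.exp_pos _
  have hq : Complex.exp (2 * Real.pi * Complex.I * (x + t * Complex.I))
      = r * (Complex.cos (2 * Real.pi * x) + Complex.sin (2 * Real.pi * x) * Complex.I) := by
    rw [← Complex.exp_mul_I, hr, Complex.ofReal_exp, ← Complex.exp_add]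
    congr 1; push_cast; ring_nf; rw [Complex.I_sq]; ring
  have hre : (1 - Complex.exp (2 * Real.pi * Complex.I * (x + t * Complex.I))).re
      = 1 - r * Real.cos (2 * Real.pi * x) := by
    rw [hq, show (2 * (Real.pi : ℂ) * x) = ((2 * Real.pi * x : ℝ) : ℂ) by push_cast; ring,
      ← Complex.ofReal_cos, ← Complex.ofReal_sin]
    simp [-Complex.ofReal_cos, -Complex.ofReal_sin]
  have him : (1 - Complex.exp (2 * Real.pi * Complex.I * (x + t * Complex.I))).im
      = - (r * Real.sin (2 * Real.pi * x)) := by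
    rw [hq, show (2 * (Real.pi : ℂ) * x) = ((2 * Real.pi * x : ℝ) : ℂ) by push_cast; ring,
      ← Complex.ofReal_cos, ← Complex.ofReal_sin]
    simp [-Complex.ofReal_cos, -Complex.ofReal_sin]
  have hn : ‖Complex.exp (2 * Real.pi * Complex.I * (x + t * Complex.I))‖ = r := by
    rw [Complex.norm_exp, hr]; congr 1; simp
  have hn2 : ‖1 - Complex.exp (2 * Real.pi * Complex.I * (x + t * Complex.I))‖ ^ 2
      = 1 - 2 * r * Real.cos (2 * Real.pi * x) + r ^ 2 := by
    rw [← Complex.normSq_eq_norm_sq, Complex.normSq_apply, hre, him]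
    have := Real.sin_sq_add_cos_sq (2 * Real.pi * x)
    linear_combination r ^ 2 * this
  rw [norm_mul, norm_div, norm_pow, hn, hn2]
  have hpi := Real.pi_pos
  have hpi3 := Real.pi_gt_three
  have h2pi : ‖(2 * Real.pi * Complex.I : ℂ)‖ = 2 * Real.pi := by
    simp [abs_of_pos hpi]
  rw [h2pi]
  have hcos : Real.cos (2 * Real.pi * x) ≤ 1 - 8 * x ^ 2 := by
    have h := Real.cos_le_one_sub_mul_cos_sq (x := 2 * Real.pi * x) (by
      rw [abs_mul, abs_of_pos (by positivity)]; nlinarith)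
    have : 2 / Real.pi ^ 2 * (2 * Real.pi * x) ^ 2 = 8 * x ^ 2 := by field_simp; ring
    linarith
  have hcosh : 2 + (2 * Real.pi * t) ^ 2 ≤ r + r⁻¹ := by
    have h1 : r⁻¹ = Real.exp (2 * Real.pi * t) := by rw [hr, Real.exp_neg, inv_inv]
    have h2 : Real.cosh (2 * Real.pi * t) = 1 + 2 * Real.sinh (Real.pi * t) ^ 2 := by
      rw [mul_assoc, Real.cosh_two_mul, Real.cosh_sq]; ring
    have h3 : Real.pi * t ≤ Real.sinh (Real.pi * t) := Real.self_le_sinh_iff.2 (by positivity)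
    have h4 : (Real.pi * t) ^ 2 ≤ Real.sinh (Real.pi * t) ^ 2 := by gcongr
    rw [Real.cosh_eq] at h2
    rw [h1, hr]; nlinarith
  have hmain : r * (16 * x ^ 2 + 4 * Real.pi ^ 2 * t ^ 2)
      ≤ 1 - 2 * r * Real.cos (2 * Real.pi * x) + r ^ 2 := by
    have h3 : r * (2 + (2 * Real.pi * t) ^ 2) ≤ r * (r + r⁻¹) := by gcongr
    have h4 : r * (r + r⁻¹) = r ^ 2 + 1 := by field_simp
    nlinarith [mul_le_mul_of_nonneg_left hcos hr0.le]
  have hpos : 0 < r * (16 * x ^ 2 + 4 * Real.pi ^ 2 * t ^ 2) := by positivity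
  calc 2 * Real.pi * (r / (1 - 2 * r * Real.cos (2 * Real.pi * x) + r ^ 2))
      ≤ 2 * Real.pi * (r / (r * (16 * x ^ 2 + 4 * Real.pi ^ 2 * t ^ 2))) := by gcongr
    _ = 2 * Real.pi / (16 * x ^ 2 + 4 * Real.pi ^ 2 * t ^ 2) := by field_simp
    _ ≤ 1 / (t ^ 2 + x ^ 2) := by
      rw [div_le_div_iff₀ (by positivity) (by positivity)]
      have := Real.pi_lt_four
      have h5 : 0 ≤ (16 - 2 * Real.pi) * x ^ 2 := mul_nonneg (by linarith) (sq_nonneg _)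
      have h6 : 0 ≤ (4 * Real.pi ^ 2 - 2 * Real.pi) * t ^ 2 :=
        mul_nonneg (by nlinarith) (sq_nonneg _)
      nlinarith

lemma cf_const (n : ℕ) (c : ℂ) : cf n (fun _ => c) = 0 := by
  have hom : om n ≠ 0 := by
    rw [← norm_ne_zero_iff, norm_om]; exact (mu_pos n).ne'
  have h := integral_exp_mul_complex (a := 0) (b := 1) (c := -om n) (neg_ne_zero.2 hom)
  have h1 := exp_om_add_one n (-1)
  simp only [neg_add_cancel, mul_zero, Complex.exp_zero] at h1
  unfold cf
  rw [intervalIntegral.integral_const_mul]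
  simp only [neg_mul] at h
  rw [h]
  simp only [mul_neg, mul_one] at h1
  simp [← h1]

lemma continuous_exp_neg_om (n : ℕ) : Continuous fun s : ℝ => Complex.exp (-(om n * s)) := by
  fun_prop

lemma cf_sub {n : ℕ} {f g : ℝ → ℂ} (hf : Continuous f) (hg : Continuous g) :
    cf n (fun s => f s - g s) = cf n f - cf n g := by
  unfold cf
  simp only [sub_mul]
  exact intervalIntegral.integral_sub
    ((hf.mul (continuous_exp_neg_om n)).intervalIntegrable _ _)
    ((hg.mul (continuous_exp_neg_om n)).intervalIntegrable _ _)

/-- The holomorphic function `∑ ωₙ cₙ(r) e^{ωₙ z}` in the upper half plane. -/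
def gk (r : ℝ → ℂ) (z : ℂ) : ℂ := ∑' n, om n * cf n r * Complex.exp (om n * z)

lemma norm_gk_term_le {r : ℝ → ℂ} {S : ℝ} (hS : ∀ x, ‖r x‖ ≤ S) (n : ℕ) (z : ℂ) :
    ‖om n * cf n r * Complex.exp (om n * z)‖ ≤ S * (mu n * Real.exp (-(mu n * z.im))) := by
  rw [norm_mul, norm_mul, norm_om, norm_exp_om]
  have := norm_cf_le (n := n) hS
  have h2 := mul_pos (mu_pos n) (Real.exp_pos (-(mu n * z.im)))
  nlinarith [mul_le_mul_of_nonneg_left this h2.le]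

lemma gk_eq {r : ℝ → ℂ} (hr : Continuous r) {S : ℝ} (hS : ∀ x, ‖r x‖ ≤ S) {z : ℂ}
    (hz : 0 < z.im) : gk r z = ∫ s in (0 : ℝ)..1, r s * ker (z - s) := by
  have key := intervalIntegral.hasSum_integral_of_dominated_convergence (a := (0 : ℝ)) (b := 1)
    (μ := volume) (F := fun (n : ℕ) (s : ℝ) => r s * (om n * Complex.exp (om n * (z - s))))
    (f := fun s => r s * ker (z - s))
    (fun n _ => S * (mu n * Real.exp (-(mu n * z.im))))
    (fun n => by
      refine Continuous.aestronglyMeasurable ?_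
      fun_prop)
    (fun n => Eventually.of_forall fun s _ => by
      rw [norm_mul, norm_mul, norm_om, norm_exp_om]
      simp only [Complex.sub_im, Complex.ofReal_im, sub_zero]
      exact mul_le_mul_of_nonneg_right (hS s)
        (mul_pos (mu_pos n) (Real.exp_pos _)).le)
    (Eventually.of_forall fun s _ => (summable_mu_exp hz).mul_left _)
    (by simp)
    (Eventually.of_forall fun s _ => ((summable_ker (by simpa using hz)).hasSum).mul_left _)
  rw [← key.tsum_eq]
  unfold gk
  refine tsum_congr fun n => ?_
  unfold cf
  rw [← intervalIntegral.integral_const_mul, ← intervalIntegral.integral_mul_const]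
  refine intervalIntegral.integral_congr fun s _ => ?_
  rw [mul_sub, sub_eq_add_neg, Complex.exp_add]
  ring

lemma ker_sub_periodic (z : ℂ) : Function.Periodic (fun s : ℝ => ker (z - s)) 1 := by
  intro s
  unfold ker
  refine tsum_congr fun n => ?_
  rw [← exp_om_add_one n (z - ((s + 1 : ℝ) : ℂ))]
  congr 3; push_cast; ring

/-- The constant in the boundary growth estimate. -/
def kc (a : ℝ) : ℝ := ∫ x : ℝ, |x| ^ a / (1 + x ^ 2)

lemma integrable_kc {a : ℝ} (ha : a ∈ Ioo (0 : ℝ) 1) :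
    Integrable fun x : ℝ => |x| ^ a / (1 + x ^ 2) := by
  have h := integrable_rpow_neg_one_add_norm_sq (E := ℝ) (μ := volume) (r := 2 - a)
    (by simp; linarith [ha.2])
  refine h.mono ?_ (Eventually.of_forall fun x => ?_)
  · refine Continuous.aestronglyMeasurable ?_
    refine Continuous.div ?_ (by fun_prop) (fun x => by positivity)
    exact continuous_abs.rpow_const fun _ => Or.inr ha.1.le
  · have h1 : 0 < 1 + x ^ 2 := by positivity
    have h2 : |x| ^ a ≤ (1 + x ^ 2) ^ (a / 2) := by
      have : |x| ^ a = (x ^ 2) ^ (a / 2) := by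
        rw [← sq_abs, ← Real.rpow_natCast, ← Real.rpow_mul (abs_nonneg _)]; congr 1; push_cast; ring
      rw [this]
      exact Real.rpow_le_rpow (sq_nonneg _) (by linarith) (by linarith [ha.1])
    have e1 : ‖|x| ^ a / (1 + x ^ 2)‖ = |x| ^ a / (1 + x ^ 2) := by
      rw [Real.norm_eq_abs, abs_of_nonneg (by positivity)]
    have e2 : ‖(1 + ‖x‖ ^ 2) ^ (-(2 - a) / 2)‖ = (1 + x ^ 2) ^ (-(2 - a) / 2) := by
      rw [Real.norm_eq_abs, Real.norm_eq_abs, sq_abs, abs_of_nonneg (by positivity)]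
    rw [e1, e2]
    calc |x| ^ a / (1 + x ^ 2) ≤ (1 + x ^ 2) ^ (a / 2) / (1 + x ^ 2) := by gcongr
      _ = (1 + x ^ 2) ^ (-(2 - a) / 2) := by
        rw [show -(2 - a) / 2 = a / 2 - 1 by ring, Real.rpow_sub_one h1.ne']

lemma kc_nonneg (a : ℝ) : 0 ≤ kc a := integral_nonneg fun x => by positivity

lemma integral_kc_scaled {a t : ℝ} (ha : a ∈ Ioo (0 : ℝ) 1) (ht : 0 < t) :
    Integrable (fun x : ℝ => |x| ^ a / (t ^ 2 + x ^ 2)) ∧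
    ∫ x : ℝ, |x| ^ a / (t ^ 2 + x ^ 2) = kc a * t ^ (a - 1) := by
  have e : (fun x : ℝ => |x| ^ a / (t ^ 2 + x ^ 2))
      = fun x => t ^ (a - 2) * (fun y : ℝ => |y| ^ a / (1 + y ^ 2)) (x / t) := by
    funext x
    beta_reduce
    rw [abs_div, abs_of_pos ht, Real.div_rpow (abs_nonneg _) ht.le, Real.rpow_sub ht]
    have : 0 < t ^ a := Real.rpow_pos_of_pos ht _
    rw [show (2 : ℝ) = ((2 : ℕ) : ℝ) by norm_num, Real.rpow_natCast]
    field_simp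
  constructor
  · rw [e]
    exact ((integrable_kc ha).comp_div ht.ne').const_mul _
  · rw [e, integral_const_mul, Measure.integral_comp_div (fun y : ℝ => |y| ^ a / (1 + y ^ 2)) t,
      abs_of_pos ht, smul_eq_mul]
    change _ * (t * kc a) = _
    rw [show a - 1 = a - 2 + 1 by ring, Real.rpow_add_one ht.ne']
    ring

lemma norm_gk_le {a S : ℝ} (ha : a ∈ Ioo (0 : ℝ) 1) {r : ℝ → ℂ} (hp : Function.Periodic r 1)
    (hr : Hol a S r) (x : ℝ) {t : ℝ} (ht : 0 < t) :
    ‖gk r (x + t * Complex.I)‖ ≤ kc a * S * t ^ (a - 1) := by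
  have hc := hr.continuous ha.1
  have hS := hr.nonneg
  have e1 : gk r (x + t * Complex.I) = gk (fun s => r s - r x) (x + t * Complex.I) := by
    unfold gk
    refine tsum_congr fun n => ?_
    rw [cf_sub hc continuous_const, cf_const, sub_zero]
  have hz : 0 < ((x : ℂ) + t * Complex.I).im := by simpa using ht
  rw [e1, gk_eq (r := fun s => r s - r x) (hc.sub continuous_const) (S := 2 * S) (fun s => by
    have := norm_sub_le (r s) (r x); linarith [hr.1 s, hr.1 x]) hz]
  have hper : Function.Periodic
      (fun s : ℝ => (r s - r x) * ker ((x : ℂ) + t * Complex.I - s)) 1 := by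
    intro s
    have := ker_sub_periodic ((x : ℂ) + t * Complex.I) s
    beta_reduce at this ⊢
    rw [this, hp s]
  have e2 := hper.intervalIntegral_add_eq 0 (x - 1 / 2)
  rw [zero_add] at e2
  rw [e2]
  obtain ⟨hi, hv⟩ := integral_kc_scaled ha ht
  have hi2 : Integrable (fun s : ℝ => S * (|s - x| ^ a / (t ^ 2 + (s - x) ^ 2))) :=
    (hi.comp_sub_right x).const_mul S
  have hle : x - 1 / 2 ≤ x - 1 / 2 + 1 := by linarith
  have h1 := intervalIntegral.norm_integral_le_of_norm_le (μ := volume) hle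
    (f := fun s : ℝ => (r s - r x) * ker ((x : ℂ) + t * Complex.I - s))
    (g := fun s => S * (|s - x| ^ a / (t ^ 2 + (s - x) ^ 2)))
    (Eventually.of_forall fun s hs => by
      rw [norm_mul]
      have hb : ‖ker ((x : ℂ) + t * Complex.I - s)‖ ≤ 1 / (t ^ 2 + (s - x) ^ 2) := by
        have h2 := norm_ker_le (x := x - s) (t := t)
          (by rw [abs_le]; constructor <;> linarith [hs.1, hs.2]) ht
        have e3 : (x : ℂ) + t * Complex.I - s = ((x - s : ℝ) : ℂ) + t * Complex.I := by
          push_cast; ring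
        rw [e3, show (s - x) ^ 2 = (x - s) ^ 2 by ring]
        exact h2
      calc _ ≤ (S * |s - x| ^ a) * (1 / (t ^ 2 + (s - x) ^ 2)) := by
            gcongr
            exact hr.2 s x
        _ = _ := by ring)
    hi2.intervalIntegrable
  refine h1.trans ?_
  have h3 : ∫ s in (x - 1 / 2)..(x - 1 / 2 + 1), S * (|s - x| ^ a / (t ^ 2 + (s - x) ^ 2))
      ≤ ∫ s, S * (|s - x| ^ a / (t ^ 2 + (s - x) ^ 2)) := by
    rw [intervalIntegral.integral_of_le hle]
    exact setIntegral_le_integral hi2 (Eventually.of_forall fun s => by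
      simp only [Pi.zero_apply]; positivity)
  refine h3.trans (le_of_eq ?_)
  rw [integral_const_mul, integral_sub_right_eq_self (fun s : ℝ => |s| ^ a / (t ^ 2 + s ^ 2)) x, hv]
  ring

lemma gk_differentiableOn {r : ℝ → ℂ} {S : ℝ} (hS : ∀ x, ‖r x‖ ≤ S) {t : ℝ} (ht : 0 < t) :
    DifferentiableOn ℂ (gk r) {z : ℂ | t < z.im} := by
  unfold gk
  have hS0 : 0 ≤ S := (norm_nonneg _).trans (hS 0)
  refine Complex.differentiableOn_tsum_of_summable_norm ((summable_mu_exp ht).mul_left S)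
    (fun n => by fun_prop) (isOpen_lt continuous_const Complex.continuous_im)
    (fun n z hz => (norm_gk_term_le hS n z).trans ?_)
  have : mu n * t ≤ mu n * z.im := mul_le_mul_of_nonneg_left (le_of_lt hz) (mu_pos n).le
  have hm := (mu_pos n).le
  gcongr

lemma norm_gk_sub_le {a S : ℝ} (ha : a ∈ Ioo (0 : ℝ) 1) {r : ℝ → ℂ} (hp : Function.Periodic r 1)
    (hr : Hol a S r) (x x' : ℝ) {t : ℝ} (ht : 0 < t) :
    ‖gk r (x + t * Complex.I) - gk r (x' + t * Complex.I)‖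
      ≤ 4 * kc a * S * t ^ (a - 2) * |x - x'| := by
  have hS := hr.nonneg
  have hk := kc_nonneg a
  have hd := gk_differentiableOn hr.1 (t := t / 4) (by linarith)
  have hopen : IsOpen {z : ℂ | t / 4 < z.im} := isOpen_lt continuous_const Complex.continuous_im
  have hp4 : 0 < t ^ (a - 2) := Real.rpow_pos_of_pos ht _
  have hderiv : ∀ y : ℝ, ‖deriv (gk r) (y + t * Complex.I)‖ ≤ 4 * kc a * S * t ^ (a - 2) := by
    intro y
    have hb : ∀ z ∈ Metric.closedBall ((y : ℂ) + t * Complex.I) (t / 2), t / 2 ≤ z.im := by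
      intro z hz
      rw [Metric.mem_closedBall, dist_eq_norm] at hz
      have h1 := (Complex.abs_im_le_norm (z - ((y : ℂ) + t * Complex.I))).trans hz
      simp only [Complex.sub_im, Complex.add_im, Complex.ofReal_im, Complex.mul_im,
        Complex.I_im, Complex.I_re, Complex.ofReal_re, mul_one, mul_zero, add_zero, zero_add] at h1
      linarith [(abs_le.1 h1).1]
    have h := Complex.norm_deriv_le_of_forall_mem_sphere_norm_le (f := gk r)
      (c := (y : ℂ) + t * Complex.I) (R := t / 2) (C := 2 * kc a * S * t ^ (a - 1)) (by linarith)
      (by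
        refine DifferentiableOn.diffContOnCl_ball (U := {z : ℂ | t / 4 < z.im}) hd ?_
        intro z hz
        have := hb z hz
        simp only [mem_ofPred_eq]; linarith)
      (fun z hz => by
        have hz' := hb z (Metric.sphere_subset_closedBall hz)
        have hz0 : 0 < z.im := by linarith
        have h2 := norm_gk_le ha hp hr z.re hz0
        rw [Complex.re_add_im] at h2
        refine h2.trans ?_
        have h3 : z.im ^ (a - 1) ≤ (t / 2) ^ (a - 1) :=
          Real.rpow_le_rpow_of_nonpos (by linarith) hz' (by linarith [ha.2])
        have h4 : (t / 2) ^ (a - 1) ≤ 2 * t ^ (a - 1) := by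
          rw [Real.div_rpow ht.le (by norm_num), div_eq_mul_inv, ← Real.rpow_neg (by norm_num),
            mul_comm]
          gcongr
          simpa using Real.rpow_le_rpow_of_exponent_le (x := 2) (by norm_num)
            (show -(a - 1) ≤ 1 by linarith [ha.1])
        calc kc a * S * z.im ^ (a - 1) ≤ kc a * S * (2 * t ^ (a - 1)) := by
              gcongr; exact h3.trans h4
          _ = _ := by ring)
    refine h.trans (le_of_eq ?_)
    rw [show a - 1 = a - 2 + 1 by ring, Real.rpow_add_one ht.ne']
    field_simp
    ring
  have hline : ∀ y : ℝ, HasDerivAt (fun y : ℝ => gk r (y + t * Complex.I))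
      (deriv (gk r) (y + t * Complex.I)) y := by
    intro y
    have h1 : HasDerivAt (gk r) (deriv (gk r) (y + t * Complex.I)) (y + t * Complex.I) := by
      refine (hd.differentiableAt (hopen.mem_nhds ?_)).hasDerivAt
      simp only [mem_ofPred_eq, Complex.add_im, Complex.ofReal_im, Complex.mul_im,
        Complex.I_im, Complex.I_re, Complex.ofReal_re, mul_one, mul_zero, add_zero, zero_add]
      linarith
    have h2 : HasDerivAt (fun y : ℝ => (y : ℂ) + t * Complex.I) 1 y :=
      (Complex.ofRealCLM.hasDerivAt (x := y)).add_const _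
    have h3 := h1.comp y h2
    rw [mul_one] at h3
    exact h3
  exact lip_of_hasDerivAt hline hderiv x x'

end Kernel

section FourierInversion

open Filter Topology MeasureTheory

lemma cf_shift {n : ℕ} {f : ℝ → ℂ} (hp : Function.Periodic f 1) (h : ℝ) :
    cf n (fun s => f (s + h)) = Complex.exp (om n * h) * cf n f := by
  have hper : Function.Periodic (fun s : ℝ => f s * Complex.exp (-(om n * s))) 1 := by
    intro s
    have := exp_om_add_one n (-((s + 1 : ℝ) : ℂ))
    beta_reduce
    rw [hp s, ← mul_neg, ← this]
    congr 2; push_cast; ring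
  have h1 := hper.intervalIntegral_add_eq h 0
  rw [zero_add] at h1
  unfold cf
  rw [← h1, ← intervalIntegral.integral_const_mul]
  have h2 := intervalIntegral.integral_comp_add_right (a := (0 : ℝ)) (b := 1)
    (fun s : ℝ => Complex.exp (om n * h) * (f s * Complex.exp (-(om n * s)))) h
  rw [zero_add, add_comm 1 h] at h2
  rw [← h2]
  refine intervalIntegral.integral_congr fun s _ => ?_
  beta_reduce
  rw [mul_left_comm, ← Complex.exp_add]
  congr 2; push_cast; ring

/-- Decay rate of Fourier coefficients of `C^{1,a}` functions. -/
def dec (a : ℝ) (n : ℕ) : ℝ := (1 / (2 * (n + 1)) : ℝ) ^ (1 + a)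

lemma dec_nonneg (a : ℝ) (n : ℕ) : 0 ≤ dec a n := by unfold dec; positivity

lemma summable_dec {a : ℝ} (ha : 0 < a) : Summable (dec a) := by
  have h := (Real.summable_one_div_nat_rpow (p := 1 + a)).2 (by linarith)
  have h2 := ((summable_nat_add_iff 1).2 h).mul_left ((1 / 2 : ℝ) ^ (1 + a))
  refine h2.congr fun n => ?_
  unfold dec
  rw [Real.div_rpow (by norm_num) (by positivity), Real.div_rpow (by norm_num) (by positivity),
    Real.mul_rpow (by norm_num) (by positivity)]
  push_cast
  simp only [Real.one_rpow]
  field_simp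

lemma norm_cf_le_dec {a S : ℝ} {n : ℕ} {f : ℝ → ℂ} (hp : Function.Periodic f 1)
    (hf : DQ a S f) : ‖cf n f‖ ≤ S * dec a n := by
  set h : ℝ := 1 / (2 * (n + 1)) with hh
  have hpos : 0 < h := by positivity
  have hc := hf.continuous
  have he : Complex.exp (om n * h) = -1 := by
    rw [← Complex.exp_pi_mul_I]
    congr 1
    unfold om
    rw [hh]
    push_cast
    have : (n : ℂ) + 1 ≠ 0 := by exact_mod_cast Nat.succ_ne_zero n
    field_simp
  have hp1 : Function.Periodic (fun s => f (s + h) - f s) 1 := by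
    intro s
    beta_reduce
    rw [show s + 1 + h = s + h + 1 by ring, hp, hp]
  have hc1 : Continuous (fun s => f (s + h)) := by fun_prop
  have e1 : cf n (fun s => f (s + h) - f s) = -2 * cf n f := by
    rw [cf_sub hc1 hc, cf_shift hp, he]; ring
  have hc2 : Continuous (fun s => f (s + h) - f s) := by fun_prop
  have e2 : cf n (fun s => (f (s + h + h) - f (s + h)) - (f (s + h) - f s)) = 4 * cf n f := by
    rw [cf_sub (by fun_prop) hc2, cf_shift hp1, he, e1]; ring
  have hb : ‖(4 : ℂ) * cf n f‖ ≤ S * h * h ^ a := by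
    rw [← e2]
    refine norm_cf_le fun x => ?_
    have := (hf h).2 (x + h) x
    simpa [abs_of_pos hpos] using this
  rw [norm_mul] at hb
  have h3 : S * h * h ^ a = S * dec a n := by
    unfold dec
    rw [← hh, Real.rpow_add hpos, Real.rpow_one]; ring
  rw [h3] at hb
  have : ‖(4 : ℂ)‖ = 4 := by norm_num
  rw [this] at hb
  linarith [norm_nonneg (cf n f)]

lemma summable_cf {a S : ℝ} (ha : 0 < a) {f : ℝ → ℂ} (hp : Function.Periodic f 1)
    (hf : DQ a S f) (x : ℝ) : Summable fun n => cf n f * Complex.exp (om n * x) := by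
  refine Summable.of_norm_bounded ((summable_dec ha).mul_left S) fun n => ?_
  rw [norm_mul, norm_exp_om_real, mul_one]
  exact norm_cf_le_dec hp hf

lemma DQ.ofReal {a S : ℝ} {f : ℝ → ℝ} (hf : DQ a S f) : DQ a S (fun x => (f x : ℂ)) := by
  intro h
  refine ⟨fun x => ?_, fun x x' => ?_⟩
  · have := (hf h).1 x
    beta_reduce
    rw [← Complex.ofReal_sub, Complex.norm_real]; exact this
  · have := (hf h).2 x x'
    beta_reduce
    rw [← Complex.ofReal_sub, ← Complex.ofReal_sub, ← Complex.ofReal_sub, Complex.norm_real]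
    exact this

lemma Hol.ofReal {a S : ℝ} {f : ℝ → ℝ} (hf : Hol a S f) : Hol a S (fun x => (f x : ℂ)) := by
  refine ⟨fun x => ?_, fun x x' => ?_⟩
  · rw [Complex.norm_real]; exact hf.1 x
  · rw [← Complex.ofReal_sub, Complex.norm_real]; exact hf.2 x x'

lemma tsum_cf_eq {a S : ℝ} (ha : 0 < a) {f : ℝ → ℝ} (hp : Function.Periodic f 1)
    (hf : DQ a S f) (x : ℝ) :
    2 * (∑' n, cf n (fun s => (f s : ℂ)) * Complex.exp (om n * x)).re = f x - avg f := by
  set g : ℝ → ℂ := fun s => (f s : ℂ) with hg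
  have hgp : Function.Periodic g 1 := fun s => by simp [hg, hp s]
  have hgd : DQ a S g := hf.ofReal
  have hgc : Continuous g := hgd.continuous
  let G : C(AddCircle (1 : ℝ), ℂ) := ⟨hgp.lift, by
    exact continuous_coinduced_dom.mpr (by exact hgc)⟩
  have hG : ∀ s : ℝ, G (s : AddCircle (1 : ℝ)) = g s := fun s => hgp.lift_coe s
  have hco : ∀ n : ℤ, fourierCoeff G n
      = ∫ s in (0 : ℝ)..1, g s * Complex.exp (-(2 * Real.pi * Complex.I * n * s)) := by
    intro n
    rw [fourierCoeff_eq_intervalIntegral G n 0]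
    simp only [div_one, one_smul, zero_add]
    refine intervalIntegral.integral_congr fun s _ => ?_
    rw [hG, fourier_coe_apply, smul_eq_mul, mul_comm]
    congr 2; push_cast; ring
  have hpos : ∀ n : ℕ, fourierCoeff G ((n + 1 : ℕ) : ℤ) = cf n g := by
    intro n
    rw [hco]
    unfold cf
    refine intervalIntegral.integral_congr fun s _ => ?_
    congr 3; unfold om; push_cast; ring
  have hneg : ∀ n : ℕ, fourierCoeff G (-((n + 1 : ℕ) : ℤ)) = (starRingEnd ℂ) (cf n g) := by
    intro n
    rw [hco]
    unfold cf
    rw [← intervalIntegral.intervalIntegral_conj]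
    refine intervalIntegral.integral_congr fun s _ => ?_
    rw [map_mul, ← Complex.exp_conj, hg]
    simp only [Complex.conj_ofReal]
    congr 2
    unfold om
    simp only [map_neg, map_mul, Complex.conj_ofReal, Complex.conj_I, map_ofNat]
    push_cast; ring
  have hzero : fourierCoeff G 0 = (avg f : ℂ) := by
    rw [hco]
    unfold avg
    rw [← intervalIntegral.integral_ofReal]
    refine intervalIntegral.integral_congr fun s _ => ?_
    simp [hg]
  have hs1 : Summable fun n : ℕ => ‖cf n g‖ :=
    Summable.of_nonneg_of_le (fun _ => norm_nonneg _) (fun n => norm_cf_le_dec hgp hgd)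
      ((summable_dec ha).mul_left S)
  have hsum : Summable (fourierCoeff G) := by
    refine Summable.of_nat_of_neg ?_ ?_
    · refine (summable_nat_add_iff 1).1 ?_
      exact (Summable.of_norm hs1).congr fun n => (hpos n).symm
    · refine (summable_nat_add_iff 1).1 ?_
      refine Summable.of_norm (hs1.congr fun n => ?_)
      rw [hneg, RCLike.norm_conj]
  have h1 := (has_pointwise_sum_fourier_series_of_summable hsum (x : AddCircle (1 : ℝ))).nat_add_neg
  have h2 := (hasSum_nat_add_iff (f := fun n : ℕ => fourierCoeff G (n : ℤ) • (fourier (n : ℤ))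
    (x : AddCircle (1 : ℝ)) + fourierCoeff G (-(n : ℤ)) • (fourier (-(n : ℤ)))
    (x : AddCircle (1 : ℝ))) (g := g x - avg f) 1).2 (by
      rw [hG] at h1
      have e : g x - avg f + ∑ i ∈ Finset.range 1, (fourierCoeff G (i : ℤ) • (fourier (i : ℤ))
          (x : AddCircle (1 : ℝ)) + fourierCoeff G (-(i : ℤ)) • (fourier (-(i : ℤ)))
          (x : AddCircle (1 : ℝ))) = g x + fourierCoeff G 0 • (fourier 0) (x : AddCircle (1 : ℝ)) := by
        simp [hzero]
      rw [e]
      exact h1)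
  have h3 : ∀ n : ℕ, fourierCoeff G ((n + 1 : ℕ) : ℤ) • (fourier ((n + 1 : ℕ) : ℤ))
      (x : AddCircle (1 : ℝ)) + fourierCoeff G (-((n + 1 : ℕ) : ℤ)) • (fourier (-((n + 1 : ℕ) : ℤ)))
      (x : AddCircle (1 : ℝ)) = ((2 * (cf n g * Complex.exp (om n * x)).re : ℝ) : ℂ) := by
    intro n
    rw [hpos, hneg, fourier_neg, smul_eq_mul, smul_eq_mul, ← map_mul, Complex.add_conj]
    rw [fourier_coe_apply]
    congr 4
    unfold om; push_cast; ring_nf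
  have h4 := h2.congr_fun (fun n => (h3 n).symm)
  have h5 := (Complex.hasSum_re h4)
  have h6 := ((Complex.hasSum_re (summable_cf ha hgp hgd x).hasSum).mul_left 2)
  have h7 := h6.unique (by simpa using h5)
  rw [h7]
  simp [hg]

end FourierInversion

section LinearODE

open Filter Topology MeasureTheory

/-- The solution of `E' = μ E + A` with `E 0 = c`. -/
def odeSol (μ : ℝ) (c : ℂ) (A : ℝ → ℂ) (y : ℝ) : ℂ :=
  Real.exp (μ * y) * (c + ∫ r in (0 : ℝ)..y, Real.exp (-(μ * r)) * A r)

lemma odeSol_hasDerivAt (μ : ℝ) (c : ℂ) {A : ℝ → ℂ} (hA : Continuous A) (y : ℝ) :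
    HasDerivAt (odeSol μ c A) (μ * odeSol μ c A y + A y) y := by
  have h1 : HasDerivAt (fun y : ℝ => ∫ r in (0 : ℝ)..y, (Real.exp (-(μ * r)) : ℂ) * A r)
      ((Real.exp (-(μ * y)) : ℂ) * A y) y := by
    have hc : Continuous fun r : ℝ => (Real.exp (-(μ * r)) : ℂ) * A r := by fun_prop
    exact hc.integral_hasStrictDerivAt 0 y |>.hasDerivAt
  have h2 : HasDerivAt (fun y : ℝ => (Real.exp (μ * y) : ℂ)) ((Real.exp (μ * y) * μ : ℝ) : ℂ) y := by
    refine HasDerivAt.ofReal_comp ?_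
    have := (((hasDerivAt_id y).const_mul μ).exp)
    simpa using this
  have h3 := h2.mul (h1.const_add c)
  refine h3.congr_deriv ?_
  have e : (Real.exp (μ * y) : ℂ) * Real.exp (-(μ * y)) = 1 := by
    rw [← Complex.ofReal_mul, ← Real.exp_add]; simp
  unfold odeSol
  push_cast at e ⊢
  linear_combination A y * e

/-- The bounded solution of `W' = μ W + R`. -/
def decSol (μ : ℝ) (R : ℝ → ℂ) (t : ℝ) : ℂ :=
  -∫ r in Ioi (0 : ℝ), Real.exp (-(μ * r)) * R (t + r)

variable {μ b : ℝ} {R : ℝ → ℂ}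

lemma integrableOn_exp_mul (hμ : 0 < μ) (hm : Measurable R) (hb : ∀ t, ‖R t‖ ≤ b) (c : ℝ) :
    IntegrableOn (fun r => (Real.exp (-(μ * r)) : ℂ) * R r) (Ioi c) := by
  have h1 : IntegrableOn (fun r => Real.exp (-(μ * r)) * b) (Ioi c) := by
    have := (exp_neg_integrableOn_Ioi c hμ).mul_const b
    simp only [neg_mul] at this
    exact this
  refine Integrable.mono' h1 ?_ ?_
  · exact (Measurable.mul (by fun_prop) hm).aestronglyMeasurable
  · refine Filter.Eventually.of_forall fun r => ?_
    rw [norm_mul, Complex.norm_real, Real.norm_eq_abs, abs_of_pos (Real.exp_pos _)]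
    exact mul_le_mul_of_nonneg_left (hb r) (Real.exp_pos _).le

lemma integral_exp_neg_Ioi (hμ : 0 < μ) : ∫ r in Ioi (0 : ℝ), Real.exp (-(μ * r)) = 1 / μ := by
  have := integral_exp_mul_Ioi (a := -μ) (by linarith) 0
  simp only [neg_mul, mul_zero, Real.exp_zero] at this
  rw [this]; simp

lemma norm_decSol_le (hμ : 0 < μ) (hb : ∀ t, ‖R t‖ ≤ b) (t : ℝ) : ‖decSol μ R t‖ ≤ b / μ := by
  unfold decSol
  rw [norm_neg]
  have h1 : IntegrableOn (fun r => Real.exp (-(μ * r)) * b) (Ioi 0) := by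
    have := (exp_neg_integrableOn_Ioi 0 hμ).mul_const b
    simp only [neg_mul] at this
    exact this
  refine (norm_integral_le_of_norm_le h1 (Filter.Eventually.of_forall fun r => ?_)).trans ?_
  · rw [norm_mul, Complex.norm_real, Real.norm_eq_abs, abs_of_pos (Real.exp_pos _)]
    exact mul_le_mul_of_nonneg_left (hb _) (Real.exp_pos _).le
  · rw [integral_mul_const, integral_exp_neg_Ioi hμ]
    apply le_of_eq; ring

lemma decSol_eq (hμ : 0 < μ) (hm : Measurable R) (hb : ∀ t, ‖R t‖ ≤ b) (t : ℝ) :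
    decSol μ R t = odeSol μ (decSol μ R 0) R t := by
  have hI := integrableOn_exp_mul hμ hm hb
  have h1 : ∫ r in Ioi (0 : ℝ), (Real.exp (-(μ * r)) : ℂ) * R (t + r)
      = Real.exp (μ * t) * ∫ r in Ioi t, (Real.exp (-(μ * r)) : ℂ) * R r := by
    have hs := (measurePreserving_add_left (volume : Measure ℝ) t).setIntegral_preimage_emb
      (measurableEmbedding_addLeft t) (fun r => (Real.exp (-(μ * r)) : ℂ) * R r) (Ioi t)
    have hpre : (fun x => t + x) ⁻¹' Ioi t = Ioi 0 := by ext x; simp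
    rw [hpre] at hs
    rw [← hs, ← integral_const_mul]
    refine integral_congr_ae (Filter.Eventually.of_forall fun r => ?_)
    have e : Real.exp (-(μ * r)) = Real.exp (μ * t) * Real.exp (-(μ * (t + r))) := by
      rw [← Real.exp_add]; congr 1; ring
    simp only []
    rw [e]; push_cast; ring
  have h2 := intervalIntegral.integral_interval_add_Ioi (hI 0) (hI t)
  unfold decSol odeSol
  rw [h1]
  simp only [zero_add]
  rw [← h2]; ring

lemma decSol_eq_right (hμ : 0 < μ) (hm : Measurable R) (hb : ∀ t, ‖R t‖ ≤ b) {L : ℝ} {A : ℝ → ℂ}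
    (hA : ∀ r ∈ Ioo 0 L, R r = A r) {y : ℝ} (hy : y ∈ Icc 0 L) :
    decSol μ R y = odeSol μ (decSol μ R 0) A y := by
  rw [decSol_eq hμ hm hb]
  unfold odeSol
  congr 2
  refine intervalIntegral.integral_congr_uIoo fun r hr => ?_
  rw [uIoo_of_le hy.1] at hr
  rw [hA r ⟨hr.1, hr.2.trans_le hy.2⟩]

lemma decSol_eq_left (hμ : 0 < μ) (hm : Measurable R) (hb : ∀ t, ‖R t‖ ≤ b) {L : ℝ} {B : ℝ → ℂ}
    (hB : ∀ r ∈ Ioo 0 L, R (-r) = B r) {y : ℝ} (hy : y ∈ Icc 0 L) :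
    -decSol μ R (-y) = odeSol (-μ) (-decSol μ R 0) B y := by
  rw [decSol_eq hμ hm hb]
  unfold odeSol
  have h : ∫ r in (0 : ℝ)..(-y), (Real.exp (-(μ * r)) : ℂ) * R r
      = -∫ r in (0 : ℝ)..y, (Real.exp (-(-μ * r)) : ℂ) * B r := by
    have h1 := intervalIntegral.integral_comp_neg (a := y) (b := 0)
      (fun r => (Real.exp (-(μ * r)) : ℂ) * R r)
    rw [neg_zero] at h1
    rw [← h1, intervalIntegral.integral_symm]
    congr 1
    refine intervalIntegral.integral_congr_uIoo fun r hr => ?_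
    rw [uIoo_of_le hy.1] at hr
    rw [hB r ⟨hr.1, hr.2.trans_le hy.2⟩]
    congr 4; ring
  rw [h]
  have : μ * -y = -μ * y := by ring
  rw [this]; ring

lemma hasDerivWithinAt_tsum_Icc {L : ℝ} (hL : 0 < L) {w w' : ℕ → ℝ → ℂ} {b : ℕ → ℝ}
    (hw : ∀ n y, HasDerivAt (w n) (w' n y) y) (hc : ∀ n, Continuous (w' n))
    (hb : ∀ n, ∀ y ∈ Icc 0 L, ‖w' n y‖ ≤ b n) (hs : Summable b) (h0 : Summable fun n => w n 0)
    {y : ℝ} (hy : y ∈ Icc 0 L) :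
    HasDerivWithinAt (fun y => ∑' n, w n y) (∑' n, w' n y) (Icc 0 L) y := by
  have hcl : ∀ r, max 0 (min L r) ∈ Icc 0 L := fun r =>
    ⟨le_max_left _ _, max_le hL.le (min_le_left _ _)⟩
  have hcl' : ∀ r ∈ Icc 0 L, max 0 (min L r) = r := fun r hr => by
    rw [min_eq_right hr.2, max_eq_right hr.1]
  let W : ℕ → ℝ → ℂ := fun n y => w n 0 + ∫ r in (0 : ℝ)..y, w' n (max 0 (min L r))
  have hW : ∀ n, ∀ y ∈ Icc 0 L, W n y = w n y := by
    intro n y hy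
    have h1 : ∫ r in (0 : ℝ)..y, w' n (max 0 (min L r)) = ∫ r in (0 : ℝ)..y, w' n r := by
      refine intervalIntegral.integral_congr fun r hr => ?_
      rw [uIcc_of_le hy.1] at hr
      rw [hcl' r ⟨hr.1, hr.2.trans hy.2⟩]
    have h2 := intervalIntegral.integral_eq_sub_of_hasDerivAt (fun r _ => hw n r)
      ((hc n).intervalIntegrable 0 y)
    change w n 0 + _ = _
    rw [h1, h2]; ring
  have hWd : ∀ n y, HasDerivAt (W n) (w' n (max 0 (min L y))) y := by
    intro n y
    have hcc : Continuous fun r => w' n (max 0 (min L r)) := (hc n).comp (by fun_prop)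
    exact (hcc.integral_hasStrictDerivAt 0 y).hasDerivAt.const_add _
  have h := hasDerivAt_tsum hs hWd (fun n y => hb n _ (hcl y)) (y₀ := 0)
    (h0.congr fun n => (hW n 0 ⟨le_rfl, hL.le⟩).symm) y
  have h' := h.hasDerivWithinAt (s := Icc 0 L)
  rw [hcl' y hy] at h'
  exact h'.congr (fun r hr => tsum_congr fun n => (hW n r hr).symm)
    (tsum_congr fun n => (hW n y hy).symm)

end LinearODE

section ReflectedSource

open Filter Topology MeasureTheory

/-- A periodic source with uniform Hölder bound `S` and difference-quotient bound `T`. -/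
structure Src (a S T : ℝ) (s : ℝ → ℝ → ℂ) : Prop where
  per : ∀ y, Function.Periodic (s y) 1
  hol : ∀ y, Hol a S (s y)
  dq : ∀ y, DQ a T (s y)
  cont : Continuous (Function.uncurry s)

/-- The representative of `t` modulo `2 * L` in `[-L, L)`. -/
def fd (L t : ℝ) : ℝ := t - 2 * L * ⌊(t + L) / (2 * L)⌋

lemma fd_eq {L t : ℝ} (hL : 0 < L) (h1 : -L ≤ t) (h2 : t < L) : fd L t = t := by
  have : ⌊(t + L) / (2 * L)⌋ = 0 := by
    rw [Int.floor_eq_iff]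
    constructor
    · simp only [Int.cast_zero]; apply div_nonneg <;> linarith
    · simp only [Int.cast_zero, zero_add]; rw [div_lt_one (by linarith)]; linarith
  simp [fd, this]

lemma fd_add {L : ℝ} (hL : 0 < L) (t : ℝ) : fd L (t + 2 * L) = fd L t := by
  unfold fd
  have : (t + 2 * L + L) / (2 * L) = (t + L) / (2 * L) + 1 := by field_simp; ring
  rw [this, Int.floor_add_one]; push_cast; ring

lemma measurable_fd (L : ℝ) : Measurable (fd L) := by
  unfold fd
  have h : Measurable fun t : ℝ => ((⌊(t + L) / (2 * L)⌋ : ℤ) : ℝ) :=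
    measurable_from_top.comp (Int.measurable_floor.comp (by fun_prop))
  exact measurable_id.sub (measurable_const.mul h)

/-- The `2 * L`-periodic source equal to `s t` on `[0,L)` and to `s' (-t)` on `[-L,0)`. -/
def rho (L : ℝ) (s s' : ℝ → ℝ → ℂ) (t : ℝ) : ℝ → ℂ :=
  if 0 ≤ fd L t then s (fd L t) else s' (-fd L t)

lemma rho_right {L t : ℝ} (s s' : ℝ → ℝ → ℂ) (ht : t ∈ Ioo 0 L) : rho L s s' t = s t := by
  have hL : 0 < L := ht.1.trans ht.2
  rw [rho, fd_eq hL (by linarith [ht.1]) ht.2, if_pos ht.1.le]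

lemma rho_left {L t : ℝ} (s s' : ℝ → ℝ → ℂ) (ht : t ∈ Ioo 0 L) : rho L s s' (-t) = s' t := by
  have hL : 0 < L := ht.1.trans ht.2
  rw [rho, fd_eq hL (by linarith [ht.2]) (by linarith [ht.1]), if_neg (by linarith [ht.1]), neg_neg]

lemma rho_periodic {L : ℝ} (hL : 0 < L) (s s' : ℝ → ℝ → ℂ) (t : ℝ) :
    rho L s s' (t + 2 * L) = rho L s s' t := by
  unfold rho; rw [fd_add hL]

variable {a S T L : ℝ} {s s' : ℝ → ℝ → ℂ}

lemma Src.cf_continuous (hs : Src a S T s) (n : ℕ) : Continuous fun y => cf n (s y) := by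
  unfold cf
  refine intervalIntegral.continuous_parametric_intervalIntegral_of_continuous' ?_ 0 1
  exact hs.cont.mul (by fun_prop)

lemma rho_per (hs : Src a S T s) (hs' : Src a S T s') (t : ℝ) :
    Function.Periodic (rho L s s' t) 1 := by
  unfold rho; split_ifs
  exacts [hs.per _, hs'.per _]

lemma rho_hol (hs : Src a S T s) (hs' : Src a S T s') (t : ℝ) : Hol a S (rho L s s' t) := by
  unfold rho; split_ifs
  exacts [hs.hol _, hs'.hol _]

lemma rho_dq (hs : Src a S T s) (hs' : Src a S T s') (t : ℝ) : DQ a T (rho L s s' t) := by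
  unfold rho; split_ifs
  exacts [hs.dq _, hs'.dq _]

lemma measurable_cf_rho (hs : Src a S T s) (hs' : Src a S T s') (n : ℕ) :
    Measurable fun t => cf n (rho L s s' t) := by
  have h : (fun t => cf n (rho L s s' t))
      = fun t => if 0 ≤ fd L t then cf n (s (fd L t)) else cf n (s' (-fd L t)) := by
    funext t; unfold rho; split_ifs <;> rfl
  rw [h]
  refine Measurable.ite (measurableSet_le measurable_const (measurable_fd L)) ?_ ?_
  · exact (hs.cf_continuous n).measurable.comp (measurable_fd L)
  · exact (hs'.cf_continuous n).measurable.comp (measurable_fd L).neg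

/-- Fourier coefficients of the bounded solution of `W' = |D| W + rho`. -/
def wc (L : ℝ) (s s' : ℝ → ℝ → ℂ) (n : ℕ) (t : ℝ) : ℂ :=
  decSol (mu n) (fun t => cf n (rho L s s' t)) t

lemma norm_cf_rho_le (hs : Src a S T s) (hs' : Src a S T s') (n : ℕ) (t : ℝ) :
    ‖cf n (rho L s s' t)‖ ≤ T * dec a n :=
  norm_cf_le_dec (rho_per hs hs' t) (rho_dq hs hs' t)

lemma norm_wc_le (hs : Src a S T s) (hs' : Src a S T s') (n : ℕ) (t : ℝ) :
    ‖wc L s s' n t‖ ≤ T * dec a n / mu n :=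
  norm_decSol_le (mu_pos n) (norm_cf_rho_le hs hs' n) t

lemma wc_periodic (hL : 0 < L) (s s' : ℝ → ℝ → ℂ) (n : ℕ) (t : ℝ) :
    wc L s s' n (t + 2 * L) = wc L s s' n t := by
  unfold wc decSol
  congr 1
  refine integral_congr_ae (Eventually.of_forall fun r => ?_)
  have : t + 2 * L + r = t + r + 2 * L := by ring
  simp only [this, rho_periodic hL]

/-- The `x`-derivative of the Fourier series with coefficients `wc`. -/
def wx (L : ℝ) (s s' : ℝ → ℝ → ℂ) (t x : ℝ) : ℂ :=
  ∑' n, om n * wc L s s' n t * Complex.exp (om n * x)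

lemma norm_wx_term_le (hs : Src a S T s) (hs' : Src a S T s') (n : ℕ) (t x : ℝ) :
    ‖om n * wc L s s' n t * Complex.exp (om n * x)‖ ≤ T * dec a n := by
  rw [norm_mul, norm_mul, norm_exp_om_real, norm_om, mul_one]
  have := norm_wc_le (L := L) hs hs' n t
  rwa [le_div_iff₀ (mu_pos n), mul_comm] at this

lemma summable_wx (ha : 0 < a) (hs : Src a S T s) (hs' : Src a S T s') (t x : ℝ) :
    Summable fun n => om n * wc L s s' n t * Complex.exp (om n * x) :=
  Summable.of_norm_bounded ((summable_dec ha).mul_left T) fun n => norm_wx_term_le hs hs' n t x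

/-- Constant in the Hölder estimate for `wx`. -/
def hcst (a : ℝ) : ℝ := kc a * (2 / a + 4 / (1 - a))

lemma hcst_nonneg (ha : a ∈ Ioo (0 : ℝ) 1) : 0 ≤ hcst a := by
  have := kc_nonneg a; have := ha.1; have : 0 < 1 - a := by linarith [ha.2]
  unfold hcst; positivity

lemma wx_sub_eq (ha : a ∈ Ioo (0 : ℝ) 1) (hs : Src a S T s) (hs' : Src a S T s') (t x x' : ℝ) :
    wx L s s' t x - wx L s s' t x' = -∫ r in Ioi (0 : ℝ),
      (gk (rho L s s' (t + r)) (x + r * Complex.I) - gk (rho L s s' (t + r)) (x' + r * Complex.I)) := by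
  let F : ℕ → ℝ → ℂ := fun n r => (Real.exp (-(mu n * r)) * cf n (rho L s s' (t + r)))
    * (om n * (Complex.exp (om n * x) - Complex.exp (om n * x')))
  have hT : 0 ≤ T := (hs.dq 0).nonneg
  have hint : ∀ n, Integrable (fun r => (Real.exp (-(mu n * r)) : ℂ) * cf n (rho L s s' (t + r)))
      (volume.restrict (Ioi 0)) := fun n =>
    integrableOn_exp_mul (R := fun r => cf n (rho L s s' (t + r))) (mu_pos n)
      ((measurable_cf_rho hs hs' n).comp (measurable_const_add t))
      (fun r => norm_cf_rho_le hs hs' n _) 0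
  have hF : ∀ n, Integrable (F n) (volume.restrict (Ioi 0)) := fun n => (hint n).mul_const _
  have hFs : Summable fun n => ∫ r in Ioi (0 : ℝ), ‖F n r‖ := by
    refine Summable.of_nonneg_of_le (fun n => integral_nonneg fun r => norm_nonneg _) (fun n => ?_)
      (((summable_dec ha.1).mul_left T).mul_right 2)
    have h1 : IntegrableOn (fun r => Real.exp (-(mu n * r)) * (T * dec a n * (mu n * 2))) (Ioi 0) := by
      have := (exp_neg_integrableOn_Ioi 0 (mu_pos n)).mul_const (T * dec a n * (mu n * 2))
      simp only [neg_mul] at this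
      exact this
    refine (integral_mono_ae (hF n).norm h1 (Eventually.of_forall fun r => ?_)).trans ?_
    · have hd : ‖Complex.exp (om n * x) - Complex.exp (om n * x')‖ ≤ 2 := by
        refine (norm_sub_le _ _).trans ?_
        rw [norm_exp_om_real, norm_exp_om_real]; norm_num
      change ‖_ * _ * (om n * _)‖ ≤ _
      rw [norm_mul, norm_mul, norm_mul, Complex.norm_real, Real.norm_eq_abs,
        abs_of_pos (Real.exp_pos _), norm_om, mul_assoc]
      beta_reduce
      have := (mu_pos n).le
      have := dec_nonneg a n
      have := norm_cf_rho_le (L := L) hs hs' n (t + r)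
      gcongr
    · rw [integral_mul_const, integral_exp_neg_Ioi (mu_pos n)]
      have := (mu_pos n).ne'
      apply le_of_eq; field_simp
  have hsum := hasSum_integral_of_summable_integral_norm hF hFs
  have hL : HasSum (fun n => om n * wc L s s' n t * Complex.exp (om n * x)
      - om n * wc L s s' n t * Complex.exp (om n * x')) (wx L s s' t x - wx L s s' t x') :=
    (summable_wx ha.1 hs hs' t x).hasSum.sub (summable_wx ha.1 hs hs' t x').hasSum
  have hR : HasSum (fun n => om n * wc L s s' n t * Complex.exp (om n * x)
      - om n * wc L s s' n t * Complex.exp (om n * x'))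
      (-∫ r in Ioi (0 : ℝ), ∑' n, F n r) := by
    refine hsum.neg.congr_fun fun n => ?_
    change _ = -∫ r in Ioi (0 : ℝ), (_ * _) * _
    rw [integral_mul_const]
    unfold wc decSol
    ring
  rw [hL.unique hR]
  congr 1
  refine setIntegral_congr_fun measurableSet_Ioi fun r hr => ?_
  have hr' : (0 : ℝ) < r := hr
  have hsu : ∀ x : ℝ, Summable fun n =>
      om n * cf n (rho L s s' (t + r)) * Complex.exp (om n * (x + r * Complex.I)) := fun x =>
    Summable.of_norm_bounded ((summable_mu_exp hr').mul_left S) fun n => by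
      have := norm_gk_term_le (rho_hol (L := L) hs hs' (t + r)).1 n (x + r * Complex.I)
      simpa using this
  unfold gk
  rw [← (hsu x).tsum_sub (hsu x')]
  refine tsum_congr fun n => ?_
  have he : ∀ x : ℝ, Complex.exp (om n * (x + r * Complex.I))
      = Real.exp (-(mu n * r)) * Complex.exp (om n * x) := by
    intro x
    rw [Complex.ofReal_exp, ← Complex.exp_add]
    congr 1
    rw [om_eq]; push_cast
    linear_combination (mu n : ℂ) * r * Complex.I_mul_I
  rw [he, he]
  change _ * _ * (om n * _) = _
  ring

lemma norm_wx_sub_le (ha : a ∈ Ioo (0 : ℝ) 1) (hs : Src a S T s) (hs' : Src a S T s') (t x x' : ℝ) :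
    ‖wx L s s' t x - wx L s s' t x'‖ ≤ hcst a * S * |x - x'| ^ a := by
  rcases eq_or_ne x x' with rfl | hne
  · simp [Real.zero_rpow ha.1.ne']
  set d := |x - x'| with hd
  have hdp : 0 < d := abs_pos.2 (sub_ne_zero.2 hne)
  have hS : 0 ≤ S := (hs.hol 0).nonneg
  have hk := kc_nonneg a
  have h1a : 0 < 1 - a := by linarith [ha.2]
  let g : ℝ → ℝ := fun r => if r ≤ d then 2 * kc a * S * r ^ (a - 1)
    else 4 * kc a * S * d * r ^ (a - 2)
  have hu : Ioc 0 d ∪ Ioi d = Ioi (0 : ℝ) := Ioc_union_Ioi_eq_Ioi hdp.le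
  have i1 : IntegrableOn (fun r : ℝ => 2 * kc a * S * r ^ (a - 1)) (Ioc 0 d) :=
    ((intervalIntegral.intervalIntegrable_rpow' (by linarith [ha.1])).const_mul _).1
  have i2 : IntegrableOn (fun r : ℝ => 4 * kc a * S * d * r ^ (a - 2)) (Ioi d) :=
    (integrableOn_Ioi_rpow_of_lt (by linarith) hdp).const_mul _
  have e1 : EqOn (fun r : ℝ => 2 * kc a * S * r ^ (a - 1)) g (Ioc 0 d) := fun r hr =>
    (if_pos hr.2).symm
  have e2 : EqOn (fun r : ℝ => 4 * kc a * S * d * r ^ (a - 2)) g (Ioi d) := fun r hr =>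
    (if_neg (not_le.2 hr)).symm
  have j1 := i1.congr_fun e1 measurableSet_Ioc
  have j2 := i2.congr_fun e2 measurableSet_Ioi
  have hgi : IntegrableOn g (Ioi 0) := by rw [← hu]; exact j1.union j2
  rw [wx_sub_eq ha hs hs', norm_neg]
  have hb := norm_integral_le_of_norm_le hgi (f := fun r : ℝ =>
      gk (rho L s s' (t + r)) (x + r * Complex.I) - gk (rho L s s' (t + r)) (x' + r * Complex.I))
    ((ae_restrict_iff' measurableSet_Ioi).2 (Eventually.of_forall fun r hr => by
      have hr' : (0 : ℝ) < r := hr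
      by_cases hc : r ≤ d
      · have e : g r = 2 * kc a * S * r ^ (a - 1) := if_pos hc
        rw [e]
        refine (norm_sub_le _ _).trans ?_
        have := norm_gk_le ha (rho_per (L := L) hs hs' (t + r)) (rho_hol hs hs' _) x hr'
        have := norm_gk_le ha (rho_per (L := L) hs hs' (t + r)) (rho_hol hs hs' _) x' hr'
        linarith
      · have e : g r = 4 * kc a * S * d * r ^ (a - 2) := if_neg hc
        rw [e]
        have := norm_gk_sub_le ha (rho_per (L := L) hs hs' (t + r)) (rho_hol hs hs' _) x x' hr'
        rw [← hd] at this
        linarith))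
  refine hb.trans (le_of_eq ?_)
  rw [← hu, setIntegral_union (Ioc_disjoint_Ioi le_rfl) measurableSet_Ioi j1 j2,
    ← setIntegral_congr_fun measurableSet_Ioc e1, ← setIntegral_congr_fun measurableSet_Ioi e2,
    integral_const_mul, integral_const_mul, integral_Ioi_rpow_of_lt (by linarith) hdp,
    ← intervalIntegral.integral_of_le hdp.le, integral_rpow (Or.inl (by linarith [ha.1]))]
  have e3 : d ^ (a - 2 + 1) = d ^ a / d := by
    rw [show a - 2 + 1 = a - 1 by ring, Real.rpow_sub_one hdp.ne']
  have e4 : a - 2 + 1 = -(1 - a) := by ring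
  rw [e3, e4, sub_add_cancel, Real.zero_rpow ha.1.ne']
  unfold hcst
  have := ha.1.ne'
  field_simp
  ring

end ReflectedSource

section DirichletProblem

open Filter Topology MeasureTheory

lemma decSol_continuous {μ b : ℝ} {R : ℝ → ℂ} (hμ : 0 < μ) (hm : Measurable R)
    (hb : ∀ t, ‖R t‖ ≤ b) : Continuous (decSol μ R) := by
  have h : decSol μ R = odeSol μ (decSol μ R 0) R := funext fun t => decSol_eq hμ hm hb t
  rw [h]
  unfold odeSol
  refine Continuous.mul (by fun_prop) (continuous_const.add ?_)
  refine intervalIntegral.continuous_primitive (fun p q => ?_) 0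
  have := integrableOn_exp_mul hμ hm hb (min p q)
  exact intervalIntegrable_iff.2 (this.mono_set (by rw [uIoc]; exact Ioc_subset_Ioi_self))

variable {a S T L : ℝ} {s s' : ℝ → ℝ → ℂ}

lemma wc_continuous (hs : Src a S T s) (hs' : Src a S T s') (n : ℕ) :
    Continuous (wc L s s' n) :=
  decSol_continuous (mu_pos n) (measurable_cf_rho hs hs' n) (norm_cf_rho_le hs hs' n)

/-- The Fourier series with coefficients `wc`. -/
def w0 (L : ℝ) (s s' : ℝ → ℝ → ℂ) (t x : ℝ) : ℂ :=
  ∑' n, wc L s s' n t * Complex.exp (om n * x)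

lemma one_le_mu (n : ℕ) : 1 ≤ mu n := by
  unfold mu
  have : (0 : ℝ) ≤ n := Nat.cast_nonneg n
  nlinarith [Real.pi_gt_three]

lemma norm_wc_le' (hs : Src a S T s) (hs' : Src a S T s') (n : ℕ) (t : ℝ) :
    ‖wc L s s' n t‖ ≤ T * dec a n := by
  refine (norm_wc_le hs hs' n t).trans (div_le_self ?_ (one_le_mu n))
  exact mul_nonneg (hs.dq 0).nonneg (dec_nonneg a n)

lemma norm_w0_term_le (hs : Src a S T s) (hs' : Src a S T s') (n : ℕ) (t x : ℝ) :
    ‖wc L s s' n t * Complex.exp (om n * x)‖ ≤ T * dec a n := by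
  rw [norm_mul, norm_exp_om_real, mul_one]
  exact norm_wc_le' hs hs' n t

lemma summable_w0 (ha : 0 < a) (hs : Src a S T s) (hs' : Src a S T s') (t x : ℝ) :
    Summable fun n => wc L s s' n t * Complex.exp (om n * x) :=
  Summable.of_norm_bounded ((summable_dec ha).mul_left T) fun n => norm_w0_term_le hs hs' n t x

lemma w0_continuous (ha : 0 < a) (hs : Src a S T s) (hs' : Src a S T s') :
    Continuous fun p : ℝ × ℝ => w0 L s s' p.1 p.2 := by
  unfold w0
  refine continuous_tsum (fun n => ?_) ((summable_dec ha).mul_left T)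
    fun n p => norm_w0_term_le hs hs' n p.1 p.2
  exact ((wc_continuous hs hs' n).comp continuous_fst).mul (by fun_prop)

lemma wx_continuous (ha : 0 < a) (hs : Src a S T s) (hs' : Src a S T s') :
    Continuous fun p : ℝ × ℝ => wx L s s' p.1 p.2 := by
  unfold wx
  refine continuous_tsum (fun n => ?_) ((summable_dec ha).mul_left T)
    fun n p => norm_wx_term_le hs hs' n p.1 p.2
  exact (continuous_const.mul ((wc_continuous hs hs' n).comp continuous_fst)).mul (by fun_prop)

lemma hasDerivAt_exp_om (n : ℕ) (x : ℝ) :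
    HasDerivAt (fun x : ℝ => Complex.exp (om n * x)) (om n * Complex.exp (om n * x)) x := by
  have h := ((hasDerivAt_id x).ofReal_comp.const_mul (om n)).cexp
  simp only [id, Complex.ofReal_one, mul_one] at h
  rw [mul_comm]; exact h

lemma w0_hasDerivAt (ha : 0 < a) (hs : Src a S T s) (hs' : Src a S T s') (t x : ℝ) :
    HasDerivAt (w0 L s s' t) (wx L s s' t x) x := by
  unfold w0 wx
  refine hasDerivAt_tsum ((summable_dec ha).mul_left T) (fun n x => ?_)
    (fun n x => norm_wx_term_le hs hs' n t x) (summable_w0 ha hs hs' t 0) x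
  exact ((hasDerivAt_exp_om n x).const_mul _).congr_deriv (by ring)

lemma exp_om_periodic (n : ℕ) (x : ℝ) :
    Complex.exp (om n * ((x + 1 : ℝ) : ℂ)) = Complex.exp (om n * x) := by
  have := exp_om_add_one n (x : ℂ)
  push_cast; exact this

lemma w0_per (L : ℝ) (s s' : ℝ → ℝ → ℂ) (t : ℝ) : Function.Periodic (w0 L s s' t) 1 := fun x => by
  unfold w0; simp only [exp_om_periodic]

lemma w0_add (hL : 0 < L) (s s' : ℝ → ℝ → ℂ) (t x : ℝ) :
    w0 L s s' (t + 2 * L) x = w0 L s s' t x := by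
  unfold w0; simp only [wc_periodic hL]

lemma w0_hasDerivWithinAt_right (hL : 0 < L) (ha : 0 < a) (hs : Src a S T s) (hs' : Src a S T s')
    (x : ℝ) {y : ℝ} (hy : y ∈ Icc 0 L) :
    HasDerivWithinAt (fun y => w0 L s s' y x) (-Complex.I * wx L s s' y x
      + ∑' n, cf n (s y) * Complex.exp (om n * x)) (Icc 0 L) y := by
  let E : ℕ → ℝ → ℂ := fun n => odeSol (mu n) (wc L s s' n 0) (fun y => cf n (s y))
  have hE : ∀ n, ∀ y ∈ Icc 0 L, wc L s s' n y = E n y := fun n y hy =>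
    decSol_eq_right (mu_pos n) (measurable_cf_rho hs hs' n) (norm_cf_rho_le hs hs' n)
      (fun r hr => by simp only [rho_right s s' hr]) hy
  have hEd : ∀ n y, HasDerivAt (E n) (mu n * E n y + cf n (s y)) y := fun n y =>
    odeSol_hasDerivAt _ _ (hs.cf_continuous n) y
  have hEc : ∀ n, Continuous (E n) := fun n =>
    continuous_iff_continuousAt.2 fun y => (hEd n y).continuousAt
  have h := hasDerivWithinAt_tsum_Icc hL (w := fun n y => E n y * Complex.exp (om n * x))
    (w' := fun n y => (mu n * E n y + cf n (s y)) * Complex.exp (om n * x))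
    (b := fun n => 2 * (T * dec a n)) (fun n y => (hEd n y).mul_const _)
    (fun n => (((continuous_const.mul (hEc n)).add (hs.cf_continuous n)).mul continuous_const))
    (fun n y hy => by
      rw [norm_mul, norm_exp_om_real, mul_one, ← hE n y hy]
      refine (norm_add_le _ _).trans ?_
      have h1 := norm_cf_le_dec (n := n) (hs.per y) (hs.dq y)
      have h2 := norm_wc_le (L := L) hs hs' n y
      rw [le_div_iff₀ (mu_pos n)] at h2
      rw [norm_mul, Complex.norm_real, Real.norm_eq_abs, abs_of_pos (mu_pos n)]
      linarith)
    (((summable_dec ha).mul_left T).mul_left 2)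
    ((summable_w0 ha hs hs' 0 x).congr fun n => by rw [hE n 0 ⟨le_rfl, hL.le⟩]) hy
  refine (h.congr (fun y hy => tsum_congr fun n => by rw [hE n y hy])
    (tsum_congr fun n => by rw [hE n y hy])).congr_deriv ?_
  unfold wx
  rw [← tsum_mul_left, ← ((summable_wx ha hs hs' y x).mul_left _).tsum_add
    (summable_cf ha (hs.per y) (hs.dq y) x)]
  refine tsum_congr fun n => ?_
  rw [← hE n y hy, om_eq]
  linear_combination (mu n * wc L s s' n y * Complex.exp (mu n * Complex.I * x)) * Complex.I_mul_I

lemma w0_hasDerivWithinAt_left (hL : 0 < L) (ha : 0 < a) (hs : Src a S T s) (hs' : Src a S T s')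
    (x : ℝ) {y : ℝ} (hy : y ∈ Icc 0 L) :
    HasDerivWithinAt (fun y => -w0 L s s' (-y) x) (-Complex.I * wx L s s' (-y) x
      + ∑' n, cf n (s' y) * Complex.exp (om n * x)) (Icc 0 L) y := by
  let E : ℕ → ℝ → ℂ := fun n => odeSol (-mu n) (-wc L s s' n 0) (fun y => cf n (s' y))
  have hE : ∀ n, ∀ y ∈ Icc 0 L, -wc L s s' n (-y) = E n y := fun n y hy =>
    decSol_eq_left (mu_pos n) (measurable_cf_rho hs hs' n) (norm_cf_rho_le hs hs' n)
      (fun r hr => by simp only [rho_left s s' hr]) hy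
  have hEd : ∀ n y, HasDerivAt (E n) (((-mu n : ℝ) : ℂ) * E n y + cf n (s' y)) y := fun n y =>
    odeSol_hasDerivAt _ _ (hs'.cf_continuous n) y
  have hEc : ∀ n, Continuous (E n) := fun n =>
    continuous_iff_continuousAt.2 fun y => (hEd n y).continuousAt
  have h := hasDerivWithinAt_tsum_Icc hL (w := fun n y => E n y * Complex.exp (om n * x))
    (w' := fun n y => (((-mu n : ℝ) : ℂ) * E n y + cf n (s' y)) * Complex.exp (om n * x))
    (b := fun n => 2 * (T * dec a n)) (fun n y => (hEd n y).mul_const _)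
    (fun n => (((continuous_const.mul (hEc n)).add (hs'.cf_continuous n)).mul continuous_const))
    (fun n y hy => by
      rw [norm_mul, norm_exp_om_real, mul_one, ← hE n y hy]
      refine (norm_add_le _ _).trans ?_
      have h1 := norm_cf_le_dec (n := n) (hs'.per y) (hs'.dq y)
      have h2 := norm_wc_le (L := L) hs hs' n (-y)
      rw [le_div_iff₀ (mu_pos n)] at h2
      rw [norm_mul, Complex.norm_real, Real.norm_eq_abs, abs_neg, abs_of_pos (mu_pos n), norm_neg]
      linarith)
    (((summable_dec ha).mul_left T).mul_left 2)
    ((summable_w0 ha hs hs' 0 x).neg.congr fun n => by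
      rw [← hE n 0 ⟨le_rfl, hL.le⟩, neg_zero]; ring) hy
  refine (h.congr (fun y hy => ?_) ?_).congr_deriv ?_
  · unfold w0; rw [← tsum_neg]; exact tsum_congr fun n => by rw [← hE n y hy]; ring
  · unfold w0; rw [← tsum_neg]; exact tsum_congr fun n => by rw [← hE n y hy]; ring
  unfold wx
  rw [← tsum_mul_left, ← ((summable_wx ha hs hs' (-y) x).mul_left _).tsum_add
    (summable_cf ha (hs'.per y) (hs'.dq y) x)]
  refine tsum_congr fun n => ?_
  rw [← hE n y hy, om_eq]
  push_cast
  linear_combination (mu n * wc L s s' n (-y) * Complex.exp (mu n * Complex.I * x)) * Complex.I_mul_I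

lemma abs_le_of_periodic_deriv {K : ℝ} {f f' : ℝ → ℝ} (ha : 0 ≤ a) (hp : Function.Periodic f 1)
    (hd : ∀ x, HasDerivAt f (f' x) x) (hK : ∀ x x', |f' x - f' x'| ≤ K * |x - x'| ^ a) (x : ℝ) :
    |f' x| ≤ K := by
  obtain ⟨c, hc, he⟩ := exists_hasDerivAt_eq_slope f f' (a := x) (b := x + 1) (by linarith)
    (fun x _ => (hd x).continuousAt.continuousWithinAt) (fun x _ => hd x)
  rw [hp x, sub_self, zero_div] at he
  have hK0 : 0 ≤ K := by
    have := (abs_nonneg _).trans (hK 0 1)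
    simpa using this
  have h := hK x c
  rw [he, sub_zero] at h
  refine h.trans (mul_le_of_le_one_right hK0 (Real.rpow_le_one (abs_nonneg _) ?_ ha))
  rw [abs_le]; constructor <;> linarith [hc.1, hc.2]

lemma cf_add_mul {n : ℕ} {f g : ℝ → ℂ} (hf : Continuous f) (hg : Continuous g) (c : ℂ) :
    cf n (fun x => f x + c * g x) = cf n f + c * cf n g := by
  have he := continuous_exp_neg_om n
  have h1 : IntervalIntegrable (fun x => f x * Complex.exp (-(om n * x))) volume 0 1 :=
    (hf.mul he).intervalIntegrable _ _
  have h2 : IntervalIntegrable (fun x => c * (g x * Complex.exp (-(om n * x)))) volume 0 1 :=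
    (continuous_const.mul (hg.mul he)).intervalIntegrable _ _
  unfold cf
  rw [← intervalIntegral.integral_const_mul, ← intervalIntegral.integral_add h1 h2]
  exact intervalIntegral.integral_congr fun x _ => by ring

lemma tsum_cf_add_mul (ha : 0 < a) {f g : ℝ → ℂ} (hf : Function.Periodic f 1)
    (hg : Function.Periodic g 1) (hf' : DQ a T f) (hg' : DQ a T g) (c : ℂ) (x : ℝ) :
    ∑' n, cf n (fun x => f x + c * g x) * Complex.exp (om n * x)
      = (∑' n, cf n f * Complex.exp (om n * x)) + c * ∑' n, cf n g * Complex.exp (om n * x) := by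
  rw [← tsum_mul_left, ← (summable_cf ha hf hf' x).tsum_add ((summable_cf ha hg hg' x).mul_left _)]
  refine tsum_congr fun n => ?_
  rw [cf_add_mul hf'.continuous hg'.continuous]; ring

/-- The bounded solution of `W_y = |D| W + ρ` for the reflected source built from `k` and `j`. -/
lemma exists_reflected (hL : 0 < L) (ha : a ∈ Ioo (0 : ℝ) 1) {k : ℝ → ℝ} {j : ℝ → ℝ → ℝ}
    (hkp : Function.Periodic k 1) (hk : Hol a S k) (hk' : DQ a T k)
    (hjc : Continuous (Function.uncurry j)) (hjp : ∀ y, Function.Periodic (j y) 1)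
    (hj : ∀ y, Hol a S (j y)) (hj' : ∀ y, DQ a T (j y)) :
    ∃ (W X : ℝ → ℝ → ℂ) (κ : ℝ → ℂ) (ι : ℝ → ℝ → ℂ),
      (Continuous fun p : ℝ × ℝ => W p.1 p.2) ∧ (Continuous fun p : ℝ × ℝ => X p.1 p.2) ∧
      (∀ y, Function.Periodic (W y) 1) ∧ (∀ y x, HasDerivAt (W y) (X y x) x) ∧
      (∀ x, W L x = W (-L) x) ∧
      (∀ x, 2 * (κ x).re = k x - avg k) ∧ (∀ y x, 2 * (ι y x).re = j y x - avg (j y)) ∧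
      (∀ x, ∀ y ∈ Icc 0 L, HasDerivWithinAt (fun y => W y x)
        (-Complex.I * X y x + (κ x + Complex.I * ι y x)) (Icc 0 L) y) ∧
      (∀ x, ∀ y ∈ Icc 0 L, HasDerivWithinAt (fun y => -W (-y) x)
        (-Complex.I * X (-y) x + (κ x - Complex.I * ι y x)) (Icc 0 L) y) ∧
      (∀ y x x', ‖X y x - X y x'‖ ≤ hcst a * (S + S) * |x - x'| ^ a) := by
  have hIS : ∀ {S : ℝ} {f : ℝ → ℂ}, Hol a S f → Hol a S (fun x => Complex.I * f x) := by
    intro S f hf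
    refine ⟨fun x => by simpa using hf.1 x, fun x x' => ?_⟩
    rw [← mul_sub, norm_mul, Complex.norm_I, one_mul]; exact hf.2 x x'
  have hID : ∀ {S : ℝ} {f : ℝ → ℂ}, DQ a S f → DQ a S (fun x => Complex.I * f x) := by
    intro S f hf h
    have := hIS (hf h)
    simpa only [mul_sub] using this
  have hkc := hk.continuous ha.1
  have hjx : Continuous fun p : ℝ × ℝ => (j p.1 p.2 : ℂ) := Complex.continuous_ofReal.comp hjc
  have hs : Src a (S + S) (T + T) (fun y x => (k x : ℂ) + Complex.I * (j y x : ℂ)) :=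
    ⟨fun y x => by simp only [hkp x, hjp y x], fun y => hk.ofReal.add (hIS (hj y).ofReal),
      fun y => hk'.ofReal.add (hID (hj' y).ofReal), by
        change Continuous fun p : ℝ × ℝ => (k p.2 : ℂ) + Complex.I * (j p.1 p.2 : ℂ)
        fun_prop⟩
  have hs' : Src a (S + S) (T + T) (fun y x => (k x : ℂ) - Complex.I * (j y x : ℂ)) :=
    ⟨fun y x => by simp only [hkp x, hjp y x], fun y => hk.ofReal.sub (hIS (hj y).ofReal),
      fun y => hk'.ofReal.sub (hID (hj' y).ofReal), by
        change Continuous fun p : ℝ × ℝ => (k p.2 : ℂ) - Complex.I * (j p.1 p.2 : ℂ)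
        fun_prop⟩
  have hkp' : Function.Periodic (fun x => (k x : ℂ)) 1 := fun x => by simp only [hkp x]
  have hjp' : ∀ y, Function.Periodic (fun x => (j y x : ℂ)) 1 := fun y x => by simp only [hjp y x]
  refine ⟨w0 L _ _, wx L _ _, fun x => ∑' n, cf n (fun x => (k x : ℂ)) * Complex.exp (om n * x),
    fun y x => ∑' n, cf n (fun x => (j y x : ℂ)) * Complex.exp (om n * x),
    w0_continuous ha.1 hs hs', wx_continuous ha.1 hs hs', w0_per L _ _,
    w0_hasDerivAt ha.1 hs hs', fun x => ?_, fun x => tsum_cf_eq ha.1 hkp hk' x,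
    fun y x => tsum_cf_eq ha.1 (hjp y) (hj' y) x, fun x y hy => ?_, fun x y hy => ?_,
    norm_wx_sub_le ha hs hs'⟩
  · have h := w0_add hL (fun y x => (k x : ℂ) + Complex.I * (j y x : ℂ))
      (fun y x => (k x : ℂ) - Complex.I * (j y x : ℂ)) (-L) x
    have e : -L + 2 * L = L := by ring
    rw [e] at h
    exact h
  · have h := w0_hasDerivWithinAt_right hL ha.1 hs hs' x hy
    have h2 := tsum_cf_add_mul ha.1 hkp' (hjp' y) hk'.ofReal (hj' y).ofReal Complex.I x
    exact h.congr_deriv (congrArg (fun q => -Complex.I * wx L _ _ y x + q) h2)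
  · have h := w0_hasDerivWithinAt_left hL ha.1 hs hs' x hy
    have h2 := tsum_cf_add_mul ha.1 hkp' (hjp' y) hk'.ofReal (hj' y).ofReal (-Complex.I) x
    simp only [neg_mul, ← sub_eq_add_neg] at h2
    simp only [neg_mul] at h ⊢
    exact h.congr_deriv (congrArg (fun q => -(Complex.I * wx L _ _ (-y) x) + q) h2)

/-- Solvability of the div-curl system with homogeneous Dirichlet conditions for `V`. -/
lemma exists_dirichlet (hL : 0 < L) (ha : a ∈ Ioo (0 : ℝ) 1) {k : ℝ → ℝ} {j : ℝ → ℝ → ℝ}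
    (hkp : Function.Periodic k 1) (hk : Hol a S k) (hk' : DQ a T k)
    (hjc : Continuous (Function.uncurry j)) (hjp : ∀ y, Function.Periodic (j y) 1)
    (hj : ∀ y, Hol a S (j y)) (hj' : ∀ y, DQ a T (j y)) :
    ∃ U V Ux Vx : ℝ → ℝ → ℝ, (Continuous (Function.uncurry U) ∧ Continuous (Function.uncurry V) ∧
      Continuous (Function.uncurry Ux) ∧ Continuous (Function.uncurry Vx)) ∧
      (∀ y, Function.Periodic (U y) 1) ∧ (∀ y, Function.Periodic (V y) 1) ∧
      (∀ y x, HasDerivAt (U y) (Ux y x) x) ∧ (∀ y x, HasDerivAt (V y) (Vx y x) x) ∧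
      (∀ x, ∀ y ∈ Icc 0 L, HasDerivWithinAt (fun y => U y x) (Vx y x - (j y x - avg (j y)))
        (Icc 0 L) y) ∧
      (∀ x, ∀ y ∈ Icc 0 L, HasDerivWithinAt (fun y => V y x) (-Ux y x + (k x - avg k))
        (Icc 0 L) y) ∧
      (∀ x, V 0 x = 0) ∧ (∀ x, V L x = 0) ∧
      (∀ y, Hol a (4 * hcst a * S) (Ux y)) ∧ (∀ y, Hol a (4 * hcst a * S) (Vx y)) := by
  obtain ⟨W, X, κ, ι, hW, hX, hWp, hWX, hWL, hκ, hι, hr, hl, hb⟩ :=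
    exists_reflected hL ha hkp hk hk' hjc hjp hj hj'
  have hWn : Continuous fun p : ℝ × ℝ => W (-p.1) p.2 :=
    hW.comp (continuous_fst.neg.prodMk continuous_snd)
  have hXn : Continuous fun p : ℝ × ℝ => X (-p.1) p.2 :=
    hX.comp (continuous_fst.neg.prodMk continuous_snd)
  have hre : ∀ {f : ℝ → ℂ} {f' : ℂ} {s : Set ℝ} {x : ℝ}, HasDerivWithinAt f f' s x →
      HasDerivWithinAt (fun x => (f x).re) f'.re s x := fun h =>
    Complex.reCLM.hasFDerivAt.comp_hasDerivWithinAt _ h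
  have him : ∀ {f : ℝ → ℂ} {f' : ℂ} {s : Set ℝ} {x : ℝ}, HasDerivWithinAt f f' s x →
      HasDerivWithinAt (fun x => (f x).im) f'.im s x := fun h =>
    Complex.imCLM.hasFDerivAt.comp_hasDerivWithinAt _ h
  have hUx : ∀ y x, HasDerivAt (fun x => -(W y x + W (-y) x).im) (-(X y x + X (-y) x).im) x := by
    intro y x
    exact (hasDerivWithinAt_univ.1 (him ((hWX y x).add (hWX (-y) x)).hasDerivWithinAt)).neg
  have hVx : ∀ y x, HasDerivAt (fun x => (W y x - W (-y) x).re) (X y x - X (-y) x).re x := by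
    intro y x
    exact hasDerivWithinAt_univ.1 (hre ((hWX y x).sub (hWX (-y) x)).hasDerivWithinAt)
  have hpU : ∀ y, Function.Periodic (fun x => -(W y x + W (-y) x).im) 1 := fun y x => by
    simp only [hWp y x, hWp (-y) x]
  have hpV : ∀ y, Function.Periodic (fun x => (W y x - W (-y) x).re) 1 := fun y x => by
    simp only [hWp y x, hWp (-y) x]
  have hUh : ∀ y x x', |-(X y x + X (-y) x).im - -(X y x' + X (-y) x').im|
      ≤ 4 * hcst a * S * |x - x'| ^ a := by
    intro y x x'
    have h3 := (Complex.abs_im_le_norm _).trans (hb y x x')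
    have h4 := (Complex.abs_im_le_norm _).trans (hb (-y) x x')
    rw [Complex.sub_im] at h3 h4
    rw [Complex.add_im, Complex.add_im]
    rw [abs_le] at h3 h4 ⊢
    constructor <;> linarith [h3.1, h3.2, h4.1, h4.2]
  have hVh : ∀ y x x', |(X y x - X (-y) x).re - (X y x' - X (-y) x').re|
      ≤ 4 * hcst a * S * |x - x'| ^ a := by
    intro y x x'
    have h3 := (Complex.abs_re_le_norm _).trans (hb y x x')
    have h4 := (Complex.abs_re_le_norm _).trans (hb (-y) x x')
    rw [Complex.sub_re] at h3 h4
    rw [Complex.sub_re, Complex.sub_re]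
    rw [abs_le] at h3 h4 ⊢
    constructor <;> linarith [h3.1, h3.2, h4.1, h4.2]
  refine ⟨fun y x => -(W y x + W (-y) x).im, fun y x => (W y x - W (-y) x).re,
    fun y x => -(X y x + X (-y) x).im, fun y x => (X y x - X (-y) x).re,
    ⟨(Complex.continuous_im.comp (hW.add hWn)).neg, Complex.continuous_re.comp (hW.sub hWn),
    (Complex.continuous_im.comp (hX.add hXn)).neg, Complex.continuous_re.comp (hX.sub hXn)⟩,
    hpU, hpV, hUx, hVx, fun x y hy => ?_, fun x y hy => ?_, fun x => by simp, fun x => ?_,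
    fun y => ⟨abs_le_of_periodic_deriv ha.1.le (hpU y) (hUx y) (hUh y), hUh y⟩,
    fun y => ⟨abs_le_of_periodic_deriv ha.1.le (hpV y) (hVx y) (hVh y), hVh y⟩⟩
  · refine ((him ((hl x y hy).sub (hr x y hy))).congr (fun y _ => ?_) ?_).congr_deriv ?_
    · simp only [Pi.sub_apply, Complex.sub_im, Complex.add_im, Complex.neg_im]; ring
    · simp only [Pi.sub_apply, Complex.sub_im, Complex.add_im, Complex.neg_im]; ring
    rw [← hι y x]
    simp only [Complex.sub_im, Complex.add_im, Complex.mul_im, Complex.neg_im, Complex.neg_re,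
      Complex.I_im, Complex.I_re, Complex.sub_re]
    ring
  · refine ((hre ((hl x y hy).add (hr x y hy))).congr (fun y _ => ?_) ?_).congr_deriv ?_
    · simp only [Pi.add_apply, Complex.sub_re, Complex.add_re, Complex.neg_re]; ring
    · simp only [Pi.add_apply, Complex.sub_re, Complex.add_re, Complex.neg_re]; ring
    rw [← hκ x]
    simp only [Complex.add_im, Complex.mul_re, Complex.neg_im, Complex.neg_re,
      Complex.I_im, Complex.I_re, Complex.sub_re, Complex.add_re]
    ring
  · simp only [hWL x, sub_self, Complex.zero_re]

end DirichletProblem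

section LinearProblem

open Filter Topology MeasureTheory

/-- Projection of `ℝ` onto `[0, L]`. -/
def cl (L y : ℝ) : ℝ := max 0 (min L y)

lemma cl_of_mem {L y : ℝ} (hy : y ∈ Icc 0 L) : cl L y = y := by
  simp [cl, hy.1, hy.2]

lemma cl_mem {L : ℝ} (hL : 0 < L) (y : ℝ) : cl L y ∈ Icc 0 L := by
  simp [cl, hL.le]

lemma continuous_cl (L : ℝ) : Continuous (cl L) := by unfold cl; fun_prop

lemma cl_cl {L : ℝ} (hL : 0 < L) (y : ℝ) : cl L (cl L y) = cl L y := cl_of_mem (cl_mem hL y)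

/-- Solutions of the linearised problem `u_y = v_x - j`, `v_y = -u_x`, extended constantly across
the boundary of the strip; functions take the arguments in the order `y`, `x`. -/
structure LinSol (L : ℝ) (β τ : ℝ → ℝ) (j : ℝ → ℝ → ℝ) (Φ : ℝ) (u v ux vx : ℝ → ℝ → ℝ) :
    Prop where
  cu : Continuous (Function.uncurry u)
  cv : Continuous (Function.uncurry v)
  cux : Continuous (Function.uncurry ux)
  cvx : Continuous (Function.uncurry vx)
  clu : ∀ y, u y = u (cl L y)
  clv : ∀ y, v y = v (cl L y)
  clux : ∀ y, ux y = ux (cl L y)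
  clvx : ∀ y, vx y = vx (cl L y)
  pu : ∀ y, Function.Periodic (u y) 1
  pv : ∀ y, Function.Periodic (v y) 1
  du : ∀ y x, HasDerivAt (u y) (ux y x) x
  dv : ∀ y x, HasDerivAt (v y) (vx y x) x
  duy : ∀ x, ∀ y ∈ Icc 0 L, HasDerivWithinAt (fun y => u y x) (vx y x - j y x) (Icc 0 L) y
  dvy : ∀ x, ∀ y ∈ Icc 0 L, HasDerivWithinAt (fun y => v y x) (-ux y x) (Icc 0 L) y
  bot : ∀ x, v 0 x = β x
  top : ∀ x, vx L x = τ x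
  flux : ∫ y in (0 : ℝ)..L, u y 0 = Φ

lemma avg_deriv {f f' : ℝ → ℝ} (hf : Function.Periodic f 1) (h : ∀ x, HasDerivAt f (f' x) x)
    (hc : Continuous f') : avg f' = 0 := by
  unfold avg
  rw [intervalIntegral.integral_eq_sub_of_hasDerivAt (f := f) (fun x _ => h x)
    (hc.intervalIntegrable _ _)]
  have := hf 0
  simp at this
  simp [this]

lemma continuous_avg {j : ℝ → ℝ → ℝ} (hj : Continuous (Function.uncurry j)) :
    Continuous (fun y => avg (j y)) :=
  intervalIntegral.continuous_parametric_intervalIntegral_of_continuous' hj 0 1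

lemma avg_sub {f g : ℝ → ℝ} (hf : Continuous f) (hg : Continuous g) :
    avg (fun x => f x - g x) = avg f - avg g :=
  intervalIntegral.integral_sub (hf.intervalIntegrable _ _) (hg.intervalIntegrable _ _)

lemma avg_const_mul (c : ℝ) (f : ℝ → ℝ) : avg (fun x => c * f x) = c * avg f :=
  intervalIntegral.integral_const_mul _ _

/-- A periodic primitive with prescribed average. -/
lemma exists_primitive {τ : ℝ → ℝ} (hc : Continuous τ) (hp : Function.Periodic τ 1)
    (h0 : avg τ = 0) (m : ℝ) :
    ∃ b : ℝ → ℝ, (∀ x, HasDerivAt b (τ x) x) ∧ Function.Periodic b 1 ∧ avg b = m := by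
  set b₀ : ℝ → ℝ := fun x => ∫ t in (0 : ℝ)..x, τ t with hb₀
  have hd : ∀ x, HasDerivAt b₀ (τ x) x := fun x =>
    intervalIntegral.integral_hasDerivAt_right (hc.intervalIntegrable _ _)
      hc.stronglyMeasurable.stronglyMeasurableAtFilter hc.continuousAt
  have hcb : Continuous b₀ := continuous_iff_continuousAt.2 fun x => (hd x).continuousAt
  have hpb : Function.Periodic b₀ 1 := by
    intro x
    have h1 : (∫ t in x..x + 1, τ t) = 0 := by
      rw [hp.intervalIntegral_add_eq x 0]; simpa [avg] using h0
    have h2 := intervalIntegral.integral_add_adjacent_intervals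
      (hc.intervalIntegrable (μ := volume) 0 x) (hc.intervalIntegrable x (x + 1))
    simp only [hb₀]
    linarith
  refine ⟨fun x => b₀ x - (avg b₀ - m), fun x => (hd x).sub_const _, fun x => ?_, ?_⟩
  · beta_reduce; rw [hpb x]
  · rw [avg_sub hcb continuous_const]; simp [avg]

theorem exists_linSol {a S T L Φ : ℝ} (hL : 0 < L) (ha : a ∈ Ioo (0 : ℝ) 1) {β βd τ : ℝ → ℝ}
    {j : ℝ → ℝ → ℝ} (hβ : ∀ x, HasDerivAt β (βd x) x) (hβp : Function.Periodic β 1)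
    (hβd : Hol a S βd) (hβd' : DQ a T βd)
    (hτ : Hol a S τ) (hτ' : DQ a T τ) (hτp : Function.Periodic τ 1) (hτ0 : avg τ = 0)
    (hjc : Continuous (Function.uncurry j)) (hjp : ∀ y, Function.Periodic (j y) 1)
    (hj : ∀ y, Hol a S (j y)) (hj' : ∀ y, DQ a T (j y)) :
    ∃ u v ux vx, LinSol L β τ j Φ u v ux vx ∧
      (∀ y, Hol a (4 * hcst a * ((6 / L + 5) * S)) (ux y)) ∧
      (∀ y, Hol a (3 * S + 4 * hcst a * ((6 / L + 5) * S)) (vx y)) := by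
  have hS : 0 ≤ S := hτ.nonneg
  have hT : 0 ≤ T := hτ'.nonneg
  have hτc : Continuous τ := hτ.continuous ha.1
  have hβdc : Continuous βd := hβd.continuous ha.1
  have hβc : Continuous β := continuous_iff_continuousAt.2 fun x => (hβ x).continuousAt
  have hβdp : Function.Periodic βd 1 := by
    intro x
    have h1 : HasDerivAt β (βd (x + 1)) x := by
      have := (hβ (x + 1)).comp_add_const x 1
      rwa [show (fun x => β (x + 1)) = β from funext hβp] at this
    exact h1.unique (hβ x)
  have hβd0 : avg βd = 0 := avg_deriv hβp hβ hβdc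
  obtain ⟨b, hb, hbp, hb0⟩ := exists_primitive hτc hτp hτ0 (avg β)
  have hbc : Continuous b := continuous_iff_continuousAt.2 fun x => (hb x).continuousAt
  have hd : ∀ x, HasDerivAt (fun x => b x - β x) (τ x - βd x) x := fun x => (hb x).sub (hβ x)
  have hdp : Function.Periodic (fun x => b x - β x) 1 := fun x => by
    beta_reduce; rw [hbp x, hβp x]
  have hdh : Hol a (S + S) (fun x => τ x - βd x) := hτ.sub hβd
  have hdl := lip_of_hasDerivAt hd hdh.1
  have hda : avg (fun x => b x - β x) = 0 := by rw [avg_sub hbc hβc, hb0, sub_self]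
  have hdb := abs_le_of_avg_zero (hbc.sub hβc) hdp hdl hda
  have hdH := hol_of_lip ha (f := fun x => b x - β x) hdb hdl
  have hdD := DQ.of_hasDerivAt hd hdh
  set k : ℝ → ℝ := fun x => (-1 / L) * (b x - β x) with hk
  have hkH := hdH.const_mul (-1 / L)
  have hkD := hdD.const_mul (-1 / L)
  have hk0 : avg k = 0 := by rw [hk, avg_const_mul, hda, mul_zero]
  set jt : ℝ → ℝ → ℝ := fun y x => j (cl L y) x - βd x - (cl L y / L) * (τ x - βd x) with hjt
  have hjtH : ∀ y, Hol a (S + S + 1 * (S + S)) (jt y) := fun y => by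
    refine ((hj _).sub hβd).sub (((hdh).const_mul (cl L y / L)).mono ?_)
    have := cl_mem hL y
    gcongr
    rw [abs_of_nonneg (div_nonneg this.1 hL.le)]
    exact div_le_one_of_le₀ this.2 hL.le
  have hjtD : ∀ y, DQ a (T + T + 1 * (T + T)) (jt y) := fun y => by
    refine ((hj' _).sub hβd').sub (((hτ'.sub hβd').const_mul (cl L y / L)).mono ?_)
    have := cl_mem hL y
    gcongr
    rw [abs_of_nonneg (div_nonneg this.1 hL.le)]
    exact div_le_one_of_le₀ this.2 hL.le
  have hcl := continuous_cl L
  have hjtc : Continuous (Function.uncurry jt) := by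
    have h1 : Continuous (fun p : ℝ × ℝ => j (cl L p.1) p.2) :=
      hjc.comp ((hcl.comp continuous_fst).prodMk continuous_snd)
    have h2 : Continuous (fun p : ℝ × ℝ => cl L p.1 / L) := (hcl.comp continuous_fst).div_const _
    exact (h1.sub (hβdc.comp continuous_snd)).sub
      (h2.mul ((hτc.comp continuous_snd).sub (hβdc.comp continuous_snd)))
  have hjtp : ∀ y, Function.Periodic (jt y) 1 := fun y x => by
    simp only [hjt]; rw [hjp _ x, hβdp x, hτp x]
  have hjcy : ∀ y, Continuous (j y) := fun y => (hj y).continuous ha.1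
  have hjta : ∀ y ∈ Icc 0 L, avg (jt y) = avg (j y) := fun y hy => by
    simp only [hjt]
    have e1 := avg_sub (f := fun x => j (cl L y) x - βd x)
      (g := fun x => cl L y / L * (τ x - βd x)) ((hjcy _).sub hβdc)
      (continuous_const.mul (hτc.sub hβdc))
    rw [e1, avg_sub (hjcy _) hβdc, avg_const_mul, avg_sub hτc hβdc, hτ0, hβd0, cl_of_mem hy]
    ring
  have hkp : Function.Periodic k 1 := fun x => by
    simp only [hk]; rw [hbp x, hβp x]
  have hLL : |-1 / L| = 1 / L := by rw [abs_div, abs_neg, abs_one, abs_of_pos hL]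
  rw [hLL] at hkH hkD
  have hkH' : Hol a ((6 / L + 5) * S) k := hkH.mono (by
    have : 0 ≤ S / L := by positivity
    calc _ = 6 / L * S := by ring
      _ ≤ _ := by nlinarith)
  have hjtH' : ∀ y, Hol a ((6 / L + 5) * S) (jt y) := fun y => (hjtH y).mono (by
    have : 0 ≤ 6 / L * S := by positivity
    nlinarith)
  have hkD' : DQ a (1 / L * (S + S) + 4 * T) k := hkD.mono (by linarith)
  have hjtD' : ∀ y, DQ a (1 / L * (S + S) + 4 * T) (jt y) := fun y => (hjtD y).mono (by
    have : 0 ≤ 1 / L * (S + S) := by positivity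
    linarith)
  obtain ⟨U, V, Ux, Vx, ⟨hcU, hcV, hcUx, hcVx⟩, hpU, hpV, hdU, hdV, hUy, hVy, hV0, hVL, hUb, hVb⟩ :=
    exists_dirichlet hL ha hkp hkH' hkD' hjtc hjtp hjtH' hjtD'
  have hja := continuous_avg hjc
  set G : ℝ → ℝ := fun y => ∫ s in (0 : ℝ)..y, avg (j s) with hG
  have hGd : ∀ y, HasDerivAt G (avg (j y)) y := fun y =>
    intervalIntegral.integral_hasDerivAt_right (hja.intervalIntegrable _ _)
      hja.stronglyMeasurable.stronglyMeasurableAtFilter hja.continuousAt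
  have hGc : Continuous G := continuous_iff_continuousAt.2 fun x => (hGd x).continuousAt
  set C : ℝ := (Φ - ∫ y in (0 : ℝ)..L, (U y 0 - G y)) / L with hC
  have hVxL : ∀ x, Vx L x = 0 := fun x => by
    have h1 : HasDerivAt (V L) 0 x := by
      rw [show V L = fun _ => (0 : ℝ) from funext hVL]; exact hasDerivAt_const _ _
    exact (hdV L x).unique h1
  have cU : Continuous (fun p : ℝ × ℝ => U (cl L p.1) p.2) :=
    hcU.comp ((hcl.comp continuous_fst).prodMk continuous_snd)
  have cV : Continuous (fun p : ℝ × ℝ => V (cl L p.1) p.2) :=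
    hcV.comp ((hcl.comp continuous_fst).prodMk continuous_snd)
  have cUx : Continuous (fun p : ℝ × ℝ => Ux (cl L p.1) p.2) :=
    hcUx.comp ((hcl.comp continuous_fst).prodMk continuous_snd)
  have cVx : Continuous (fun p : ℝ × ℝ => Vx (cl L p.1) p.2) :=
    hcVx.comp ((hcl.comp continuous_fst).prodMk continuous_snd)
  have cl1 : Continuous (fun p : ℝ × ℝ => cl L p.1) := hcl.comp continuous_fst
  have hcle : ∀ y ∈ Icc 0 L, cl L y = y := fun y hy => cl_of_mem hy
  refine ⟨fun y x => U (cl L y) x + (C - G (cl L y)),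
    fun y x => β x + (cl L y / L) * (b x - β x) + V (cl L y) x,
    fun y x => Ux (cl L y) x,
    fun y x => βd x + (cl L y / L) * (τ x - βd x) + Vx (cl L y) x, ?_, fun y => hUb _, fun y => ?_⟩
  · refine ⟨?_, ?_, cUx, ?_, ?_, ?_, ?_, ?_, ?_, ?_, ?_, ?_, ?_, ?_, ?_, ?_, ?_⟩
    · exact cU.add (continuous_const.sub (hGc.comp cl1))
    · exact ((hβc.comp continuous_snd).add ((cl1.div_const _).mul
        ((hbc.comp continuous_snd).sub (hβc.comp continuous_snd)))).add cV
    · exact ((hβdc.comp continuous_snd).add ((cl1.div_const _).mul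
        ((hτc.comp continuous_snd).sub (hβdc.comp continuous_snd)))).add cVx
    · intro y; rw [cl_cl hL]
    · intro y; rw [cl_cl hL]
    · intro y; rw [cl_cl hL]
    · intro y; rw [cl_cl hL]
    · intro y x; beta_reduce; rw [hpU _ x]
    · intro y x; beta_reduce; rw [hpV _ x, hβp x, hbp x]
    · intro y x; exact (hdU _ x).add_const _
    · intro y x; exact ((hβ x).add ((hd x).const_mul _)).add (hdV _ x)
    · intro x y hy
      have h1 := (hUy x y hy).add ((hGd y).hasDerivWithinAt.const_sub C)
      refine HasDerivWithinAt.congr_deriv (h1.congr (fun z hz => ?_) ?_) ?_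
      · rw [cl_of_mem hz]; rfl
      · rw [cl_of_mem hy]; rfl
      · rw [hjta y hy]; simp only [hjt]; rw [cl_of_mem hy]; ring
    · intro x y hy
      have h2 : HasDerivAt (fun y : ℝ => β x + (y / L) * (b x - β x)) ((1 / L) * (b x - β x)) y := by
        exact (((hasDerivAt_id y).div_const L).mul_const _).const_add _
      have h1 := h2.hasDerivWithinAt.add (hVy x y hy)
      refine HasDerivWithinAt.congr_deriv (h1.congr (fun z hz => ?_) ?_) ?_
      · rw [cl_of_mem hz]; rfl
      · rw [cl_of_mem hy]; rfl
      · rw [hk0]; simp only [hk]; rw [cl_of_mem hy]; ring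
    · intro x; rw [cl_of_mem ⟨le_rfl, hL.le⟩, hV0]; simp
    · intro x; rw [cl_of_mem ⟨hL.le, le_rfl⟩, hVxL]; field_simp; ring
    · have h1 : ∀ y ∈ uIcc 0 L, U (cl L y) 0 + (C - G (cl L y)) = (U y 0 - G y) + C := by
        intro y hy
        rw [uIcc_of_le hL.le] at hy
        rw [cl_of_mem hy]; ring
      rw [intervalIntegral.integral_congr h1]
      have hc1 : Continuous (fun y => U y 0 - G y) :=
        (hcU.comp (continuous_id.prodMk continuous_const)).sub hGc
      rw [intervalIntegral.integral_add (hc1.intervalIntegrable _ _) (by simp)]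
      rw [intervalIntegral.integral_const, hC]
      simp only [smul_eq_mul, sub_zero]
      field_simp
      ring
  · refine Hol.add ((hβd.add (((hdh).const_mul (cl L y / L)).mono
      (?_ : _ ≤ 1 * (S + S)))).mono (by linarith)) (hVb _)
    have := cl_mem hL y
    gcongr
    rw [abs_of_nonneg (div_nonneg this.1 hL.le)]
    exact div_le_one_of_le₀ this.2 hL.le

end LinearProblem

section LinearUniqueness

open Filter Topology MeasureTheory

lemma integral_swap {f : ℝ → ℝ → ℝ} (hf : Continuous (Function.uncurry f)) {p q r s : ℝ}
    (hpq : p ≤ q) (hrs : r ≤ s) :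
    ∫ x in p..q, (∫ y in r..s, f x y) = ∫ y in r..s, (∫ x in p..q, f x y) := by
  simp only [intervalIntegral.integral_of_le hpq, intervalIntegral.integral_of_le hrs]
  refine integral_integral_swap ?_
  rw [Measure.prod_restrict]
  exact (hf.continuousOn.integrableOn_compact (isCompact_Icc.prod isCompact_Icc)).mono_set
    (prod_mono Ioc_subset_Icc_self Ioc_subset_Icc_self)

lemma eq_zero_of_integral_eq_zero {f : ℝ → ℝ} (hf : Continuous f) {p q : ℝ} (hpq : p < q)
    (h0 : ∀ x, 0 ≤ f x) (h : ∫ x in p..q, f x = 0) : ∀ x ∈ Icc p q, f x = 0 := by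
  intro x hx
  by_contra hne
  exact absurd h (intervalIntegral.integral_pos hpq hf.continuousOn (fun _ _ => h0 _)
    ⟨x, hx, lt_of_le_of_ne (h0 x) (Ne.symm hne)⟩).ne'

variable {L Φ Φ' : ℝ} {β τ β' τ' : ℝ → ℝ} {j u v ux vx j' u' v' ux' vx' : ℝ → ℝ → ℝ}

lemma LinSol.sub (h : LinSol L β τ j Φ u v ux vx) (h' : LinSol L β' τ' j' Φ' u' v' ux' vx') :
    LinSol L (fun x => β x - β' x) (fun x => τ x - τ' x) (fun y x => j y x - j' y x) (Φ - Φ')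
      (fun y x => u y x - u' y x) (fun y x => v y x - v' y x) (fun y x => ux y x - ux' y x)
      (fun y x => vx y x - vx' y x) where
  cu := h.cu.sub h'.cu
  cv := h.cv.sub h'.cv
  cux := h.cux.sub h'.cux
  cvx := h.cvx.sub h'.cvx
  clu y := by rw [h.clu y, h'.clu y]
  clv y := by rw [h.clv y, h'.clv y]
  clux y := by rw [h.clux y, h'.clux y]
  clvx y := by rw [h.clvx y, h'.clvx y]
  pu y x := by beta_reduce; rw [h.pu y x, h'.pu y x]
  pv y x := by beta_reduce; rw [h.pv y x, h'.pv y x]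
  du y x := (h.du y x).sub (h'.du y x)
  dv y x := (h.dv y x).sub (h'.dv y x)
  duy x y hy := ((h.duy x y hy).sub (h'.duy x y hy)).congr_deriv (by ring)
  dvy x y hy := ((h.dvy x y hy).sub (h'.dvy x y hy)).congr_deriv (by ring)
  bot x := by rw [h.bot, h'.bot]
  top x := by rw [h.top, h'.top]
  flux := by
    have c1 : Continuous (fun y => u y 0) := h.cu.comp (continuous_id.prodMk continuous_const)
    have c2 : Continuous (fun y => u' y 0) := h'.cu.comp (continuous_id.prodMk continuous_const)
    rw [intervalIntegral.integral_sub (c1.intervalIntegrable _ _) (c2.intervalIntegrable _ _),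
      h.flux, h'.flux]

lemma LinSol.shift (h : LinSol L β τ j Φ u v ux vx) (k : ℝ) :
    LinSol L (fun x => β (x + k)) (fun x => τ (x + k)) (fun y x => j y (x + k))
      (∫ y in (0 : ℝ)..L, u y k)
      (fun y x => u y (x + k)) (fun y x => v y (x + k)) (fun y x => ux y (x + k))
      (fun y x => vx y (x + k)) where
  cu := h.cu.comp (continuous_fst.prodMk (continuous_snd.add continuous_const))
  cv := h.cv.comp (continuous_fst.prodMk (continuous_snd.add continuous_const))
  cux := h.cux.comp (continuous_fst.prodMk (continuous_snd.add continuous_const))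
  cvx := h.cvx.comp (continuous_fst.prodMk (continuous_snd.add continuous_const))
  clu y := by rw [h.clu y]
  clv y := by rw [h.clv y]
  clux y := by rw [h.clux y]
  clvx y := by rw [h.clvx y]
  pu y x := by beta_reduce; rw [add_right_comm, h.pu y]
  pv y x := by beta_reduce; rw [add_right_comm, h.pv y]
  du y x := (h.du y (x + k)).comp_add_const x k
  dv y x := (h.dv y (x + k)).comp_add_const x k
  duy x y hy := h.duy _ y hy
  dvy x y hy := h.dvy _ y hy
  bot x := h.bot _
  top x := h.top _
  flux := by simp

lemma LinSol.zero : LinSol L (fun _ => 0) (fun _ => 0) (fun _ _ => 0) 0 (fun _ _ => 0)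
    (fun _ _ => 0) (fun _ _ => 0) (fun _ _ => 0) where
  cu := continuous_const
  cv := continuous_const
  cux := continuous_const
  cvx := continuous_const
  clu _ := rfl
  clv _ := rfl
  clux _ := rfl
  clvx _ := rfl
  pu _ _ := rfl
  pv _ _ := rfl
  du _ x := hasDerivAt_const x 0
  dv _ x := hasDerivAt_const x 0
  duy _ y _ := (hasDerivWithinAt_const y _ 0).congr_deriv (by ring)
  dvy _ y _ := (hasDerivWithinAt_const y _ 0).congr_deriv (by ring)
  bot _ := rfl
  top _ := rfl
  flux := by simp

/-- Integrated form of `v_y = -u_x`. -/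
lemma LinSol.integral_ux (h : LinSol L β τ j Φ u v ux vx) {y : ℝ} (hy : y ∈ Icc 0 L) (x : ℝ) :
    ∫ r in (0 : ℝ)..y, ux r x = β x - v y x := by
  have hc : Continuous (fun r => ux r x) := h.cux.comp (continuous_id.prodMk continuous_const)
  have := intervalIntegral.integral_eq_sub_of_hasDerivAt_of_le (f := fun y => v y x)
    (f' := fun r => -ux r x) hy.1
    (fun r hr => ((h.dvy x r ⟨hr.1, hr.2.trans hy.2⟩).mono (Icc_subset_Icc_right hy.2)).continuousWithinAt)
    (fun r hr => (h.dvy x r ⟨hr.1.le, hr.2.le.trans hy.2⟩).hasDerivAt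
      (Icc_mem_nhds hr.1 (hr.2.trans_le hy.2))) ((hc.neg).intervalIntegrable _ _)
  rw [intervalIntegral.integral_neg, h.bot] at this
  linarith

/-- The derivative in `x` of the partial flux. -/
lemma LinSol.hasDerivAt_flux (h : LinSol L β τ j Φ u v ux vx) (hβ : Continuous β)
    {y : ℝ} (hy : y ∈ Icc 0 L) (x : ℝ) :
    HasDerivAt (fun x => ∫ r in (0 : ℝ)..y, u r x) (β x - v y x) x := by
  have key : ∀ z, (∫ r in (0 : ℝ)..y, u r z)
      = (∫ r in (0 : ℝ)..y, u r (x - 1)) + ∫ t in (x - 1)..z, (β t - v y t) := by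
    intro z
    have e1 : ∀ t, β t - v y t = ∫ r in (0 : ℝ)..y, ux r t := fun t => (h.integral_ux hy t).symm
    simp only [e1]
    have e2 : (∫ t in (x - 1)..z, ∫ r in (0 : ℝ)..y, ux r t)
        = ∫ r in (0 : ℝ)..y, ∫ t in (x - 1)..z, ux r t := by
      have hc : Continuous (Function.uncurry fun t r => ux r t) := h.cux.comp continuous_swap
      rcases le_total (x - 1) z with hz | hz
      · exact integral_swap hc hz hy.1
      · have := integral_swap hc hz hy.1
        rw [intervalIntegral.integral_symm]
        simp only [fun r => intervalIntegral.integral_symm (μ := volume) (f := ux r) z (x - 1)]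
        rw [this, intervalIntegral.integral_neg]
    rw [e2]
    have e3 : ∀ r, (∫ t in (x - 1)..z, ux r t) = u r z - u r (x - 1) := fun r => by
      refine intervalIntegral.integral_eq_sub_of_hasDerivAt (fun t _ => h.du r t) ?_
      exact Continuous.intervalIntegrable
        (h.cux.comp (continuous_const.prodMk continuous_id)) _ _
    simp only [e3]
    have c1 : Continuous (fun y => u y z) := h.cu.comp (continuous_id.prodMk continuous_const)
    have c2 : Continuous (fun y => u y (x - 1)) :=
      h.cu.comp (continuous_id.prodMk continuous_const)
    rw [intervalIntegral.integral_sub (c1.intervalIntegrable _ _) (c2.intervalIntegrable _ _)]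
    ring
  have hc : Continuous (fun t => β t - v y t) :=
    hβ.sub (h.cv.comp (continuous_const.prodMk continuous_id))
  refine HasDerivAt.congr_of_eventuallyEq ?_ (Eventually.of_forall key)
  exact (intervalIntegral.integral_hasDerivAt_right (hc.intervalIntegrable _ _)
      hc.stronglyMeasurable.stronglyMeasurableAtFilter hc.continuousAt).const_add _

theorem LinSol.eq_zero (hL : 0 < L)
    (h : LinSol L (fun _ => 0) (fun _ => 0) (fun _ _ => 0) 0 u v ux vx) (y x : ℝ) :
    u y x = 0 ∧ v y x = 0 := by
  have cuy : ∀ x, Continuous (fun y => u y x) := fun x =>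
    h.cu.comp (continuous_id.prodMk continuous_const)
  have cvy : ∀ x, Continuous (fun y => v y x) := fun x =>
    h.cv.comp (continuous_id.prodMk continuous_const)
  have cvx : ∀ y, Continuous (v y) := fun y => h.cv.comp (continuous_const.prodMk continuous_id)
  have cvxx : ∀ y, Continuous (vx y) := fun y =>
    h.cvx.comp (continuous_const.prodMk continuous_id)
  have cvxy : ∀ x, Continuous (fun y => vx y x) := fun x =>
    h.cvx.comp (continuous_id.prodMk continuous_const)
  set φ : ℝ → ℝ → ℝ := fun y x => ∫ r in (0 : ℝ)..y, u r x with hφ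
  have hφx : ∀ y ∈ Icc 0 L, ∀ x, HasDerivAt (φ y) (-v y x) x := fun y hy x => by
    simpa using h.hasDerivAt_flux continuous_const hy x
  have hφp : ∀ y, Function.Periodic (φ y) 1 := fun y x => by
    simp only [hφ, fun r => h.pu r x]
  have hLm : L ∈ Icc 0 L := ⟨hL.le, le_rfl⟩
  have hvL : ∀ x, v L x = v L 0 := fun x => by
    have := lip_of_hasDerivAt (f := v L) (f' := vx L) (S := 0) (fun x => h.dv L x)
      (fun x => by rw [h.top]; simp) x 0
    rw [zero_mul] at this
    exact sub_eq_zero.1 (norm_le_zero_iff.1 this)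
  have hvL0 : v L 0 = 0 := by
    have h1 : avg (fun x => -v L x) = 0 := avg_deriv (hφp L) (hφx L hLm) (cvx L).neg
    simp only [hvL, avg] at h1
    simpa using h1
  have hφL : ∀ x, φ L x = 0 := fun x => by
    have := lip_of_hasDerivAt (f := φ L) (f' := fun x => -v L x) (S := 0) (hφx L hLm)
      (fun x => by rw [hvL, hvL0]; simp) x 0
    rw [zero_mul] at this
    rw [sub_eq_zero.1 (norm_le_zero_iff.1 this)]
    exact h.flux
  have hφ0 : ∀ x, φ 0 x = 0 := fun x => by simp [hφ]
  have hφc : Continuous (Function.uncurry φ) := by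
    have := intervalIntegral.continuous_parametric_intervalIntegral_of_continuous
      (μ := volume) (f := fun (p : ℝ × ℝ) r => u r p.2) (a₀ := 0) (s := fun p => p.1)
      (h.cu.comp (continuous_snd.prodMk (continuous_snd.comp continuous_fst))) continuous_fst
    exact this
  have hφy : ∀ x y, HasDerivAt (fun y => φ y x) (u y x) y := fun x y =>
    intervalIntegral.integral_hasDerivAt_right ((cuy x).intervalIntegrable _ _)
      (cuy x).stronglyMeasurable.stronglyMeasurableAtFilter (cuy x).continuousAt
  have E1 : ∀ x, ∫ y in (0 : ℝ)..L, (u y x ^ 2 + φ y x * vx y x) = 0 := fun x => by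
    have cφ : Continuous (fun y => φ y x) := hφc.comp (continuous_id.prodMk continuous_const)
    have := intervalIntegral.integral_eq_sub_of_hasDerivAt_of_le (f := fun y => φ y x * u y x)
      (f' := fun y => u y x ^ 2 + φ y x * vx y x) hL.le
      ((cφ.mul (cuy x)).continuousOn)
      (fun r hr => by
        have h1 := (h.duy x r ⟨hr.1.le, hr.2.le⟩).hasDerivAt (Icc_mem_nhds hr.1 hr.2)
        exact ((hφy x r).mul h1).congr_deriv (by ring))
      ((((cuy x).pow 2).add (cφ.mul (cvxy x))).intervalIntegrable _ _)
    rw [this, hφL, hφ0]; ring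
  have E2 : ∀ y ∈ Icc 0 L, ∫ x in (0 : ℝ)..1, (φ y x * vx y x) = ∫ x in (0 : ℝ)..1, v y x ^ 2 := by
    intro y hy
    have cφ : Continuous (fun x => φ y x) := hφc.comp (continuous_const.prodMk continuous_id)
    have h1 : (∫ x in (0 : ℝ)..1, (φ y x * vx y x - v y x ^ 2)) = 0 := by
      refine avg_deriv (f := fun x => φ y x * v y x) (fun x => ?_) (fun x => ?_)
        ((cφ.mul (cvxx y)).sub ((cvx y).pow 2))
      · beta_reduce; rw [hφp y x, h.pv y x]
      · exact ((hφx y hy x).mul (h.dv y x)).congr_deriv (by ring)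
    have h2 := avg_sub (f := fun x => φ y x * vx y x) (g := fun x => v y x ^ 2)
      (cφ.mul (cvxx y)) ((cvx y).pow 2)
    unfold avg at h2
    linarith
  have hu2 : Continuous (Function.uncurry fun x y => u y x ^ 2) :=
    (h.cu.comp continuous_swap).pow 2
  have hpv : Continuous (Function.uncurry fun x y => φ y x * vx y x) :=
    (hφc.comp continuous_swap).mul (h.cvx.comp continuous_swap)
  have hv2 : Continuous (Function.uncurry fun x y => v y x ^ 2) :=
    (h.cv.comp continuous_swap).pow 2
  have P : ∀ f : ℝ → ℝ → ℝ, Continuous (Function.uncurry f) → ∀ x,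
      Continuous (f x) := fun f hf x => hf.comp (continuous_const.prodMk continuous_id)
  have Q : ∀ f : ℝ → ℝ → ℝ, Continuous (Function.uncurry f) →
      Continuous (fun x => ∫ y in (0 : ℝ)..L, f x y) := fun f hf =>
    intervalIntegral.continuous_parametric_intervalIntegral_of_continuous' hf 0 L
  have E3 : ∫ x in (0 : ℝ)..1, ∫ y in (0 : ℝ)..L, (u y x ^ 2 + v y x ^ 2) = 0 := by
    have s1 : ∀ x, ∫ y in (0 : ℝ)..L, (u y x ^ 2 + v y x ^ 2)
        = (∫ y in (0 : ℝ)..L, u y x ^ 2) + ∫ y in (0 : ℝ)..L, v y x ^ 2 := fun x =>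
      intervalIntegral.integral_add ((P _ hu2 x).intervalIntegrable _ _)
        ((P _ hv2 x).intervalIntegrable _ _)
    have s2 : ∀ x, (∫ y in (0 : ℝ)..L, u y x ^ 2) + ∫ y in (0 : ℝ)..L, φ y x * vx y x = 0 :=
      fun x => by
        rw [← intervalIntegral.integral_add ((P _ hu2 x).intervalIntegrable _ _)
          ((P _ hpv x).intervalIntegrable _ _), E1 x]
    simp only [s1]
    rw [intervalIntegral.integral_add ((Q _ hu2).intervalIntegrable _ _)
      ((Q _ hv2).intervalIntegrable _ _)]
    have s3 : (∫ x in (0 : ℝ)..1, ∫ y in (0 : ℝ)..L, v y x ^ 2)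
        = ∫ x in (0 : ℝ)..1, ∫ y in (0 : ℝ)..L, φ y x * vx y x := by
      rw [integral_swap hv2 zero_le_one hL.le, integral_swap hpv zero_le_one hL.le]
      refine intervalIntegral.integral_congr fun y hy => ?_
      rw [uIcc_of_le hL.le] at hy
      exact (E2 y hy).symm
    rw [s3, ← intervalIntegral.integral_add ((Q _ hu2).intervalIntegrable _ _)
      ((Q _ hpv).intervalIntegrable _ _)]
    simp only [s2]; simp
  have huv : Continuous (Function.uncurry fun x y => u y x ^ 2 + v y x ^ 2) := hu2.add hv2
  have E4 : ∀ x ∈ Icc (0 : ℝ) 1, ∀ y ∈ Icc 0 L, u y x ^ 2 + v y x ^ 2 = 0 := by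
    intro x hx
    have := eq_zero_of_integral_eq_zero (Q _ huv) zero_lt_one
      (fun x => intervalIntegral.integral_nonneg hL.le fun y _ => by positivity) E3 x hx
    exact eq_zero_of_integral_eq_zero (P _ huv x) hL (fun y => by positivity) this
  have hfr := E4 (Int.fract x) ⟨Int.fract_nonneg x, (Int.fract_lt_one x).le⟩ (cl L y) (cl_mem hL y)
  have e1 : ∀ f : ℝ → ℝ, Function.Periodic f 1 → f x = f (Int.fract x) := fun f hf => by
    have := per_add_int hf (Int.fract x) ⌊x⌋
    rw [← this, Int.fract_add_floor]
  rw [h.clu, h.clv, e1 _ (h.pu _), e1 _ (h.pv _)]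
  constructor <;> nlinarith [sq_nonneg (u (cl L y) (Int.fract x)),
    sq_nonneg (v (cl L y) (Int.fract x))]

lemma LinSol.unique (hL : 0 < L) (h : LinSol L β τ j Φ u v ux vx)
    (h' : LinSol L β τ j Φ u' v' ux' vx') : u = u' ∧ v = v' ∧ ux = ux' ∧ vx = vx' := by
  have h0 := h.sub h'
  simp only [sub_self] at h0
  have hu : u = u' := by
    funext y x; exact sub_eq_zero.1 (h0.eq_zero hL y x).1
  have hv : v = v' := by
    funext y x; exact sub_eq_zero.1 (h0.eq_zero hL y x).2
  refine ⟨hu, hv, ?_, ?_⟩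
  · funext y x
    have := h'.du y x
    rw [← hu] at this
    exact (h.du y x).unique this
  · funext y x
    have := h'.dv y x
    rw [← hv] at this
    exact (h.dv y x).unique this

/-- The constant of the linear estimate. -/
def lc (L a : ℝ) : ℝ :=
  5 + 3 * (4 * hcst a * (6 / L + 5)) + 2 * L * (4 + 4 * hcst a * (6 / L + 5)) + 2 / L

lemma lc_ge {a : ℝ} (hL : 0 < L) (ha : a ∈ Ioo (0 : ℝ) 1) : 5 ≤ lc L a := by
  have := hcst_nonneg ha
  unfold lc
  have : 0 ≤ 4 * hcst a * (6 / L + 5) := by positivity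
  have : 0 ≤ 2 / L := by positivity
  nlinarith

theorem LinSol.bound {a S T : ℝ} (hL : 0 < L) (ha : a ∈ Ioo (0 : ℝ) 1) {βd : ℝ → ℝ}
    (h : LinSol L β τ j Φ u v ux vx)
    (hβ : ∀ x, HasDerivAt β (βd x) x) (hβp : Function.Periodic β 1)
    (hβH : Hol a S β) (hβd : Hol a S βd) (hβd' : DQ a T βd)
    (hτ : Hol a S τ) (hτ' : DQ a T τ) (hτp : Function.Periodic τ 1) (hτ0 : avg τ = 0)
    (hjc : Continuous (Function.uncurry j)) (hjp : ∀ y, Function.Periodic (j y) 1)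
    (hj : ∀ y, Hol a S (j y)) (hj' : ∀ y, DQ a T (j y)) (hΦ : |Φ| ≤ S) (y : ℝ) :
    Hol a (lc L a * S) (u y) ∧ Hol a (lc L a * S) (v y) ∧ Hol a (lc L a * S) (ux y) ∧
      Hol a (lc L a * S) (vx y) := by
  obtain ⟨u', v', ux', vx', h', bux, bvx⟩ :=
    exists_linSol (Φ := Φ) hL ha hβ hβp hβd hβd' hτ hτ' hτp hτ0 hjc hjp hj hj'
  obtain ⟨-, -, rfl, rfl⟩ := h.unique hL h'
  have hS := hτ.nonneg
  set H : ℝ := 4 * hcst a * (6 / L + 5) with hH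
  have hH0 : 0 ≤ H := by have := hcst_nonneg ha; positivity
  have hL' : 0 ≤ 2 / L := by positivity
  have e1 : 4 * hcst a * ((6 / L + 5) * S) = H * S := by rw [hH]; ring
  rw [e1] at bux bvx
  have e2 : lc L a = 5 + 3 * H + 2 * L * (4 + H) + 2 / L := by rw [hH, lc]
  have hLH : 0 ≤ L * (4 + H) := by positivity
  have m1 : H ≤ lc L a := by rw [e2]; linarith
  have m2 : 3 + H ≤ lc L a := by rw [e2]; linarith
  have svB : ∀ y ∈ Icc 0 L, ∀ x, |v y x| ≤ S + L * (H * S) := by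
    intro y hy x
    have h1 := h.integral_ux hy x
    have h2 := intervalIntegral.norm_integral_le_of_norm_le_const (a := (0 : ℝ)) (b := y)
      (f := fun r => ux r x) (C := H * S) (fun r _ => (bux r).1 x)
    rw [h1, sub_zero, abs_of_nonneg hy.1, Real.norm_eq_abs] at h2
    have h3 : H * S * y ≤ L * (H * S) := by
      rw [mul_comm]; exact mul_le_mul_of_nonneg_right hy.2 (by positivity)
    have h4 := hβH.1 x
    rw [Real.norm_eq_abs] at h4
    have h5 : v y x = β x - (β x - v y x) := by ring
    rw [h5]
    exact (abs_sub _ _).trans (by linarith)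
  have suB : ∀ y ∈ Icc 0 L, ∀ x, |u y x| ≤ L * ((4 + H) * S) + H * S + S / L := by
    intro y hy x
    have h1 : ∀ r ∈ Icc 0 L, |u y x - u r 0| ≤ L * ((4 + H) * S) + H * S := by
      intro r hr
      have k1 := (convex_Icc 0 L).norm_image_sub_le_of_norm_hasDerivWithin_le
        (f := fun y => u y x) (f' := fun y => vx y x - j y x) (C := (4 + H) * S)
        (fun y hy => h.duy x y hy) (fun y hy => by
          refine (norm_sub_le _ _).trans ((add_le_add ((bvx y).1 x) ((hj y).1 x)).trans ?_)
          linarith) hr hy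
      have k2 := abs_sub_le_of_per (h.pu r) (lip_of_hasDerivAt (h.du r) (bux r).1) x 0
      have k3 : ‖y - r‖ ≤ L := by
        rw [Real.norm_eq_abs, abs_le]
        constructor <;> linarith [hy.1, hy.2, hr.1, hr.2]
      have k4 : (4 + H) * S * ‖y - r‖ ≤ L * ((4 + H) * S) := by
        rw [mul_comm]; exact mul_le_mul_of_nonneg_right k3 (by positivity)
      calc |u y x - u r 0| = ‖(u y x - u r x) + (u r x - u r 0)‖ := by
            rw [Real.norm_eq_abs]; congr 1; ring
        _ ≤ _ := norm_add_le _ _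
        _ ≤ _ := by linarith
    have c1 : Continuous (fun y => u y 0) := h.cu.comp (continuous_id.prodMk continuous_const)
    have h2 : (∫ r in (0 : ℝ)..L, (u y x - u r 0)) = L * u y x - Φ := by
      rw [intervalIntegral.integral_sub (by simp) (c1.intervalIntegrable _ _), h.flux]
      simp
    have h3 := intervalIntegral.norm_integral_le_of_norm_le_const (a := (0 : ℝ)) (b := L)
      (f := fun r => u y x - u r 0) (C := L * ((4 + H) * S) + H * S) (fun r hr => by
        rw [uIoc_of_le hL.le] at hr
        exact h1 r ⟨hr.1.le, hr.2⟩)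
    rw [h2, sub_zero, abs_of_pos hL, Real.norm_eq_abs] at h3
    have h4 : |L * u y x| ≤ (L * ((4 + H) * S) + H * S) * L + S := by
      have : L * u y x = (L * u y x - Φ) + Φ := by ring
      rw [this]
      exact (abs_add_le _ _).trans (add_le_add h3 hΦ)
    rw [abs_mul, abs_of_pos hL] at h4
    have h5 : |u y x| = L * |u y x| / L := by field_simp
    rw [h5]
    calc _ ≤ ((L * ((4 + H) * S) + H * S) * L + S) / L := by gcongr
      _ = _ := by field_simp
  refine ⟨?_, ?_, (bux y).mono (by gcongr), (bvx y).mono ?_⟩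
  · rw [h.clu]
    refine (hol_of_lip ha (suB _ (cl_mem hL y)) (lip_of_hasDerivAt (h.du _) (bux _).1)).mono ?_
    rw [e2]
    have : S / L * 2 = 2 / L * S := by ring
    nlinarith
  · rw [h.clv]
    refine (hol_of_lip ha (svB _ (cl_mem hL y)) (lip_of_hasDerivAt (h.dv _) (bvx _).1)).mono ?_
    rw [e2]
    have : 0 ≤ L * S := by positivity
    have : 0 ≤ 2 / L * S := by positivity
    nlinarith [mul_nonneg hH0 hS]
  · calc _ = (3 + H) * S := by ring
      _ ≤ _ := by gcongr

end LinearUniqueness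

section Iteration

open Filter Topology MeasureTheory

/-- Labels for the components of the unknown of the fixed point problem. -/
inductive Cmp | u | v | ux | vx | s | f

/-- Normalised boundary data. -/
structure Dat where
  gd : ℝ → ℝ
  Gd : ℝ → ℝ
  β : ℝ → ℝ
  βd : ℝ → ℝ
  A : ℝ → ℝ
  Φ : ℝ

/-- Admissible data of size `η`. -/
structure Dat.Ok (a η : ℝ) (d : Dat) : Prop where
  hβ : ∀ x, HasDerivAt d.β (d.βd x) x
  hA : ∀ x, HasDerivAt d.A (d.β x) x
  pgd : Function.Periodic d.gd 1
  pGd : Function.Periodic d.Gd 1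
  pβ : Function.Periodic d.β 1
  gdH : Hol a η d.gd
  gdD : DQ a η d.gd
  GdH : Hol a η d.Gd
  GdD : DQ a η d.Gd
  βH : Hol a η d.β
  βdH : Hol a η d.βd
  βdD : DQ a η d.βd

/-- Admissible states of size `η`. -/
structure St (a η : ℝ) (w : Cmp → ℝ → ℝ → ℝ) : Prop where
  hol : ∀ i y, Hol a η (w i y)
  dq : ∀ i y, DQ a η (w i y)
  per : ∀ i y, Function.Periodic (w i y) 1
  cs : Continuous (Function.uncurry (w .s))

/-- The current transported along the field lines. -/
def stepJ (w w' : Cmp → ℝ → ℝ → ℝ) (y x : ℝ) : ℝ := w' .f 0 (x + w .s y x)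

/-- The nonlinear expression prescribing `v_x` on the upper boundary. -/
def stepR (L : ℝ) (d : Dat) (w w' : Cmp → ℝ → ℝ → ℝ) (x : ℝ) : ℝ :=
  d.Gd x - (stepJ w w' L x + w .v L x * stepJ w w' L x) - w .u L x * w .ux L x
    - w .v L x * w .vx L x

/-- One step `w ↦ w'` of the iteration. -/
structure Step (L : ℝ) (d : Dat) (w w' : Cmp → ℝ → ℝ → ℝ) : Prop where
  f : ∀ y x, w' .f y x = d.gd x - w .u 0 x * w .ux 0 x - d.β x * w .f 0 x
  lin : LinSol L d.β (fun x => stepR L d w w' x - avg (stepR L d w w')) (stepJ w w') d.Φ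
    (w' .u) (w' .v) (w' .ux) (w' .vx)
  s : ∀ y x, w' .s y x = -(∫ r in (0 : ℝ)..cl L y, w' .u r x) - (d.A (x + w .s y x) - d.A x)

variable {a η L : ℝ} {d : Dat} {w w' : Cmp → ℝ → ℝ → ℝ}

lemma Dat.Ok.nonneg (h : d.Ok a η) : 0 ≤ η := h.gdH.nonneg

lemma Dat.Ok.mono {η' : ℝ} (h : d.Ok a η) (hη : η ≤ η') : d.Ok a η' :=
  { h with
    gdH := h.gdH.mono hη
    gdD := h.gdD.mono hη
    GdH := h.GdH.mono hη
    GdD := h.GdD.mono hη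
    βH := h.βH.mono hη
    βdH := h.βdH.mono hη
    βdD := h.βdD.mono hη }

lemma Dat.Ok.βD (h : d.Ok a η) : DQ a η d.β := DQ.of_hasDerivAt h.hβ h.βdH

lemma Dat.Ok.AD (h : d.Ok a η) : DQ a η d.A := DQ.of_hasDerivAt h.hA h.βH

lemma St.mono {η' : ℝ} (h : St a η w) (hη : η ≤ η') : St a η' w :=
  ⟨fun i y => (h.hol i y).mono hη, fun i y => (h.dq i y).mono hη, h.per, h.cs⟩

lemma St.lip (h : St a η w) (hη : η ≤ 1) (i : Cmp) (y x x' : ℝ) :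
    |w i y x - w i y x'| ≤ |x - x'| := by
  refine ((h.dq i y).lip x x').trans ?_
  nlinarith [abs_nonneg (x - x')]

lemma Step.holF (h : Step L d w w') (hd : d.Ok a η) (hw : St a η w) (hη : η ≤ 1) (y : ℝ) :
    Hol a (5 * η) (w' .f y) := by
  have h0 := hd.nonneg
  rw [show w' .f y = _ from funext (h.f y)]
  refine ((hd.gdH.sub ((hw.hol _ _).mul (hw.hol _ _))).sub (hd.βH.mul (hw.hol _ _))).mono ?_
  nlinarith

lemma Step.dqF (h : Step L d w w') (hd : d.Ok a η) (hw : St a η w) (hη : η ≤ 1) (y : ℝ) :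
    DQ a (9 * η) (w' .f y) := by
  have h0 := hd.nonneg
  rw [show w' .f y = _ from funext (h.f y)]
  refine ((hd.gdD.sub (DQ.mul (hw.hol .u 0) (hw.dq .u 0) (hw.hol .ux 0) (hw.dq .ux 0))).sub
    (DQ.mul hd.βH hd.βD (hw.hol .f 0) (hw.dq .f 0))).mono ?_
  nlinarith

lemma Step.perF (h : Step L d w w') (hd : d.Ok a η) (hw : St a η w) (y : ℝ) :
    Function.Periodic (w' .f y) 1 := fun x => by
  rw [h.f, h.f, hd.pgd, hd.pβ, hw.per _ 0 x, hw.per _ 0 x, hw.per _ 0 x]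

lemma Step.holJ (h : Step L d w w') (ha : a ∈ Ioo (0 : ℝ) 1) (hd : d.Ok a η) (hw : St a η w)
    (hη : η ≤ 1) (y : ℝ) : Hol a (10 * η) (stepJ w w' y) :=
  ((h.holF hd hw hη 0).comp ha (hw.lip hη .s y)).mono (by linarith)

lemma Step.dqJ (h : Step L d w w') (ha : a ∈ Ioo (0 : ℝ) 1) (hd : d.Ok a η) (hw : St a η w)
    (hη : η ≤ 1) (y : ℝ) : DQ a (54 * η) (stepJ w w' y) :=
  ((h.dqF hd hw hη 0).comp ha ((hw.dq .s y).mono hη)).mono (by linarith)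

lemma Step.perJ (h : Step L d w w') (hd : d.Ok a η) (hw : St a η w) (y : ℝ) :
    Function.Periodic (stepJ w w' y) 1 := fun x => by
  unfold stepJ
  rw [hw.per .s y x, add_right_comm]
  exact h.perF hd hw 0 _

lemma Step.contJ (h : Step L d w w') (hd : d.Ok a η) (hw : St a η w) (hη : η ≤ 1) :
    Continuous (Function.uncurry (stepJ w w')) :=
  (h.dqF hd hw hη 0).continuous.comp (continuous_snd.add hw.cs)

lemma Step.dqR (h : Step L d w w') (ha : a ∈ Ioo (0 : ℝ) 1) (hd : d.Ok a η) (hw : St a η w)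
    (hη : η ≤ 1) : DQ a (300 * η) (stepR L d w w') := by
  have h0 := hd.nonneg
  have hJ := (h.holJ ha hd hw hη L).mono (T := 54 * η) (by linarith)
  have hJ' := h.dqJ ha hd hw hη L
  refine (((hd.GdD.sub (hJ'.add (DQ.mul (hw.hol .v L) (hw.dq .v L) hJ hJ'))).sub
    (DQ.mul (hw.hol .u L) (hw.dq .u L) (hw.hol .ux L) (hw.dq .ux L))).sub
    (DQ.mul (hw.hol .v L) (hw.dq .v L) (hw.hol .vx L) (hw.dq .vx L))).mono ?_
  nlinarith

lemma Step.perR (h : Step L d w w') (hd : d.Ok a η) (hw : St a η w) :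
    Function.Periodic (stepR L d w w') 1 := fun x => by
  unfold stepR
  rw [h.perJ hd hw L x, hd.pGd x, hw.per .v L x, hw.per .u L x, hw.per .ux L x, hw.per .vx L x]

lemma Step.contR (h : Step L d w w') (ha : a ∈ Ioo (0 : ℝ) 1) (hd : d.Ok a η) (hw : St a η w)
    (hη : η ≤ 1) : Continuous (stepR L d w w') := (h.dqR ha hd hw hη).continuous

lemma avg_sub_avg {f : ℝ → ℝ} (hf : Continuous f) : avg (fun x => f x - avg f) = 0 := by
  rw [avg_sub hf continuous_const]; simp [avg]

lemma hol_integral {M : ℝ} (hL : 0 < L) {f : ℝ → ℝ → ℝ} (hf : Continuous (Function.uncurry f))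
    (hM : ∀ y, Hol a M (f y)) (y : ℝ) :
    Hol a (L * M) (fun x => ∫ r in (0 : ℝ)..cl L y, f r x) := by
  have hy := cl_mem hL y
  have cf : ∀ x, Continuous (fun r => f r x) := fun x =>
    hf.comp (continuous_id.prodMk continuous_const)
  have hM0 := (hM 0).nonneg
  refine ⟨fun x => ?_, fun x x' => ?_⟩
  · refine (intervalIntegral.norm_integral_le_of_norm_le_const (C := M)
      fun r _ => (hM r).1 x).trans ?_
    rw [sub_zero, abs_of_nonneg hy.1, mul_comm]
    gcongr; exact hy.2
  · rw [← intervalIntegral.integral_sub ((cf x).intervalIntegrable _ _)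
      ((cf x').intervalIntegrable _ _)]
    refine (intervalIntegral.norm_integral_le_of_norm_le_const (C := M * |x - x'| ^ a)
      fun r _ => (hM r).2 x x').trans ?_
    rw [sub_zero, abs_of_nonneg hy.1]
    calc _ ≤ M * |x - x'| ^ a * L := by gcongr; exact hy.2
      _ = _ := by ring

/-- The constant of the iteration. -/
def sc (L a : ℝ) : ℝ := 300 * lc L a * (1 + L)

lemma Hol.of_eq {E : Type*} [NormedAddCommGroup E] {S : ℝ} {f g : ℝ → E} (h : Hol a S f)
    (e : ∀ x, f x = g x) : Hol a S g := funext e ▸ h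

theorem Step.lipschitz {D Δ N : ℝ} (hL : 0 < L) (ha : a ∈ Ioo (0 : ℝ) 1) (hη : η ≤ 1)
    {d₁ d₂ : Dat} {w₁ w₁' w₂ w₂' : Cmp → ℝ → ℝ → ℝ} (hd₁ : d₁.Ok a η) (hd₂ : d₂.Ok a η)
    (hw₁ : St a η w₁) (hw₂ : St a η w₂) (h₁ : Step L d₁ w₁ w₁') (h₂ : Step L d₂ w₂ w₂')
    (hD : ∀ i y, Hol a D (fun x => w₁ i y x - w₂ i y x))
    (hgd : Hol a Δ (fun x => d₁.gd x - d₂.gd x)) (hGd : Hol a Δ (fun x => d₁.Gd x - d₂.Gd x))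
    (hβ : Hol a Δ (fun x => d₁.β x - d₂.β x)) (hβd : Hol a Δ (fun x => d₁.βd x - d₂.βd x))
    (hΦ : |d₁.Φ - d₂.Φ| ≤ N) (i : Cmp) (y : ℝ) :
    Hol a (sc L a * (Δ + η * D + N)) (fun x => w₁' i y x - w₂' i y x) := by
  have h0 := hd₁.nonneg
  have hD0 := (hD .u 0).nonneg
  have hΔ0 := hβ.nonneg
  have hN0 := (abs_nonneg _).trans hΦ
  have hηD : 0 ≤ η * D := by positivity
  have hF : ∀ y, Hol a (3 * Δ + 6 * (η * D)) (fun x => w₁' .f y x - w₂' .f y x) := fun y => by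
    have e1 := (hgd.sub (((hw₁.hol .u 0).mul (hD .ux 0)).add ((hD .u 0).mul (hw₂.hol .ux 0)))).sub
      ((hβ.mul (hw₁.hol .f 0)).add (hd₂.βH.mul (hD .f 0)))
    refine (e1.mono (T := 3 * Δ + 6 * (η * D)) ?_).of_eq fun x => ?_
    · nlinarith
    · rw [h₁.f, h₂.f]; ring
  have hJ : ∀ y, Hol a (6 * Δ + 39 * (η * D)) (fun x => stepJ w₁ w₁' y x - stepJ w₂ w₂' y x) :=
    fun y => by
    have e1 := (h₁.dqF hd₁ hw₁ hη 0).comp_sub ha (hw₂.lip hη .s y) (hD .s y)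
    have e2 := (hF 0).comp ha (hw₂.lip hη .s y)
    refine ((e1.add e2).mono (T := 6 * Δ + 39 * (η * D)) ?_).of_eq fun x => ?_
    · nlinarith
    · unfold stepJ; ring
  have hR : Hol a (19 * Δ + 145 * (η * D)) (fun x => stepR L d₁ w₁ w₁' x - stepR L d₂ w₂ w₂' x) := by
    have e1 := (((hGd).sub ((hJ L).add (((hw₁.hol .v L).mul (hJ L)).add ((hD .v L).mul
      (h₂.holJ ha hd₂ hw₂ hη L))))).sub
      (((hw₁.hol .u L).mul (hD .ux L)).add ((hD .u L).mul (hw₂.hol .ux L)))).sub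
      (((hw₁.hol .v L).mul (hD .vx L)).add ((hD .v L).mul (hw₂.hol .vx L)))
    refine (e1.mono (T := 19 * Δ + 145 * (η * D)) ?_).of_eq fun x => ?_
    · nlinarith
    · unfold stepR; ring
  have hc₁ := h₁.contR ha hd₁ hw₁ hη
  have hc₂ := h₂.contR ha hd₂ hw₂ hη
  set S : ℝ := 38 * Δ + 290 * (η * D) + N with hS
  have hτ : Hol a S (fun x => (stepR L d₁ w₁ w₁' x - avg (stepR L d₁ w₁ w₁'))
      - (stepR L d₂ w₂ w₂' x - avg (stepR L d₂ w₂ w₂'))) := by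
    refine (hR.sub_avg.mono (T := S) ?_).of_eq fun x => ?_
    · rw [hS]; linarith
    · rw [avg_sub hc₁ hc₂]; ring
  have key := (h₁.lin.sub h₂.lin).bound (S := S) (T := 600 * η) hL ha
    (βd := fun x => d₁.βd x - d₂.βd x) (fun x => (hd₁.hβ x).sub (hd₂.hβ x))
    (fun x => by rw [hd₁.pβ x, hd₂.pβ x])
    (hβ.mono (by rw [hS]; linarith)) (hβd.mono (by rw [hS]; linarith))
    ((hd₁.βdD.sub hd₂.βdD).mono (by linarith)) hτ
    (((h₁.dqR ha hd₁ hw₁ hη).sub_avg.sub (h₂.dqR ha hd₂ hw₂ hη).sub_avg).mono (by linarith))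
    (fun x => by rw [h₁.perR hd₁ hw₁ x, h₂.perR hd₂ hw₂ x])
    (by rw [avg_sub (f := fun x => stepR L d₁ w₁ w₁' x - avg (stepR L d₁ w₁ w₁'))
          (g := fun x => stepR L d₂ w₂ w₂' x - avg (stepR L d₂ w₂ w₂'))
          (hc₁.sub continuous_const) (hc₂.sub continuous_const), avg_sub_avg hc₁,
          avg_sub_avg hc₂, sub_zero])
    ((h₁.contJ hd₁ hw₁ hη).sub (h₂.contJ hd₂ hw₂ hη))
    (fun y x => by rw [h₁.perJ hd₁ hw₁ y x, h₂.perJ hd₂ hw₂ y x])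
    (fun y => (hJ y).mono (by rw [hS]; linarith))
    (fun y => ((h₁.dqJ ha hd₁ hw₁ hη y).sub (h₂.dqJ ha hd₂ hw₂ hη y)).mono (by linarith))
    (hΦ.trans (by rw [hS]; linarith))
  have hlc := lc_ge hL ha
  have hS0 : 0 ≤ S := hτ.nonneg
  have hSle : S ≤ 290 * (Δ + η * D + N) := by rw [hS]; linarith
  have hX : 0 ≤ Δ + η * D + N := by positivity
  have m1 : lc L a * S ≤ sc L a * (Δ + η * D + N) := by
    have : lc L a * S ≤ lc L a * (290 * (Δ + η * D + N)) := by gcongr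
    have h2 : 0 ≤ lc L a * (Δ + η * D + N) := by positivity
    unfold sc
    nlinarith [mul_nonneg hL.le h2]
  cases i with
  | u => exact (key y).1.mono m1
  | v => exact (key y).2.1.mono m1
  | ux => exact (key y).2.2.1.mono m1
  | vx => exact (key y).2.2.2.mono m1
  | f =>
    refine (hF y).mono ?_
    have h2 : 0 ≤ lc L a * (Δ + η * D + N) := by positivity
    have h3 : 5 * (Δ + η * D + N) ≤ lc L a * (Δ + η * D + N) := by gcongr
    unfold sc
    nlinarith [mul_nonneg hL.le h2]
  | s =>
    have cu₁ := h₁.lin.cu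
    have cu₂ := h₂.lin.cu
    have e1 := hol_integral hL (f := fun y x => w₁' .u y x - w₂' .u y x) (cu₁.sub cu₂)
      (fun y => (key y).1) y
    have hAd : DQ a Δ (fun x => d₁.A x - d₂.A x) :=
      DQ.of_hasDerivAt (fun x => (hd₁.hA x).sub (hd₂.hA x)) hβ
    have e2 := hd₁.AD.comp_sub ha (hw₂.lip hη .s y) (hD .s y)
    have e3 := hAd.comp_sub ha (σ := w₂ .s y) (ς := fun _ => 0) (D := η) (by simp)
      (by simpa using hw₂.hol .s y)
    refine (((e1.neg.sub e2).sub e3).mono (T := sc L a * (Δ + η * D + N)) ?_).of_eq fun x => ?_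
    · have h2 : 0 ≤ lc L a * (Δ + η * D + N) := by positivity
      have h3 : 5 * (Δ + η * D + N) ≤ lc L a * (Δ + η * D + N) := by gcongr
      have h4 : lc L a * S ≤ lc L a * (290 * (Δ + η * D + N)) := by gcongr
      have h5 : L * (lc L a * S) ≤ L * (lc L a * (290 * (Δ + η * D + N))) := by gcongr
      have h6 : Δ * η ≤ Δ := by nlinarith
      unfold sc
      nlinarith [mul_nonneg hL.le h2]
    · rw [h₁.s, h₂.s]
      have c1 : Continuous (fun r => w₁' .u r x) := cu₁.comp (continuous_id.prodMk continuous_const)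
      have c2 : Continuous (fun r => w₂' .u r x) := cu₂.comp (continuous_id.prodMk continuous_const)
      rw [intervalIntegral.integral_sub (c1.intervalIntegrable _ _) (c2.intervalIntegrable _ _)]
      simp only [add_zero]
      ring

end Iteration

section FixedPoint

open Filter Topology MeasureTheory

variable {a η L : ℝ} {d : Dat} {w w' : Cmp → ℝ → ℝ → ℝ}

theorem exists_step (hL : 0 < L) (ha : a ∈ Ioo (0 : ℝ) 1) (hd : d.Ok a η) (hw : St a η w)
    (hη : η ≤ 1) : ∃ w', Step L d w w' := by
  have h0 := hd.nonneg
  set F : ℝ → ℝ := fun x => d.gd x - w .u 0 x * w .ux 0 x - d.β x * w .f 0 x with hF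
  set w₀ : Cmp → ℝ → ℝ → ℝ := fun _ _ => F with hw₀
  have hFH : Hol a (5 * η) F := by
    refine ((hd.gdH.sub ((hw.hol _ _).mul (hw.hol _ _))).sub (hd.βH.mul (hw.hol _ _))).mono ?_
    nlinarith
  have hFD : DQ a (9 * η) F := by
    refine ((hd.gdD.sub (DQ.mul (hw.hol .u 0) (hw.dq .u 0) (hw.hol .ux 0) (hw.dq .ux 0))).sub
      (DQ.mul hd.βH hd.βD (hw.hol .f 0) (hw.dq .f 0))).mono ?_
    nlinarith
  have hFp : Function.Periodic F 1 := fun x => by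
    simp only [hF]; rw [hd.pgd, hd.pβ, hw.per _ 0 x, hw.per _ 0 x, hw.per _ 0 x]
  set J : ℝ → ℝ → ℝ := stepJ w w₀ with hJ
  have hJH : ∀ y, Hol a (54 * η) (J y) := fun y =>
    (hFH.comp ha (hw.lip hη .s y)).mono (by linarith)
  have hJD : ∀ y, DQ a (54 * η) (J y) := fun y =>
    (hFD.comp ha ((hw.dq .s y).mono hη)).mono (by linarith)
  have hJp : ∀ y, Function.Periodic (J y) 1 := fun y x => by
    simp only [hJ, stepJ, hw₀]; rw [hw.per .s y x, add_right_comm]; exact hFp _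
  have hJc : Continuous (Function.uncurry J) := hFD.continuous.comp (continuous_snd.add hw.cs)
  set R : ℝ → ℝ := stepR L d w w₀ with hR
  have hRH : Hol a (300 * η) R := by
    have hj := hJH L
    refine (((hd.GdH.sub (hj.add ((hw.hol .v L).mul hj))).sub
      ((hw.hol .u L).mul (hw.hol .ux L))).sub ((hw.hol .v L).mul (hw.hol .vx L))).mono ?_
    nlinarith
  have hRD : DQ a (300 * η) R := by
    have hj := hJH L
    have hj' := hJD L
    refine (((hd.GdD.sub (hj'.add (DQ.mul (hw.hol .v L) (hw.dq .v L) hj hj'))).sub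
      (DQ.mul (hw.hol .u L) (hw.dq .u L) (hw.hol .ux L) (hw.dq .ux L))).sub
      (DQ.mul (hw.hol .v L) (hw.dq .v L) (hw.hol .vx L) (hw.dq .vx L))).mono ?_
    nlinarith
  have hRp : Function.Periodic R 1 := fun x => by
    simp only [hR, stepR]
    rw [← hJ, hJp L x, hd.pGd x, hw.per .v L x, hw.per .u L x, hw.per .ux L x, hw.per .vx L x]
  have hRc := hRD.continuous
  obtain ⟨u, v, ux, vx, hlin, -, -⟩ := exists_linSol (S := 600 * η) (T := 600 * η) (Φ := d.Φ) hL ha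
    (τ := fun x => R x - avg R) (j := J)
    hd.hβ hd.pβ (hd.βdH.mono (by linarith)) (hd.βdD.mono (by linarith))
    (hRH.sub_avg.mono (by linarith)) (hRD.sub_avg.mono (by linarith))
    (fun x => by beta_reduce; rw [hRp x]) (avg_sub_avg hRc) hJc hJp (fun y => (hJH y).mono (by linarith))
    (fun y => (hJD y).mono (by linarith))
  let w' : Cmp → ℝ → ℝ → ℝ := fun i => match i with
    | .u => u
    | .v => v
    | .ux => ux
    | .vx => vx
    | .f => fun _ => F
    | .s => fun y x => -(∫ r in (0 : ℝ)..cl L y, u r x) - (d.A (x + w .s y x) - d.A x)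
  exact ⟨w', ⟨fun _ _ => rfl, hlin, fun _ _ => rfl⟩⟩

/-- Trivial data. -/
def Dat.triv : Dat := ⟨fun _ => 0, fun _ => 0, fun _ => 0, fun _ => 0, fun _ => 0, 0⟩

lemma Dat.triv_ok (hη : 0 ≤ η) : Dat.triv.Ok a η where
  hβ x := hasDerivAt_const x 0
  hA x := hasDerivAt_const x 0
  pgd _ := rfl
  pGd _ := rfl
  pβ _ := rfl
  gdH := Hol.zero.mono hη
  gdD := (DQ.const 0).mono hη
  GdH := Hol.zero.mono hη
  GdD := (DQ.const 0).mono hη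
  βH := Hol.zero.mono hη
  βdH := Hol.zero.mono hη
  βdD := (DQ.const 0).mono hη

lemma St.triv (hη : 0 ≤ η) : St a η (fun _ _ _ => 0) where
  hol _ _ := Hol.zero.mono hη
  dq _ _ := (DQ.const 0).mono hη
  per _ _ _ := rfl
  cs := continuous_const

lemma Step.triv : Step L Dat.triv (fun _ _ _ => 0) (fun _ _ _ => 0) where
  f _ _ := by simp [Dat.triv]
  lin := by
    have e : stepR L Dat.triv (fun _ _ _ => 0) (fun _ _ _ => 0) = fun _ => 0 := by
      funext x; simp [stepR, stepJ, Dat.triv]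
    have e2 : stepJ (fun _ _ _ => 0) (fun _ _ _ => 0) = fun _ _ => 0 := by
      funext y x; simp [stepJ]
    rw [e, e2]
    have e3 : avg (fun _ => 0) = 0 := by simp [avg]
    simp only [e3, sub_zero]
    exact LinSol.zero
  s _ _ := by simp [Dat.triv]

lemma Dat.Ok.A_add_one (hd : d.Ok a η) (x z : ℝ) : d.A (x + 1) - d.A (z + 1) = d.A x - d.A z := by
  have h : ∀ x, HasDerivAt (fun x => d.A (x + 1) - d.A x) 0 x := fun x => by
    refine (((hd.hA (x + 1)).comp_add_const x 1).sub (hd.hA x)).congr_deriv ?_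
    rw [hd.pβ, sub_self]
  have := lip_of_hasDerivAt (S := 0) h (by simp) x z
  rw [zero_mul] at this
  have := sub_eq_zero.1 (norm_le_zero_iff.1 this)
  linarith

/-- Translation of the data in the periodic direction. -/
def Dat.shift (L : ℝ) (u : ℝ → ℝ → ℝ) (k : ℝ) (d : Dat) : Dat :=
  ⟨fun x => d.gd (x + k), fun x => d.Gd (x + k), fun x => d.β (x + k), fun x => d.βd (x + k),
    fun x => d.A (x + k), ∫ y in (0 : ℝ)..L, u y k⟩

lemma Dat.Ok.shift (hd : d.Ok a η) (u : ℝ → ℝ → ℝ) (k : ℝ) : (d.shift L u k).Ok a η where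
  hβ x := (hd.hβ (x + k)).comp_add_const x k
  hA x := (hd.hA (x + k)).comp_add_const x k
  pgd x := by simp only [Dat.shift]; rw [add_right_comm, hd.pgd]
  pGd x := by simp only [Dat.shift]; rw [add_right_comm, hd.pGd]
  pβ x := by simp only [Dat.shift]; rw [add_right_comm, hd.pβ]
  gdH := hd.gdH.shift k
  gdD := hd.gdD.shift k
  GdH := hd.GdH.shift k
  GdD := hd.GdD.shift k
  βH := hd.βH.shift k
  βdH := hd.βdH.shift k
  βdD := hd.βdD.shift k

lemma St.shift (hw : St a η w) (k : ℝ) : St a η (fun i y x => w i y (x + k)) where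
  hol i y := (hw.hol i y).shift k
  dq i y := (hw.dq i y).shift k
  per i y x := by beta_reduce; rw [add_right_comm, hw.per i y]
  cs := hw.cs.comp (continuous_fst.prodMk (continuous_snd.add continuous_const))

lemma avg_shift {f : ℝ → ℝ} (hf : Function.Periodic f 1) (k : ℝ) :
    avg (fun x => f (x + k)) = avg f := by
  unfold avg
  rw [intervalIntegral.integral_comp_add_right]
  have := hf.intervalIntegral_add_eq k 0
  rw [zero_add] at this
  rw [zero_add, add_comm 1 k, this]

lemma Step.shift (h : Step L d w w') (hd : d.Ok a η) (hw : St a η w) (k : ℝ) :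
    Step L (d.shift L (w' .u) k) (fun i y x => w i y (x + k)) (fun i y x => w' i y (x + k)) where
  f y x := h.f y (x + k)
  lin := by
    have e1 : stepJ (fun i y x => w i y (x + k)) (fun i y x => w' i y (x + k))
        = fun y x => stepJ w w' y (x + k) := by
      funext y x; simp only [stepJ]; congr 1; ring
    have e2 : stepR L (d.shift L (w' .u) k) (fun i y x => w i y (x + k))
        (fun i y x => w' i y (x + k)) = fun x => stepR L d w w' (x + k) := by
      funext x; simp only [stepR, e1, Dat.shift]
    rw [e1, e2, avg_shift (h.perR hd hw)]
    exact h.lin.shift k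
  s y x := by
    have := h.s y (x + k)
    simp only [Dat.shift]
    rw [this, add_right_comm]

/-- The constant controlling the gain of regularity in one step. -/
def rc (L a : ℝ) : ℝ := sc L a * (1 + L * sc L a)

lemma sc_ge (hL : 0 < L) (ha : a ∈ Ioo (0 : ℝ) 1) : 1 ≤ sc L a := by
  have := lc_ge hL ha
  unfold sc
  nlinarith

lemma rc_ge (hL : 0 < L) (ha : a ∈ Ioo (0 : ℝ) 1) : sc L a ≤ rc L a := by
  have := sc_ge hL ha
  unfold rc
  have : 0 ≤ sc L a * (L * sc L a) := by positivity
  linarith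

lemma Step.st {ηd : ℝ} (hL : 0 < L) (ha : a ∈ Ioo (0 : ℝ) 1) (hη : η ≤ 1) (hηd : ηd ≤ η)
    (hd : d.Ok a ηd) (hΦ : |d.Φ| ≤ ηd) (hw : St a η w) (h : Step L d w w') :
    St a (rc L a * (2 * ηd + η ^ 2)) w' := by
  have h0 := hd.nonneg
  have hη0 := h0.trans hηd
  have hd' := hd.mono hηd
  have hs := sc_ge hL ha
  have hr := rc_ge hL ha
  have hX : 0 ≤ 2 * ηd + η ^ 2 := by positivity
  have hol : ∀ i y, Hol a (sc L a * (2 * ηd + η ^ 2)) (w' i y) := fun i y => by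
    have := h.lipschitz (D := η) (Δ := ηd) (N := ηd) hL ha hη hd' (Dat.triv_ok hη0) hw (St.triv hη0)
      Step.triv (fun i y => by simpa using hw.hol i y) (by simpa [Dat.triv] using hd.gdH)
      (by simpa [Dat.triv] using hd.GdH) (by simpa [Dat.triv] using hd.βH)
      (by simpa [Dat.triv] using hd.βdH) (by simpa [Dat.triv] using hΦ) i y
    simp only [sub_zero] at this
    exact this.mono (le_of_eq (by ring))
  refine ⟨fun i y => (hol i y).mono (by gcongr), fun i y k => ?_, fun i y => ?_, ?_⟩
  · have hΦk : |(d.shift L (w' .u) k).Φ - d.Φ| ≤ L * (sc L a * (2 * ηd + η ^ 2)) * |k| := by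
      simp only [Dat.shift]
      rw [← h.lin.flux]
      have hk : ∀ r, ‖w' .u r k - w' .u r 0‖ ≤ sc L a * (2 * ηd + η ^ 2) * |k| := fun r => by
        have := lip_of_hasDerivAt (h.lin.du r) (hol .ux r).1 k 0
        simpa using this
      have c1 : Continuous (fun y => w' .u y k) :=
        h.lin.cu.comp (continuous_id.prodMk continuous_const)
      have c2 : Continuous (fun y => w' .u y 0) :=
        h.lin.cu.comp (continuous_id.prodMk continuous_const)
      rw [← intervalIntegral.integral_sub (c1.intervalIntegrable _ _) (c2.intervalIntegrable _ _)]
      refine (intervalIntegral.norm_integral_le_of_norm_le_const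
        (C := sc L a * (2 * ηd + η ^ 2) * |k|) (fun r _ => hk r)).trans ?_
      · rw [sub_zero, abs_of_pos hL]; apply le_of_eq; ring
    have := (h.shift hd' hw k).lipschitz (D := η * |k|) (Δ := ηd * |k|) hL ha hη (hd'.shift _ k) hd'
      (hw.shift k) hw h (fun i y => hw.dq i y k) (hd.gdD k) (hd.GdD k) (hd.βD k) (hd.βdD k) hΦk i y
    refine this.mono ?_
    have : sc L a * (ηd + η ^ 2) * |k| ≤ sc L a * (2 * ηd + η ^ 2) * |k| := by
      gcongr; linarith
    unfold rc
    calc _ = sc L a * (ηd + η ^ 2) * |k| + sc L a * (L * sc L a) * (2 * ηd + η ^ 2) * |k| := by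
          ring
      _ ≤ sc L a * (2 * ηd + η ^ 2) * |k| + sc L a * (L * sc L a) * (2 * ηd + η ^ 2) * |k| := by
          gcongr
      _ = _ := by ring
  · cases i with
    | u => exact h.lin.pu y
    | v => exact h.lin.pv y
    | ux =>
      intro x
      have h1 := (h.lin.du y (x + 1)).comp_add_const x 1
      rw [show (fun x => w' .u y (x + 1)) = w' .u y from funext (h.lin.pu y)] at h1
      exact h1.unique (h.lin.du y x)
    | vx =>
      intro x
      have h1 := (h.lin.dv y (x + 1)).comp_add_const x 1
      rw [show (fun x => w' .v y (x + 1)) = w' .v y from funext (h.lin.pv y)] at h1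
      exact h1.unique (h.lin.dv y x)
    | f => exact h.perF hd' hw y
    | s =>
      intro x
      rw [h.s, h.s, hw.per .s y x, add_right_comm, hd.A_add_one]
      simp only [fun r => h.lin.pu r x]
  · have hA : Continuous d.A := hd.AD.continuous
    have hI : Continuous (fun p : ℝ × ℝ => ∫ r in (0 : ℝ)..cl L p.1, w' .u r p.2) :=
      intervalIntegral.continuous_parametric_intervalIntegral_of_continuous
        (μ := volume) (f := fun (p : ℝ × ℝ) r => w' .u r p.2) (a₀ := 0) (s := fun p => cl L p.1)
        (h.lin.cu.comp (continuous_snd.prodMk (continuous_snd.comp continuous_fst)))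
        ((continuous_cl L).comp continuous_fst)
    have : Continuous (fun p : ℝ × ℝ => -(∫ r in (0 : ℝ)..cl L p.1, w' .u r p.2)
        - (d.A (p.2 + w .s p.1 p.2) - d.A p.2)) :=
      hI.neg.sub ((hA.comp (continuous_snd.add hw.cs)).sub (hA.comp continuous_snd))
    refine this.congr fun p => ?_
    rw [← h.s]
    rfl

lemma Step.contract {D : ℝ} (hL : 0 < L) (ha : a ∈ Ioo (0 : ℝ) 1) (hη : 2 * rc L a * η ≤ 1)
    {w₁ w₁' w₂ w₂' : Cmp → ℝ → ℝ → ℝ} (hd : d.Ok a η) (hw₁ : St a η w₁) (hw₂ : St a η w₂)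
    (h₁ : Step L d w₁ w₁') (h₂ : Step L d w₂ w₂')
    (hD : ∀ i y, Hol a D (fun x => w₁ i y x - w₂ i y x)) (i : Cmp) (y : ℝ) :
    Hol a (D / 2) (fun x => w₁' i y x - w₂' i y x) := by
  have h0 := hd.nonneg
  have hs := sc_ge hL ha
  have hr := rc_ge hL ha
  have hD0 := (hD .u 0).nonneg
  have hz : ∀ f : ℝ → ℝ, Hol a 0 (fun x => f x - f x) := fun f => by simpa using Hol.zero
  refine (h₁.lipschitz (N := 0) hL ha (by nlinarith) hd hd hw₁ hw₂ h₂ hD (hz _) (hz _) (hz _) (hz _)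
    (by simp) i y).mono ?_
  have : sc L a * η ≤ 1 / 2 := by nlinarith
  nlinarith

theorem fixedPoint_unique {w₁ w₂ : Cmp → ℝ → ℝ → ℝ} (hL : 0 < L) (ha : a ∈ Ioo (0 : ℝ) 1)
    (hη : 2 * rc L a * η ≤ 1) (hd : d.Ok a η) (hw₁ : St a η w₁) (hw₂ : St a η w₂)
    (h₁ : Step L d w₁ w₁) (h₂ : Step L d w₂ w₂) : w₁ = w₂ := by
  have key : ∀ n : ℕ, ∀ i y, Hol a ((η + η) * (1 / 2) ^ n) (fun x => w₁ i y x - w₂ i y x) := by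
    intro n
    induction n with
    | zero => intro i y; simpa using (hw₁.hol i y).sub (hw₂.hol i y)
    | succ n ih =>
      intro i y
      exact (h₁.contract hL ha hη hd hw₁ hw₂ h₂ ih i y).mono (le_of_eq (by ring))
  funext i y x
  refine sub_eq_zero.1 (norm_le_zero_iff.1 ?_)
  have ht : Tendsto (fun n : ℕ => (η + η) * (1 / 2 : ℝ) ^ n) atTop (𝓝 ((η + η) * 0)) :=
    (tendsto_pow_atTop_nhds_zero_of_lt_one (by norm_num) (by norm_num)).const_mul _
  rw [mul_zero] at ht
  exact ge_of_tendsto' ht fun n => (key n i y).1 x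

theorem exists_fixedPoint {ηd : ℝ} (hL : 0 < L) (ha : a ∈ Ioo (0 : ℝ) 1)
    (hη : 2 * rc L a * η ≤ 1) (hd : d.Ok a ηd) (hΦ : |d.Φ| ≤ ηd) (hηd : 4 * rc L a * ηd ≤ η) :
    ∃ w, St a η w ∧ Step L d w w := by
  have h0 := hd.nonneg
  have hs := sc_ge hL ha
  have hr := rc_ge hL ha
  have hle : ηd ≤ η := by nlinarith
  have hη0 := h0.trans hle
  have hη1 : η ≤ 1 := by nlinarith
  have hd' := hd.mono hle
  have hstep : ∀ w : {w // St a η w}, ∃ w' : {w // St a η w}, Step L d w.1 w'.1 := by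
    rintro ⟨w, hw⟩
    obtain ⟨w', hw'⟩ := exists_step hL ha hd' hw hη1
    refine ⟨⟨w', (hw'.st hL ha hη1 hle hd hΦ hw).mono ?_⟩, hw'⟩
    nlinarith
  choose T hT using hstep
  set s : ℕ → {w // St a η w} := fun n => T^[n] ⟨_, St.triv hη0⟩ with hsdef
  have hs1 : ∀ n, Step L d (s n).1 (s (n + 1)).1 := fun n => by
    simp only [hsdef, Function.iterate_succ_apply']; exact hT _
  have hdiff : ∀ n i y, Hol a ((η + η) * (1 / 2) ^ n)
      (fun x => (s (n + 1)).1 i y x - (s n).1 i y x) := by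
    intro n
    induction n with
    | zero => intro i y; simpa using ((s 1).2.hol i y).sub ((s 0).2.hol i y)
    | succ n ih =>
      intro i y
      exact ((hs1 (n + 1)).contract hL ha hη hd' (s (n + 1)).2 (s n).2 (hs1 n) ih i y).mono
        (le_of_eq (by ring))
  have hdiff2 : ∀ n m i y, Hol a ((4 * η) * ((1 / 2) ^ n - (1 / 2) ^ (n + m)))
      (fun x => (s (n + m)).1 i y x - (s n).1 i y x) := by
    intro n m i y
    induction m with
    | zero => simpa using Hol.zero
    | succ m ih =>
      refine (((hdiff (n + m) i y).add ih).mono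
        (T := (4 * η) * ((1 / 2) ^ n - (1 / 2) ^ (n + (m + 1)))) (le_of_eq ?_)).of_eq fun x => ?_
      · rw [← add_assoc, pow_succ (1 / 2 : ℝ) (n + m)]; ring
      · rw [add_assoc]; ring
  have hdiff3 : ∀ n m i y, Hol a ((4 * η) * (1 / 2) ^ n)
      (fun x => (s (n + m)).1 i y x - (s n).1 i y x) := fun n m i y =>
    (hdiff2 n m i y).mono (by
      have : (0 : ℝ) ≤ (1 / 2) ^ (n + m) := by positivity
      nlinarith)
  have hbz : Tendsto (fun n : ℕ => (4 * η) * (1 / 2 : ℝ) ^ n) atTop (𝓝 0) := by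
    simpa using (tendsto_pow_atTop_nhds_zero_of_lt_one (r := (1 / 2 : ℝ)) (by norm_num)
      (by norm_num)).const_mul (4 * η)
  have hlim : ∀ i y x, ∃ l, Tendsto (fun n => (s n).1 i y x) atTop (𝓝 l) := by
    intro i y x
    refine cauchySeq_tendsto_of_complete (cauchySeq_of_le_tendsto_0' _ (fun n m hnm => ?_) hbz)
    obtain ⟨m, rfl⟩ := Nat.exists_eq_add_of_le hnm
    rw [dist_comm, dist_eq_norm]
    exact (hdiff3 n m i y).1 x
  choose W hW using hlim
  have hWn : ∀ n i y, Hol a ((4 * η) * (1 / 2) ^ n) (fun x => W i y x - (s n).1 i y x) :=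
    fun n i y => Hol.limit (fun m => hdiff3 n m i y) fun x => by
      have := (tendsto_add_atTop_iff_nat n).2 (hW i y x)
      simp only [add_comm _ n] at this
      exact this.sub_const _
  have hWst : St a η W := by
    refine ⟨fun i y => Hol.limit (fun n => (s n).2.hol i y) (hW i y),
      fun i y => DQ.limit (fun n => (s n).2.dq i y) (hW i y), fun i y x => ?_, ?_⟩
    · refine tendsto_nhds_unique (hW i y (x + 1)) ((hW i y x).congr fun n => ?_)
      exact ((s n).2.per i y x).symm
    · have hu : TendstoUniformly (fun n => Function.uncurry ((s n).1 .s)) (Function.uncurry (W .s))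
          atTop := by
        rw [Metric.tendstoUniformly_iff]
        intro e he
        filter_upwards [hbz.eventually (gt_mem_nhds he)] with n hn p
        rw [dist_eq_norm]
        exact ((hWn n .s p.1).1 p.2).trans_lt hn
      exact hu.continuous (Frequently.of_forall fun n => (s n).2.cs)
  obtain ⟨W', hW'⟩ := exists_step hL ha hd' hWst hη1
  have : W' = W := by
    funext i y x
    refine tendsto_nhds_unique (f := fun n => (s (n + 1)).1 i y x) (l := atTop) ?_
      ((tendsto_add_atTop_iff_nat 1).2 (hW i y x))
    rw [tendsto_iff_norm_sub_tendsto_zero]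
    refine squeeze_zero (fun _ => norm_nonneg _) (fun n => ?_) hbz
    have := (hW'.contract hL ha hη hd' hWst (s n).2 (hs1 n) (hWn n) i y).1 x
    rw [norm_sub_rev]
    refine this.trans ?_
    have : (0 : ℝ) ≤ (4 * η) * (1 / 2) ^ n := by positivity
    linarith
  rw [this] at hW'
  exact ⟨W, hWst, hW'⟩

end FixedPoint

section DerivOfDQ
open Filter Topology MeasureTheory

variable {a S : ℝ}

/-- A difference quotient bound gives a Hölder continuous derivative. -/
lemma DQ.exists_deriv (ha : a ∈ Ioo (0 : ℝ) 1) {f : ℝ → ℝ} (h : DQ a S f) :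
    ∃ f', (∀ x, HasDerivAt f (f' x) x) ∧ Hol a S f' := by
  have hS : 0 ≤ S := h.nonneg
  have hc : Continuous f := h.continuous
  let e : ℕ → ℝ := fun n => (1 / 2 : ℝ) ^ n
  have he : ∀ n, 0 < e n := fun n => by positivity
  have he1 : ∀ n, e n = 2 * e (n + 1) := fun n => by simp only [e, pow_succ]; ring
  let D : ℕ → ℝ → ℝ := fun n x => (e n)⁻¹ * (f (x + e n) - f x)
  have hD : ∀ n, Hol a S (D n) := fun n => by
    have := (h (e n)).const_mul (c := (e n)⁻¹)
    refine this.mono (le_of_eq ?_)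
    rw [abs_of_pos (inv_pos.2 (he n)), abs_of_pos (he n)]
    field_simp [(he n).ne']
  have hr0 : (0 : ℝ) < (1 / 2 : ℝ) ^ a := by positivity
  have hr1 : (1 / 2 : ℝ) ^ a < 1 := Real.rpow_lt_one (by norm_num) (by norm_num) ha.1
  have hstep : ∀ x n, dist (D n x) (D (n + 1) x) ≤ S * ((1 / 2 : ℝ) ^ a) ^ n := fun x n => by
    have h1 : D n x - D (n + 1) x = (1 / 2) * (D (n + 1) (x + e (n + 1)) - D (n + 1) x) := by
      simp only [D]
      rw [he1 n, add_assoc, ← two_mul]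
      field_simp [(he (n + 1)).ne']
      ring
    have h2 := (hD (n + 1)).2 (x + e (n + 1)) x
    rw [Real.dist_eq, h1, abs_mul]
    rw [Real.norm_eq_abs, add_sub_cancel_left, abs_of_pos (he _)] at h2
    have h3 : e (n + 1) ^ a ≤ ((1 / 2 : ℝ) ^ a) ^ n := by
      rw [← Real.rpow_natCast, ← Real.rpow_mul (by norm_num), mul_comm a, Real.rpow_mul (by norm_num),
        Real.rpow_natCast]
      exact Real.rpow_le_rpow (he _).le (pow_le_pow_of_le_one (by norm_num) (by norm_num)
        (Nat.le_succ n)) ha.1.le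
    have h4 : S * e (n + 1) ^ a ≤ S * ((1 / 2 : ℝ) ^ a) ^ n := by gcongr
    have h5 : |(1 / 2 : ℝ)| = 1 / 2 := by norm_num
    rw [h5]
    have := abs_nonneg (D (n + 1) (x + e (n + 1)) - D (n + 1) x)
    linarith
  choose g hg using fun x => cauchySeq_tendsto_of_complete
    (cauchySeq_of_le_geometric _ S hr1 (hstep x))
  have hunif : TendstoUniformlyOn D g atTop univ := by
    rw [Metric.tendstoUniformlyOn_iff]
    intro δ hδ
    have : Tendsto (fun n : ℕ => S * ((1 / 2 : ℝ) ^ a) ^ n / (1 - (1 / 2 : ℝ) ^ a)) atTop (𝓝 0) := by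
      have := ((tendsto_pow_atTop_nhds_zero_of_lt_one hr0.le hr1).const_mul S).div_const
        (1 - (1 / 2 : ℝ) ^ a)
      simpa using this
    filter_upwards [this.eventually (gt_mem_nhds hδ)] with n hn x _
    rw [dist_comm]
    exact (dist_le_of_le_geometric_of_tendsto _ S hr1 (hstep x) (hg x) n).trans_lt hn
  let P : ℝ → ℝ := fun x => ∫ t in (0 : ℝ)..x, f t
  have hP : ∀ x, HasDerivAt P (f x) x := fun x =>
    intervalIntegral.integral_hasDerivAt_right (hc.intervalIntegrable _ _)
      hc.stronglyMeasurable.stronglyMeasurableAtFilter hc.continuousAt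
  have he0 : Tendsto e atTop (𝓝[≠] 0) := by
    rw [tendsto_nhdsWithin_iff]
    exact ⟨tendsto_pow_atTop_nhds_zero_of_lt_one (by norm_num) (by norm_num),
      Eventually.of_forall fun n => (he n).ne'⟩
  refine ⟨g, fun x => ?_, ?_, ?_⟩
  · refine hasDerivAt_of_tendstoUniformlyOn (l := atTop) (s := univ) isOpen_univ hunif
      (f := fun n x => (e n)⁻¹ * (P (x + e n) - P x)) ?_ ?_ (mem_univ x)
    · exact Eventually.of_forall fun n x _ =>
        (((hP (x + e n)).comp_add_const x (e n)).sub (hP x)).const_mul _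
    · intro x _
      have := (hasDerivAt_iff_tendsto_slope_zero.1 (hP x)).comp he0
      simpa [Function.comp_def] using this
  · exact fun x => le_of_tendsto (hg x).norm (Eventually.of_forall fun n => (hD n).1 x)
  · exact fun x z => le_of_tendsto ((hg x).sub (hg z)).norm
      (Eventually.of_forall fun n => (hD n).2 x z)

/-- Hölder continuity of `f_xx` in the transversal variable. -/
lemma hol_transversal (ha : a ∈ Ioo (0 : ℝ) 1) {s : Set ℝ} (hs : Convex ℝ s)
    {f g fx fxx : ℝ → ℝ → ℝ} (hfx : ∀ y ∈ s, ∀ x, HasDerivAt (f y) (fx y x) x)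
    (hfxx : ∀ y ∈ s, ∀ x, HasDerivAt (fx y) (fxx y x) x)
    (hg : ∀ x, ∀ y ∈ s, HasDerivWithinAt (fun y => f y x) (g y x) s y)
    (hH : ∀ y ∈ s, Hol a S (fxx y)) (hD : ∀ y ∈ s, DQ a S (g y)) {y y' : ℝ} (hy : y ∈ s)
    (hy' : y' ∈ s) (x : ℝ) : |fxx y x - fxx y' x| ≤ 3 * S * |y - y'| ^ a := by
  rcases eq_or_ne y y' with rfl | hne
  · simp [Real.zero_rpow ha.1.ne']
  set h := |y - y'| with hh
  have h0 : 0 < h := abs_pos.2 (sub_ne_zero.2 hne)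
  have hS : 0 ≤ S := (hH y hy).nonneg
  have h1 : ∀ k, |(f y (x + h + k) - f y (x + h)) - (f y (x + k) - f y x)
      - ((f y' (x + h + k) - f y' (x + h)) - (f y' (x + k) - f y' x))| ≤ S * |k| * h ^ a * h := by
    intro k
    have := hs.norm_image_sub_le_of_norm_hasDerivWithin_le (C := S * |k| * h ^ a)
      (f := fun y => (f y (x + h + k) - f y (x + h)) - (f y (x + k) - f y x))
      (f' := fun y => (g y (x + h + k) - g y (x + h)) - (g y (x + k) - g y x))
      (fun y hy => ((hg _ y hy).sub (hg _ y hy)).sub ((hg _ y hy).sub (hg _ y hy)))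
      (fun y hy => by
        have := (hD y hy k).2 (x + h) x
        rwa [add_sub_cancel_left, abs_of_pos h0] at this) hy' hy
    rwa [Real.norm_eq_abs, Real.norm_eq_abs, ← hh] at this
  have h2 : |(fx y (x + h) - fx y x) - (fx y' (x + h) - fx y' x)| ≤ S * h ^ a * h := by
    have hd : HasDerivAt (fun t => (f y (x + h + t) - f y (x + t)) - (f y' (x + h + t) - f y' (x + t)))
        ((fx y (x + h) - fx y x) - (fx y' (x + h) - fx y' x)) 0 := by
      have e1 : ∀ y ∈ s, ∀ x, HasDerivAt (fun t => f y (x + t)) (fx y x) 0 := fun y hy x => by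
        have := (hfx y hy (x + 0)).comp_const_add x 0
        rwa [add_zero] at this
      exact ((e1 y hy _).sub (e1 y hy _)).sub ((e1 y' hy' _).sub (e1 y' hy' _))
    have := hd.le_of_lip' (C := S * h ^ a * h) (by positivity) (Eventually.of_forall fun t => by
      rw [Real.norm_eq_abs, Real.norm_eq_abs, sub_zero]
      refine le_trans (le_of_eq ?_) ((h1 t).trans (le_of_eq (by ring)))
      congr 1
      simp only [add_zero]
      ring)
    simpa using this
  have h3 : ∀ y ∈ s, |fx y (x + h) - fx y x - h * fxx y x| ≤ S * h ^ a * h := fun y hy => by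
    have hd : ∀ t, HasDerivAt (fun t => fx y (x + t) - t * fxx y x)
        (fxx y (x + t) - 1 * fxx y x) t := fun t =>
      ((hfxx y hy (x + t)).comp_const_add x t).sub ((hasDerivAt_id t).mul_const _)
    have := (convex_Icc (0 : ℝ) h).norm_image_sub_le_of_norm_hasDerivWithin_le (C := S * h ^ a)
      (fun t _ => (hd t).hasDerivWithinAt) (fun t ht => by
        have := (hH y hy).2 (x + t) x
        rw [one_mul]
        refine this.trans ?_
        rw [add_sub_cancel_left]
        gcongr
        · exact ha.1.le
        · rw [abs_of_nonneg ht.1]; exact ht.2) (left_mem_Icc.2 h0.le) (right_mem_Icc.2 h0.le)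
    simp only [add_zero, zero_mul, sub_zero, Real.norm_eq_abs, abs_of_pos h0] at this
    rwa [sub_right_comm] at this
  have h4 : h * |fxx y x - fxx y' x| ≤ h * (3 * S * h ^ a) := by
    have e : h * |fxx y x - fxx y' x| = |h * (fxx y x - fxx y' x)| := by
      rw [abs_mul, abs_of_pos h0]
    rw [e]
    have a1 := abs_le.1 (h3 y hy)
    have a2 := abs_le.1 (h3 y' hy')
    have a3 := abs_le.1 h2
    rw [abs_le]
    constructor <;> linarith [a1.1, a1.2, a2.1, a2.2, a3.1, a3.2]
  exact le_of_mul_le_mul_left h4 h0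

/-- Interchange of partial derivatives. -/
lemma hasDerivWithinAt_partial {s : Set ℝ} (hs : Convex ℝ s)
    {f g fx gx : ℝ → ℝ → ℝ} (hfx : ∀ y ∈ s, ∀ x, HasDerivAt (f y) (fx y x) x)
    (hgx : ∀ y ∈ s, ∀ x, HasDerivAt (g y) (gx y x) x)
    (hg : ∀ x, ∀ y ∈ s, HasDerivWithinAt (fun y => f y x) (g y x) s y)
    (hc : ContinuousOn (Function.uncurry gx) (s ×ˢ univ)) {y : ℝ} (hy : y ∈ s) (x : ℝ) :
    HasDerivWithinAt (fun y => fx y x) (gx y x) s y := by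
  rw [hasDerivWithinAt_iff_isLittleO, Asymptotics.isLittleO_iff]
  intro ε hε
  obtain ⟨δ, hδ, H⟩ := Metric.continuousOn_iff.1 hc (y, x) ⟨hy, mem_univ _⟩ ε hε
  have hs' : Convex ℝ (s ∩ Metric.ball y δ) := hs.inter (convex_ball y δ)
  rw [eventually_nhdsWithin_iff]
  filter_upwards [Metric.ball_mem_nhds y hδ] with y' hy'δ hy'
  have h1 : ∀ k, |k| < δ → |(f y' (x + k) - f y' x) - (f y (x + k) - f y x) - k * (y' - y) * gx y x|
      ≤ ε * |k| * |y' - y| := by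
    intro k hk
    have h2 : ∀ r ∈ s ∩ Metric.ball y δ, |g r (x + k) - g r x - k * gx y x| ≤ ε * |k| := by
      intro r hr
      have := (convex_ball (0 : ℝ) δ).norm_image_sub_le_of_norm_hasDerivWithin_le (C := ε)
        (f := fun t => g r (x + t) - t * gx y x) (f' := fun t => gx r (x + t) - 1 * gx y x)
        (fun t _ => (((hgx r hr.1 (x + t)).comp_const_add x t).sub
          ((hasDerivAt_id t).mul_const _)).hasDerivWithinAt)
        (fun t ht => by
          rw [one_mul]
          have := H (r, x + t) ⟨hr.1, mem_univ _⟩ (by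
            rw [Prod.dist_eq]
            refine max_lt hr.2 ?_
            simpa [Real.dist_eq] using ht)
          exact this.le) (Metric.mem_ball_self hδ) (y := k) (by simpa using hk)
      simp only [add_zero, zero_mul, sub_zero, Real.norm_eq_abs] at this
      rwa [sub_right_comm] at this
    have := hs'.norm_image_sub_le_of_norm_hasDerivWithin_le (C := ε * |k|)
      (f := fun r => (f r (x + k) - f r x) - r * (k * gx y x))
      (f' := fun r => (g r (x + k) - g r x) - 1 * (k * gx y x))
      (fun r hr => (((hg _ r hr.1).sub (hg _ r hr.1)).sub
        (((hasDerivAt_id r).mul_const _).hasDerivWithinAt)).mono inter_subset_left)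
      (fun r hr => by rw [one_mul]; exact h2 r hr) ⟨hy, Metric.mem_ball_self hδ⟩ ⟨hy', hy'δ⟩
    rw [Real.norm_eq_abs, Real.norm_eq_abs] at this
    refine le_trans (le_of_eq ?_) this
    congr 1
    ring
  have hd : HasDerivAt (fun t => (f y' (x + t)) - (f y (x + t)) - t * (y' - y) * gx y x)
      (fx y' x - fx y x - (y' - y) * gx y x) 0 := by
    have e1 : ∀ y ∈ s, HasDerivAt (fun t => f y (x + t)) (fx y x) 0 := fun y hy => by
      have := (hfx y hy (x + 0)).comp_const_add x 0
      rwa [add_zero] at this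
    have e2 : HasDerivAt (fun t : ℝ => t * (y' - y) * gx y x) ((y' - y) * gx y x) 0 := by
      have := ((hasDerivAt_id (0 : ℝ)).mul_const (y' - y)).mul_const (gx y x)
      simpa using this
    exact ((e1 y' hy').sub (e1 y hy)).sub e2
  have := hd.le_of_lip' (C := ε * |y' - y|) (by positivity) (by
    filter_upwards [Metric.ball_mem_nhds (0 : ℝ) hδ] with t ht
    rw [Real.norm_eq_abs, Real.norm_eq_abs, sub_zero]
    refine le_trans (le_of_eq ?_) ((h1 t (by simpa using ht)).trans (le_of_eq (by ring)))
    congr 1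
    simp only [add_zero]
    ring)
  simpa [Real.norm_eq_abs, smul_eq_mul] using this

end DerivOfDQ

section StripCalculus
open Filter Topology MeasureTheory

variable {a L S T : ℝ} {f g : ℝ → ℝ → ℝ}

/-- `f`, with arguments in the order `y`, `x`, is bounded by `S` and jointly `a`-Hölder on the
strip. -/
def HS (L a S : ℝ) (f : ℝ → ℝ → ℝ) : Prop :=
  (∀ y ∈ Icc 0 L, ∀ x, |f y x| ≤ S) ∧ ∀ y ∈ Icc 0 L, ∀ y' ∈ Icc 0 L, ∀ x x',
    |f y x - f y' x'| ≤ S * (|x - x'| ^ a + |y - y'| ^ a)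

lemma HS.nonneg (hL : 0 < L) (hf : HS L a S f) : 0 ≤ S :=
  (abs_nonneg _).trans (hf.1 0 ⟨le_rfl, hL.le⟩ 0)

lemma HS.mono (hf : HS L a S f) (h : S ≤ T) : HS L a T f :=
  ⟨fun y hy x => (hf.1 y hy x).trans h, fun y hy y' hy' x x' => (hf.2 y hy y' hy' x x').trans
    (by gcongr)⟩

lemma HS.add (hf : HS L a S f) (hg : HS L a T g) : HS L a (S + T) (fun y x => f y x + g y x) := by
  refine ⟨fun y hy x => (abs_add_le _ _).trans (add_le_add (hf.1 y hy x) (hg.1 y hy x)),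
    fun y hy y' hy' x x' => ?_⟩
  rw [add_sub_add_comm, add_mul]
  exact (abs_add_le _ _).trans (add_le_add (hf.2 y hy y' hy' x x') (hg.2 y hy y' hy' x x'))

lemma HS.neg (hf : HS L a S f) : HS L a S (fun y x => -f y x) := by
  refine ⟨fun y hy x => by rw [abs_neg]; exact hf.1 y hy x, fun y hy y' hy' x x' => ?_⟩
  rw [← neg_sub', abs_neg]
  exact hf.2 y hy y' hy' x x'

lemma HS.sub (hf : HS L a S f) (hg : HS L a T g) : HS L a (S + T) (fun y x => f y x - g y x) := by
  simpa only [sub_eq_add_neg] using hf.add hg.neg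

lemma HS.mul (hL : 0 < L) (hf : HS L a S f) (hg : HS L a T g) :
    HS L a (2 * S * T) (fun y x => f y x * g y x) := by
  have hS := hf.nonneg hL
  have hT := hg.nonneg hL
  refine ⟨fun y hy x => ?_, fun y hy y' hy' x x' => ?_⟩
  · rw [abs_mul]
    have := mul_le_mul (hf.1 y hy x) (hg.1 y hy x) (abs_nonneg _) hS
    nlinarith [mul_nonneg hS hT]
  · have e : f y x * g y x - f y' x' * g y' x'
        = f y x * (g y x - g y' x') + (f y x - f y' x') * g y' x' := by ring
    rw [e]
    refine (abs_add_le _ _).trans ?_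
    rw [abs_mul, abs_mul]
    have h1 := mul_le_mul (hf.1 y hy x) (hg.2 y hy y' hy' x x') (abs_nonneg _) hS
    have h2 := mul_le_mul (hf.2 y hy y' hy' x x') (hg.1 y' hy' x') (abs_nonneg _)
      ((abs_nonneg _).trans (hf.2 y hy y' hy' x x'))
    nlinarith

lemma HS.const (c : ℝ) : HS L a |c| (fun _ _ => c) :=
  ⟨fun _ _ _ => le_rfl, fun _ _ _ _ _ _ => by rw [sub_self, abs_zero]; positivity⟩

lemma HS.of_separate (hx : ∀ y ∈ Icc 0 L, Hol a S (f y))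
    (hy : ∀ x, ∀ y ∈ Icc 0 L, ∀ y' ∈ Icc 0 L, |f y x - f y' x| ≤ S * |y - y'| ^ a) :
    HS L a S f := by
  refine ⟨fun y hy x => (hx y hy).1 x, fun y h y' h' x x' => ?_⟩
  calc |f y x - f y' x'| ≤ |f y x - f y x'| + |f y x' - f y' x'| := abs_sub_le _ _ _
    _ ≤ S * |x - x'| ^ a + S * |y - y'| ^ a := add_le_add ((hx y h).2 x x') (hy x' y h y' h')
    _ = _ := by ring

/-- A function bounded by `N` with Lipschitz constants `N` in both variables. -/
lemma HS.of_lip (ha : a ∈ Ioo (0 : ℝ) 1) {N : ℝ} (hN : ∀ y ∈ Icc 0 L, ∀ x, |f y x| ≤ N)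
    (hx : ∀ y ∈ Icc 0 L, ∀ x x', |f y x - f y x'| ≤ N * |x - x'|)
    (hy : ∀ x, ∀ y ∈ Icc 0 L, ∀ y' ∈ Icc 0 L, |f y x - f y' x| ≤ N * |y - y'|) :
    HS L a (3 * N) f := by
  have key : ∀ t d : ℝ, 0 ≤ d → t ≤ N * d → t ≤ 2 * N → 0 ≤ N → t ≤ 3 * N * d ^ a := by
    intro t d hd h1 h2 hN0
    rcases le_total d 1 with h | h
    · rcases hd.eq_or_lt with rfl | h0
      · rw [Real.zero_rpow ha.1.ne', mul_zero]; simpa using h1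
      · have : d ^ (1 : ℝ) ≤ d ^ a := Real.rpow_le_rpow_of_exponent_ge h0 h ha.2.le
        rw [Real.rpow_one] at this
        nlinarith
    · have : 1 ≤ d ^ a := Real.one_le_rpow h ha.1.le
      nlinarith
  have hN0 : ∀ y ∈ Icc 0 L, 0 ≤ N := fun y h => (abs_nonneg _).trans (hN y h 0)
  have h2 : ∀ y ∈ Icc 0 L, ∀ y' ∈ Icc 0 L, ∀ x x', |f y x - f y' x'| ≤ 2 * N :=
    fun y h y' h' x x' => (abs_sub _ _).trans (by linarith [hN y h x, hN y' h' x'])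
  refine HS.of_separate (fun y h => ⟨fun x => (hN y h x).trans (by linarith [hN0 y h]),
    fun x x' => key _ _ (abs_nonneg _) (hx y h x x') (h2 y h y h x x') (hN0 y h)⟩)
    fun x y h y' h' => key _ _ (abs_nonneg _) (hy x y h y' h') (h2 y h y' h' x x) (hN0 y h)

lemma HS.hol (hf : HS L a S f) (ha : 0 < a) {y : ℝ} (hy : y ∈ Icc 0 L) : Hol a S (f y) :=
  ⟨fun x => hf.1 y hy x, fun x x' => by
    have := hf.2 y hy y hy x x'
    rwa [sub_self, abs_zero, Real.zero_rpow ha.ne', add_zero] at this⟩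

lemma HS.continuousOn (hf : HS L a S f) (ha : 0 < a) :
    ContinuousOn (Function.uncurry f) (Icc 0 L ×ˢ univ) := by
  intro p hp
  rw [ContinuousWithinAt, tendsto_iff_dist_tendsto_zero]
  have h0 : Tendsto (fun q : ℝ × ℝ => S * (|q.2 - p.2| ^ a + |q.1 - p.1| ^ a))
      (𝓝[Icc 0 L ×ˢ univ] p) (𝓝 0) := by
    have : Continuous (fun q : ℝ × ℝ => S * (|q.2 - p.2| ^ a + |q.1 - p.1| ^ a)) := by
      have c : Continuous (fun t : ℝ => t ^ a) := Real.continuous_rpow_const ha.le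
      exact continuous_const.mul ((c.comp (continuous_snd.sub continuous_const).abs).add
        (c.comp (continuous_fst.sub continuous_const).abs))
    have := (this.tendsto p).mono_left (nhdsWithin_le_nhds (s := Icc 0 L ×ˢ univ))
    simpa [Real.zero_rpow ha.ne'] using this
  refine squeeze_zero' (Eventually.of_forall fun _ => dist_nonneg) ?_ h0
  filter_upwards [self_mem_nhdsWithin] with q hq
  exact hf.2 q.1 hq.1 p.1 hp.1 q.2 p.2

/-- `fx` and `fy` are the partial derivatives of `f` on the strip. -/
structure Partials (L : ℝ) (f fx fy : ℝ → ℝ → ℝ) : Prop where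
  dx : ∀ y ∈ Icc 0 L, ∀ x, HasDerivAt (f y) (fx y x) x
  dy : ∀ x, ∀ y ∈ Icc 0 L, HasDerivWithinAt (fun y => f y x) (fy y x) (Icc 0 L) y

variable {fx fy gx gy : ℝ → ℝ → ℝ}

lemma Partials.add (hf : Partials L f fx fy) (hg : Partials L g gx gy) :
    Partials L (fun y x => f y x + g y x) (fun y x => fx y x + gx y x)
      (fun y x => fy y x + gy y x) :=
  ⟨fun y hy x => (hf.dx y hy x).add (hg.dx y hy x), fun x y hy => (hf.dy x y hy).add (hg.dy x y hy)⟩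

lemma Partials.neg (hf : Partials L f fx fy) :
    Partials L (fun y x => -f y x) (fun y x => -fx y x) (fun y x => -fy y x) :=
  ⟨fun y hy x => (hf.dx y hy x).neg, fun x y hy => (hf.dy x y hy).neg⟩

lemma Partials.sub (hf : Partials L f fx fy) (hg : Partials L g gx gy) :
    Partials L (fun y x => f y x - g y x) (fun y x => fx y x - gx y x)
      (fun y x => fy y x - gy y x) :=
  ⟨fun y hy x => (hf.dx y hy x).sub (hg.dx y hy x), fun x y hy => (hf.dy x y hy).sub (hg.dy x y hy)⟩

lemma Partials.mul (hf : Partials L f fx fy) (hg : Partials L g gx gy) :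
    Partials L (fun y x => f y x * g y x) (fun y x => fx y x * g y x + f y x * gx y x)
      (fun y x => fy y x * g y x + f y x * gy y x) :=
  ⟨fun y hy x => (hf.dx y hy x).mul (hg.dx y hy x), fun x y hy => (hf.dy x y hy).mul (hg.dy x y hy)⟩

lemma Partials.comp {q q' : ℝ → ℝ} (hq : ∀ x, HasDerivAt q (q' x) x) (hf : Partials L f fx fy) :
    Partials L (fun y x => q (f y x)) (fun y x => q' (f y x) * fx y x)
      (fun y x => q' (f y x) * fy y x) :=
  ⟨fun y hy x => (hq (f y x)).comp x (hf.dx y hy x),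
    fun x y hy => (hq (f y x)).comp_hasDerivWithinAt y (hf.dy x y hy)⟩

lemma Partials.const_add (c : ℝ) (hf : Partials L f fx fy) :
    Partials L (fun y x => c + f y x) fx fy :=
  ⟨fun y hy x => (hf.dx y hy x).const_add c, fun x y hy => (hf.dy x y hy).const_add c⟩

lemma Partials.lip_y (hf : Partials L f fx fy) {N : ℝ} (hN : ∀ y ∈ Icc 0 L, ∀ x, |fy y x| ≤ N)
    (x : ℝ) {y y' : ℝ} (hy : y ∈ Icc 0 L) (hy' : y' ∈ Icc 0 L) :
    |f y x - f y' x| ≤ N * |y - y'| :=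
  (convex_Icc 0 L).norm_image_sub_le_of_norm_hasDerivWithin_le (f := fun y => f y x)
    (f' := fun y => fy y x) (fun y hy => hf.dy x y hy) (fun y hy => hN y hy x) hy' hy

/-- Second order regularity on the strip, in terms of partial derivatives. -/
structure Reg2 (L a S : ℝ) (f fx fy fxx fxy fyx fyy : ℝ → ℝ → ℝ) : Prop where
  p : Partials L f fx fy
  px : Partials L fx fxx fxy
  py : Partials L fy fyx fyy
  b : ∀ y ∈ Icc 0 L, ∀ x, |f y x| ≤ S
  bx : ∀ y ∈ Icc 0 L, ∀ x, |fx y x| ≤ S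
  by' : ∀ y ∈ Icc 0 L, ∀ x, |fy y x| ≤ S
  hxx : HS L a S fxx
  hxy : HS L a S fxy
  hyx : HS L a S fyx
  hyy : HS L a S fyy

/-- Global inverse of the perturbation `x + A x` of the identity. -/
lemma exists_inverse {A β : ℝ → ℝ} (hA : ∀ x, HasDerivAt A (β x) x) (hβ : ∀ x, |β x| ≤ 1 / 2) :
    ∃ E : ℝ → ℝ, (∀ s, E s + A (E s) = s) ∧ (∀ x, E (x + A x) = x) ∧
      ∀ s, HasDerivAt E (1 + β (E s))⁻¹ s := by
  have hlip : ∀ x x', |A x - A x'| ≤ 1 / 2 * |x - x'| := fun x x' => by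
    have := lip_of_hasDerivAt hA hβ x x'
    exact this
  have hAc : Continuous A := continuous_iff_continuousAt.2 fun x => (hA x).continuousAt
  have hinj : ∀ x x', |x - x'| ≤ 2 * |x + A x - (x' + A x')| := fun x x' => by
    have h1 := hlip x x'
    have h2 : |x - x'| ≤ |x + A x - (x' + A x')| + |A x - A x'| := by
      have := abs_sub (x + A x - (x' + A x')) (A x - A x')
      rwa [show x + A x - (x' + A x') - (A x - A x') = x - x' by ring] at this
    linarith
  have hsurj : Function.Surjective (fun x => x + A x) := by
    have hc : Continuous (fun x => x + A x) := continuous_id.add hAc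
    refine hc.surjective ?_ ?_
    · refine tendsto_atTop_mono' atTop (f₁ := fun x => (1 / 2) * x + A 0) ?_
        (tendsto_atTop_add_const_right _ _ (tendsto_id.const_mul_atTop (by norm_num : (0 : ℝ) < 1 / 2)))
      filter_upwards [eventually_ge_atTop 0] with x hx
      have := abs_le.1 (hlip x 0)
      rw [sub_zero, abs_of_nonneg hx] at this
      linarith [this.1]
    · refine tendsto_atBot_mono' atBot (f₁ := fun x => (1 / 2) * x + A 0) ?_
        (tendsto_atBot_add_const_right _ _ (tendsto_id.const_mul_atBot (by norm_num : (0 : ℝ) < 1 / 2)))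
      filter_upwards [eventually_le_atBot 0] with x hx
      have := abs_le.1 (hlip x 0)
      rw [sub_zero, abs_of_nonpos hx] at this
      linarith [this.2]
  choose E hE using hsurj
  beta_reduce at hE
  have hEc : Continuous E := by
    refine (LipschitzWith.of_dist_le_mul (K := 2) fun s t => ?_).continuous
    have := hinj (E s) (E t)
    rw [hE, hE] at this
    exact this
  refine ⟨E, hE, fun x => ?_, fun s => ?_⟩
  · have := hinj (E (x + A x)) x
    rw [hE, sub_self, abs_zero, mul_zero] at this
    exact sub_eq_zero.1 (abs_nonpos_iff.1 this)
  · refine HasDerivAt.of_local_left_inverse (f := fun x => x + A x) hEc.continuousAt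
      ((hasDerivAt_id _).add (hA _)) ?_ (Eventually.of_forall hE)
    have := abs_le.1 (hβ (E s))
    linarith [this.1]

/-- Field line labels. -/
lemma LinSol.partials_label {Φ : ℝ} {β τ A E : ℝ → ℝ} {j u v ux vx : ℝ → ℝ → ℝ}
    (h : LinSol L β τ j Φ u v ux vx) (hβ : Continuous β)
    (hA : ∀ x, HasDerivAt A (β x) x)
    (hE : ∀ s, HasDerivAt E (1 + β (E s))⁻¹ s) {θ : ℝ → ℝ → ℝ}
    (hθ : ∀ y x, θ y x = E (x + A x - ∫ r in (0 : ℝ)..cl L y, u r x)) :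
    Partials L θ (fun y x => (1 + β (θ y x))⁻¹ * (1 + v y x))
      (fun y x => (1 + β (θ y x))⁻¹ * (-u y x)) := by
  have hp : Partials L (fun y x => x + A x - ∫ r in (0 : ℝ)..cl L y, u r x)
      (fun y x => 1 + v y x) (fun y x => -u y x) := by
    refine ⟨fun y hy x => ?_, fun x y hy => ?_⟩
    · rw [cl_of_mem hy]
      exact (((hasDerivAt_id x).add (hA x)).sub (h.hasDerivAt_flux hβ hy x)).congr_deriv (by ring)
    · have hc : Continuous (fun r => u r x) := h.cu.comp (continuous_id.prodMk continuous_const)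
      have h1 : HasDerivAt (fun y => x + A x - ∫ r in (0 : ℝ)..y, u r x) (-u y x) y :=
        (intervalIntegral.integral_hasDerivAt_right (hc.intervalIntegrable _ _)
          hc.stronglyMeasurable.stronglyMeasurableAtFilter hc.continuousAt).const_sub _
      refine h1.hasDerivWithinAt.congr (fun y hy => ?_) ?_
      · rw [cl_of_mem hy]
      · rw [cl_of_mem hy]
  have := hp.comp hE
  have e : θ = fun y x => E (x + A x - ∫ r in (0 : ℝ)..cl L y, u r x) := by
    funext y x; exact hθ y x
  rw [e]
  exact this

end StripCalculus

section FixedPointRegularity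
open Filter Topology MeasureTheory

variable {a L S η : ℝ} {d : Dat} {w : Cmp → ℝ → ℝ → ℝ}

lemma HS.of_comp (ha : a ∈ Ioo (0 : ℝ) 1) {q : ℝ → ℝ} (hq : Hol a S q) {θ : ℝ → ℝ → ℝ}
    (hθ : ∀ y ∈ Icc 0 L, ∀ y' ∈ Icc 0 L, ∀ x x', |θ y x - θ y' x'| ≤ 2 * |x - x'| + |y - y'|) :
    HS L a (2 * S) (fun y x => q (θ y x)) := by
  have hS := hq.nonneg
  refine ⟨fun y hy x => (hq.1 _).trans (by linarith), fun y hy y' hy' x x' => ?_⟩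
  refine (hq.2 _ _).trans ?_
  have h1 : |θ y x - θ y' x'| ^ a ≤ 2 * |x - x'| ^ a + |y - y'| ^ a := by
    refine (Real.rpow_le_rpow (abs_nonneg _) (hθ y hy y' hy' x x') ha.1.le).trans ?_
    refine (Real.rpow_add_le_add_rpow (by positivity) (by positivity) ha.1.le ha.2.le).trans ?_
    gcongr
    rw [Real.mul_rpow (by norm_num) (abs_nonneg _)]
    gcongr
    calc (2 : ℝ) ^ a ≤ 2 ^ (1 : ℝ) := Real.rpow_le_rpow_of_exponent_le (by norm_num) ha.2.le
      _ = 2 := Real.rpow_one 2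
  have h2 : 0 ≤ |y - y'| ^ a := by positivity
  nlinarith

lemma Hol.inv_one_add {β : ℝ → ℝ} (hβ : Hol a η β) (hη : η ≤ 1 / 4) :
    Hol a 2 (fun x => (1 + β x)⁻¹) := by
  have h0 : ∀ x, 3 / 4 ≤ 1 + β x := fun x => by
    have := abs_le.1 (hβ.1 x)
    linarith [this.1]
  have hm : ∀ x, |(1 + β x)⁻¹| ≤ 4 / 3 := fun x => by
    rw [abs_of_pos (inv_pos.2 (by linarith [h0 x])), inv_le_comm₀ (by linarith [h0 x]) (by norm_num)]
    linarith [h0 x]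
  refine ⟨fun x => (hm x).trans (by norm_num), fun x x' => ?_⟩
  have e : (1 + β x)⁻¹ - (1 + β x')⁻¹ = (β x' - β x) * ((1 + β x)⁻¹ * (1 + β x')⁻¹) := by
    have h1 := h0 x
    have h2 := h0 x'
    have h3 : 1 + β x ≠ 0 := by linarith
    have h4 : 1 + β x' ≠ 0 := by linarith
    field_simp
    ring
  have h5 := hβ.2 x' x
  rw [abs_sub_comm] at h5
  rw [e, Real.norm_eq_abs, abs_mul, abs_mul]
  have h6 := mul_le_mul (hm x) (hm x') (abs_nonneg _) (by norm_num)
  have h7 : 0 ≤ |x - x'| ^ a := by positivity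
  calc |β x' - β x| * (|(1 + β x)⁻¹| * |(1 + β x')⁻¹|)
      ≤ (η * |x - x'| ^ a) * (4 / 3 * (4 / 3)) :=
        mul_le_mul h5 h6 (by positivity) ((norm_nonneg _).trans h5)
    _ ≤ 2 * |x - x'| ^ a := by nlinarith

/-- The field line label of a fixed point. -/
lemma Step.exists_label (hd : d.Ok a η) (hη : η ≤ 1 / 4)
    (h : Step L d w w) : Partials L (fun y x => x + w .s y x)
      (fun y x => (1 + d.β (x + w .s y x))⁻¹ * (1 + w .v y x))
      (fun y x => (1 + d.β (x + w .s y x))⁻¹ * (-w .u y x)) := by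
  have hβ : ∀ x, |d.β x| ≤ 1 / 2 := fun x => (hd.βH.1 x).trans (by linarith)
  obtain ⟨E, hE1, hE2, hE3⟩ := exists_inverse hd.hA hβ
  refine h.lin.partials_label (E := E) (hd.βD.continuous) hd.hA hE3 fun y x => ?_
  rw [← hE2 (x + w .s y x)]
  congr 1
  have := h.s y x
  linarith

/-- Fixed points of the iteration yield regular solutions. -/
theorem Step.exists_solution (hL : 0 < L) (ha : a ∈ Ioo (0 : ℝ) 1) (hd : d.Ok a η)
    (hη : η ≤ 1 / 4) (hw : St a η w) (h : Step L d w w) {Pm PT : ℝ → ℝ}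
    (hPm : ∀ x, HasDerivAt Pm (d.gd x + (1 + d.β x) * d.βd x) x) (pPm : Function.Periodic Pm 1)
    (hPT : ∀ x, HasDerivAt PT (d.Gd x) x) (pPT : Function.Periodic PT 1) :
    ∃ p j : ℝ → ℝ → ℝ,
      (∃ f₁ f₂ f₃ f₄, Reg2 L a (300 * η) (w .u) (w .ux) (fun y x => w .vx y x - j y x) f₁ f₂ f₃ f₄) ∧
      (∃ f₁ f₂ f₃ f₄, Reg2 L a (300 * η) (w .v) (w .vx) (fun y x => -w .ux y x) f₁ f₂ f₃ f₄) ∧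
      (∃ T f₁ f₂ f₃ f₄, Reg2 L a T p (fun y x => j y x * (1 + w .v y x))
        (fun y x => -(j y x * w .u y x)) f₁ f₂ f₃ f₄) ∧
      (∀ y, Function.Periodic (p y) 1) ∧
      (∀ x, p 0 x = Pm x - w .u 0 x ^ 2 / 2 - (1 + d.β x) ^ 2 / 2) ∧
      ∀ x, j L x * (1 + w .v L x) + w .u L x * w .ux L x + (1 + w .v L x) * w .vx L x
        = d.Gd x := by
  have h0 := hd.nonneg
  have hη1 : η ≤ 1 := by linarith
  have hL' : L ∈ Icc 0 L := ⟨hL.le, le_rfl⟩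
  set θ : ℝ → ℝ → ℝ := fun y x => x + w .s y x with hθ
  have hθp := h.exists_label hd hη
  rw [← hθ] at hθp
  have hm := hd.βH.inv_one_add hη
  have hb : ∀ i y x, |w i y x| ≤ η := fun i y x => (hw.hol i y).1 x
  have hθx : ∀ y ∈ Icc 0 L, ∀ x, |(1 + d.β (θ y x))⁻¹ * (1 + w .v y x)| ≤ 2 := fun y hy x => by
    have h1 : |1 + w .v y x| ≤ 5 / 4 := by
      have := abs_le.1 (hb .v y x)
      rw [abs_le]; constructor <;> linarith [this.1, this.2]
    have h2 : |(1 + d.β (θ y x))⁻¹| ≤ 4 / 3 := by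
      have := abs_le.1 (hd.βH.1 (θ y x))
      rw [abs_of_pos (inv_pos.2 (by linarith [this.1])),
        inv_le_comm₀ (by linarith [this.1]) (by norm_num)]
      linarith [this.1]
    rw [abs_mul]
    nlinarith [abs_nonneg (1 + w .v y x), abs_nonneg (1 + d.β (θ y x))⁻¹]
  have hθy : ∀ y ∈ Icc 0 L, ∀ x, |(1 + d.β (θ y x))⁻¹ * (-w .u y x)| ≤ 1 := fun y hy x => by
    have h2 := hm.1 (θ y x)
    have h3 := hb .u y x
    rw [Real.norm_eq_abs] at h2
    rw [abs_mul, abs_neg]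
    nlinarith [abs_nonneg (w .u y x), abs_nonneg (1 + d.β (θ y x))⁻¹]
  have hθl : ∀ y ∈ Icc 0 L, ∀ y' ∈ Icc 0 L, ∀ x x', |θ y x - θ y' x'| ≤ 2 * |x - x'| + |y - y'| := by
    intro y hy y' hy' x x'
    have h1 := lip_of_hasDerivAt (hθp.dx y hy) (hθx y hy) x x'
    have h2 := hθp.lip_y hθy x' hy hy'
    rw [one_mul] at h2
    exact (abs_sub_le _ (θ y x') _).trans (add_le_add h1 h2)
  obtain ⟨F', hF', hF'H⟩ := (hw.dq .f 0).exists_deriv ha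
  choose uxx huxx huxxH using fun y => (hw.dq .ux y).exists_deriv ha
  choose vxx hvxx hvxxH using fun y => (hw.dq .vx y).exists_deriv ha
  let j : ℝ → ℝ → ℝ := fun y x => w .f 0 (θ y x)
  have hjs : stepJ w w = j := rfl
  have hjp : Partials L j (fun y x => F' (θ y x) * ((1 + d.β (θ y x))⁻¹ * (1 + w .v y x)))
    (fun y x => F' (θ y x) * ((1 + d.β (θ y x))⁻¹ * (-w .u y x))) := hθp.comp hF'
  set jx : ℝ → ℝ → ℝ := fun y x => F' (θ y x) * ((1 + d.β (θ y x))⁻¹ * (1 + w .v y x)) with hjx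
  set jy : ℝ → ℝ → ℝ := fun y x => F' (θ y x) * ((1 + d.β (θ y x))⁻¹ * (-w .u y x)) with hjy
  have hup : Partials L (w .u) (w .ux) (fun y x => w .vx y x - j y x) :=
    ⟨fun y _ x => h.lin.du y x, fun x y hy => h.lin.duy x y hy⟩
  have hvp : Partials L (w .v) (w .vx) (fun y x => -w .ux y x) :=
    ⟨fun y _ x => h.lin.dv y x, fun x y hy => h.lin.dvy x y hy⟩
  have hbj : ∀ y x, |j y x| ≤ η := fun y x => hb .f 0 _
  have hbuy : ∀ y ∈ Icc 0 L, ∀ x, |w .vx y x - j y x| ≤ 2 * η := fun y _ x =>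
    (abs_sub _ _).trans (by linarith [hb .vx y x, hbj y x])
  have hlipx : ∀ i y x x', |w i y x - w i y x'| ≤ 2 * η * |x - x'| := fun i y x x' =>
    ((hw.dq i y).lip x x').trans (by nlinarith [abs_nonneg (x - x')])
  have hSu : HS L a 2 (w .u) := (HS.of_lip (N := 2 * η) ha
    (fun y _ x => (hb .u y x).trans (by linarith)) (fun y _ => hlipx .u y)
    (fun x y hy y' hy' => hup.lip_y hbuy x hy hy')).mono (by linarith)
  have hSv : HS L a 2 (w .v) := (HS.of_lip (N := 2 * η) ha
    (fun y _ x => (hb .v y x).trans (by linarith)) (fun y _ => hlipx .v y)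
    (fun x y hy y' hy' => hvp.lip_y
      (fun y _ x => by rw [abs_neg]; linarith [hb .ux y x]) x hy hy')).mono (by linarith)
  have hSv1 : HS L a 3 (fun y x => 1 + w .v y x) :=
    ((HS.const 1).add hSv).mono (by norm_num)
  have hSj : HS L a (2 * η) j := HS.of_comp ha (hw.hol .f 0) hθl
  have hSF : HS L a (8 * η) (fun y x => F' (θ y x) * (1 + d.β (θ y x))⁻¹) :=
    (HS.of_comp ha (hF'H.mul hm) hθl).mono (by linarith)
  have hSjx : HS L a (48 * η) jx := by
    have := (hSF.mul hL hSv1).mono (T := 48 * η) (by linarith)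
    simpa only [hjx, mul_assoc] using this
  have hSjy : HS L a (48 * η) jy := by
    have := (hSF.mul hL hSu.neg).mono (T := 48 * η) (by linarith)
    simpa only [hjy, mul_assoc] using this
  have hgD : ∀ y, DQ a (55 * η) (fun x => w .vx y x - j y x) := fun y =>
    ((hw.dq .vx y).sub (h.dqJ ha hd hw hη1 y)).mono (by linarith)
  have hSuxx : HS L a (165 * η) uxx := HS.of_separate
    (fun y _ => (huxxH y).mono (by linarith)) fun x y hy y' hy' => by
      have := hol_transversal (S := 55 * η) ha (convex_Icc 0 L) hup.dx (fun y _ => huxx y) hup.dy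
        (fun y _ => (huxxH y).mono (by linarith)) (fun y _ => hgD y) hy hy' x
      refine this.trans (le_of_eq (by ring))
  have hSvxx : HS L a (165 * η) vxx := HS.of_separate
    (fun y _ => (hvxxH y).mono (by linarith)) fun x y hy y' hy' => by
      have := hol_transversal (S := 55 * η) ha (convex_Icc 0 L) hvp.dx (fun y _ => hvxx y) hvp.dy
        (fun y _ => (hvxxH y).mono (by linarith))
        (fun y _ => (hw.dq .ux y).neg.mono (by linarith)) hy hy' x
      refine this.trans (le_of_eq (by ring))
  have hSuxy := hSvxx.sub hSjx
  have hSvxy := hSuxx.neg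
  have hux : Partials L (w .ux) uxx (fun y x => vxx y x - jx y x) :=
    ⟨fun y _ => huxx y, fun x y hy => hasDerivWithinAt_partial (convex_Icc 0 L) hup.dx
      (fun y hy x => (hvxx y x).sub (hjp.dx y hy x)) hup.dy (hSuxy.continuousOn ha.1) hy x⟩
  have hvx : Partials L (w .vx) vxx (fun y x => -uxx y x) :=
    ⟨fun y _ => hvxx y, fun x y hy => hasDerivWithinAt_partial (convex_Icc 0 L) hvp.dx
      (fun y hy x => (huxx y x).neg) hvp.dy (hSvxy.continuousOn ha.1) hy x⟩
  have huy := hvx.sub hjp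
  have hvy := hux.neg
  let q : ℝ → ℝ := fun x => Pm x - w .u 0 x ^ 2 / 2 - (1 + d.β x) ^ 2 / 2
  have hq : ∀ x, HasDerivAt q (w .f 0 x * (1 + d.β x)) x := fun x => by
    refine (((hPm x).sub (((h.lin.du 0 x).pow 2).div_const 2)).sub
      ((((hd.hβ x).const_add 1).pow 2).div_const 2)).congr_deriv ?_
    have := h.f 0 x
    simp only [Nat.cast_ofNat, pow_one, Nat.add_one_sub_one]
    linear_combination -this
  let p : ℝ → ℝ → ℝ := fun y x => q (θ y x)
  have hp : Partials L p (fun y x => j y x * (1 + w .v y x)) (fun y x => -(j y x * w .u y x)) := by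
    have := hθp.comp hq
    have hne : ∀ t, 1 + d.β t ≠ 0 := fun t => by
      have := abs_le.1 (hd.βH.1 t)
      linarith [this.1]
    refine ⟨fun y hy x => (this.dx y hy x).congr_deriv ?_,
      fun x y hy => (this.dy x y hy).congr_deriv ?_⟩
    · have e := mul_inv_cancel₀ (hne (θ y x))
      linear_combination w .f 0 (θ y x) * (1 + w .v y x) * e
    · have e := mul_inv_cancel₀ (hne (θ y x))
      linear_combination -(w .f 0 (θ y x) * w .u y x) * e
  have hqp : Function.Periodic q 1 := fun x => by
    simp only [q]
    rw [pPm x, hw.per .u 0 x, hd.pβ x]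
  have hpp : ∀ y, Function.Periodic (p y) 1 := fun y x => by
    simp only [p, hθ]
    rw [hw.per .s y x, add_right_comm, hqp]
  have hpx := hjp.mul (hvp.const_add 1)
  have hpy := (hjp.mul hup).neg
  have hSux : HS L a (3 * (300 * η)) (w .ux) := HS.of_lip ha
    (fun y _ x => (hb .ux y x).trans (by linarith))
    (fun y _ x x' => (hlipx .ux y x x').trans (by nlinarith [abs_nonneg (x - x')]))
    (fun x y hy y' hy' => hux.lip_y (fun y hy x => (hSuxy.1 y hy x).trans (by linarith))
      x hy hy')
  have hSvx : HS L a (3 * (300 * η)) (w .vx) := HS.of_lip ha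
    (fun y _ x => (hb .vx y x).trans (by linarith))
    (fun y _ x x' => (hlipx .vx y x x').trans (by nlinarith [abs_nonneg (x - x')]))
    (fun x y hy y' hy' => hvx.lip_y (fun y hy x => (hSvxy.1 y hy x).trans (by linarith))
      x hy hy')
  have hpb : ∀ y ∈ Icc 0 L, ∀ x, |p y x| ≤ |q 0| + 2 := fun y hy x => by
    have h1 := abs_sub_le_of_per (K := 2) hqp (fun x x' => by
      refine (lip_of_hasDerivAt hq (S := 2) (fun x => ?_) x x')
      have h3 := abs_le.1 (hd.βH.1 x)
      have h2 : |1 + d.β x| ≤ 5 / 4 := by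
        rw [abs_le]; constructor <;> linarith [h3.1, h3.2]
      rw [Real.norm_eq_abs, abs_mul]
      have := hb .f 0 x
      nlinarith [abs_nonneg (w .f 0 x), abs_nonneg (1 + d.β x)]) (θ y x) 0
    have h2 : |q (θ y x)| ≤ |q (θ y x) - q 0| + |q 0| := by
      have := abs_add_le (q (θ y x) - q 0) (q 0)
      rwa [sub_add_cancel] at this
    have h3 : |q (θ y x) - q 0| ≤ 2 := h1
    linarith
  have htop : ∀ x, HasDerivAt (fun x => p L x + w .u L x ^ 2 / 2 + (1 + w .v L x) ^ 2 / 2)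
      (j L x * (1 + w .v L x) + w .u L x * w .ux L x + (1 + w .v L x) * w .vx L x) x := fun x => by
    refine (((hp.dx L hL' x).add (((h.lin.du L x).pow 2).div_const 2)).add
      ((((h.lin.dv L x).const_add 1).pow 2).div_const 2)).congr_deriv ?_
    simp only [Nat.cast_ofNat, pow_one, Nat.add_one_sub_one]
    ring
  have hRZ : ∀ x, stepR L d w w x = d.Gd x
      - (j L x * (1 + w .v L x) + w .u L x * w .ux L x + (1 + w .v L x) * w .vx L x)
      + w .vx L x := fun x => by
    unfold stepR
    rw [hjs]
    ring
  have hcR := h.contR ha hd hw hη1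
  have hcZ : Continuous (fun x => j L x * (1 + w .v L x) + w .u L x * w .ux L x
      + (1 + w .v L x) * w .vx L x) := by
    have c1 := (hw.dq .u L).continuous
    have c2 := (hw.dq .v L).continuous
    have c3 := (hw.dq .ux L).continuous
    have c4 := (hw.dq .vx L).continuous
    have c5 : Continuous (j L) := (h.dqJ ha hd hw hη1 L).continuous
    fun_prop
  have hcG := hd.GdD.continuous
  have hZ0 := avg_deriv (fun x => by rw [hpp L x, hw.per .u L x, hw.per .v L x]) htop hcZ
  have hG0 := avg_deriv pPT hPT hcG
  have hV0 := avg_deriv (hw.per .v L) (h.lin.dv L) (hw.dq .vx L).continuous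
  have hR0 : avg (stepR L d w w) = 0 := by
    have e : stepR L d w w = fun x => (fun x => stepR L d w w x - w .vx L x) x + w .vx L x := by
      funext x; ring
    have e2 : avg (fun x => stepR L d w w x - w .vx L x) = avg (stepR L d w w) - avg (w .vx L) :=
      avg_sub hcR (hw.dq .vx L).continuous
    have e3 : (fun x => stepR L d w w x - w .vx L x) = fun x => d.Gd x - (j L x * (1 + w .v L x)
        + w .u L x * w .ux L x + (1 + w .v L x) * w .vx L x) := by
      funext x; rw [hRZ x]; ring
    rw [e3, avg_sub hcG hcZ, hG0, hZ0, hV0] at e2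
    linarith
  refine ⟨p, j, ⟨uxx, _, _, _, ⟨hup, hux, huy, ?_, ?_, ?_, hSuxx.mono ?_, hSuxy.mono ?_,
    hSuxy.mono ?_, (hSvxy.sub hSjy).mono ?_⟩⟩, ⟨vxx, _, _, _, ⟨hvp, hvx, hvy, ?_, ?_, ?_,
    hSvxx.mono ?_, hSvxy.mono ?_, hSvxy.mono ?_, hSuxy.neg.mono ?_⟩⟩, ?_, hpp, ?_, ?_⟩
  any_goals linarith
  · exact fun y _ x => (hb .u y x).trans (by linarith)
  · exact fun y _ x => (hb .ux y x).trans (by linarith)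
  · exact fun y hy x => (hbuy y hy x).trans (by linarith)
  · exact fun y _ x => (hb .v y x).trans (by linarith)
  · exact fun y _ x => (hb .vx y x).trans (by linarith)
  · exact fun y _ x => by rw [abs_neg]; exact (hb .ux y x).trans (by linarith)
  · have s1 := (hSjx.mul hL hSv1).add (hSj.mul hL hSvx)
    have s2 := (hSjy.mul hL hSv1).add (hSj.mul hL hSux.neg)
    have s3 := ((hSjx.mul hL hSu).add (hSj.mul hL hSux)).neg
    have s4 := ((hSjy.mul hL hSu).add (hSj.mul hL (hSvx.sub hSj))).neg
    have b1 := hSj.mul hL hSv1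
    have b2 := (hSj.mul hL hSu).neg
    have hq0 := abs_nonneg (q 0)
    have hη2 : η * η ≤ 1 := by nlinarith
    have hη3 : 0 ≤ η * η := mul_nonneg h0 h0
    refine ⟨|q 0| + 100000, _, _, _, _, ⟨hp, hpx, hpy, ?_, ?_, ?_, s1.mono ?_, s2.mono ?_,
      s3.mono ?_, s4.mono ?_⟩⟩
    · exact fun y hy x => (hpb y hy x).trans (by linarith)
    · exact fun y hy x => (b1.1 y hy x).trans (by linarith)
    · exact fun y hy x => (b2.1 y hy x).trans (by linarith)
    all_goals nlinarith
  · intro x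
    have := h.s 0 x
    simp only [p]
    rw [cl_of_mem ⟨le_rfl, hL.le⟩, intervalIntegral.integral_same] at this
    have h1 := lip_of_hasDerivAt hd.hA hd.βH.1 (x + w .s 0 x) x
    rw [Real.norm_eq_abs, add_sub_cancel_left] at h1
    have h2 : |w .s 0 x| = |d.A (x + w .s 0 x) - d.A x| := by
      rw [← abs_neg (w .s 0 x)]
      congr 1
      linarith
    have h3 : w .s 0 x = 0 := abs_eq_zero.1 (by nlinarith [abs_nonneg (w .s 0 x)])
    have hz : θ 0 x = x := by rw [hθ]; simp [h3]
    rw [hz]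
  · intro x
    have := h.lin.top x
    rw [hR0, hRZ x] at this
    linarith

end FixedPointRegularity

section HolderNorms
open Filter Topology

variable {E F G : Type*} [NormedAddCommGroup E] [NormedSpace ℝ E] [NormedAddCommGroup F]
  [NormedSpace ℝ F] [NormedAddCommGroup G] [NormedSpace ℝ G] {k : ℕ} {a S : ℝ} {s : Set E}
  {f : E → F} {g : E → G}

/-- Each constituent of the `C^{k,α}` norm is at most `S`. -/
structure HBd (k : ℕ) (a : ℝ) (s : Set E) (f : E → F) (S : ℝ) : Prop where
  bd : ∀ i ≤ k, ∀ x ∈ s, ‖iteratedFDerivWithin ℝ i f s x‖ ≤ S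
  hol : ∀ x ∈ s, ∀ y ∈ s,
    ‖iteratedFDerivWithin ℝ k f s x - iteratedFDerivWithin ℝ k f s y‖ ≤ S * ‖x - y‖ ^ a

lemma HBd.of_hNorm (ha : 0 < a) (hS : 0 ≤ S) (h : hNorm k a s f ≤ ENNReal.ofReal S) :
    HBd k a s f S := by
  constructor
  · intro i hi x hx
    have h1 : (‖iteratedFDerivWithin ℝ i f s x‖₊ : ℝ≥0∞) ≤ ENNReal.ofReal S := by
      refine le_trans ?_ h
      refine le_trans ?_ (le_self_add)
      refine le_trans ?_ (Finset.single_le_sum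
        (f := fun i => ⨆ x ∈ s, (‖iteratedFDerivWithin ℝ i f s x‖₊ : ℝ≥0∞)) (fun _ _ => zero_le)
        (Finset.mem_range.2 (Nat.lt_succ_of_le hi)))
      exact le_iSup₂ (f := fun x (_ : x ∈ s) => (‖iteratedFDerivWithin ℝ i f s x‖₊ : ℝ≥0∞)) x hx
    rw [← enorm_eq_nnnorm, ← ofReal_norm, ENNReal.ofReal_le_ofReal_iff hS] at h1
    exact h1
  · intro x hx y hy
    rcases eq_or_ne x y with rfl | hne
    · simp [Real.zero_rpow ha.ne']
    have h1 : ENNReal.ofReal (‖iteratedFDerivWithin ℝ k f s x - iteratedFDerivWithin ℝ k f s y‖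
        / ‖x - y‖ ^ a) ≤ ENNReal.ofReal S := by
      refine le_trans ?_ h
      refine le_trans ?_ (le_add_self)
      refine le_trans ?_ (le_iSup₂ (f := fun x (_ : x ∈ s) => ⨆ y ∈ s, ENNReal.ofReal
        (‖iteratedFDerivWithin ℝ k f s x - iteratedFDerivWithin ℝ k f s y‖ / ‖x - y‖ ^ a)) x hx)
      exact le_iSup₂ (f := fun y (_ : y ∈ s) => ENNReal.ofReal
        (‖iteratedFDerivWithin ℝ k f s x - iteratedFDerivWithin ℝ k f s y‖ / ‖x - y‖ ^ a)) y hy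
    rw [ENNReal.ofReal_le_ofReal_iff hS] at h1
    exact (div_le_iff₀ (Real.rpow_pos_of_pos (norm_pos_iff.2 (sub_ne_zero.2 hne)) a)).1 h1

lemma MemC.exists_bd (ha : 0 < a) (h : MemC k a s f) : ∃ S, 0 ≤ S ∧ HBd k a s f S :=
  ⟨_, ENNReal.toReal_nonneg, HBd.of_hNorm ha ENNReal.toReal_nonneg
    (ENNReal.ofReal_toReal h.2.ne).ge⟩

lemma HBd.hNorm_le (hS : 0 ≤ S) (h : HBd k a s f S) :
    hNorm k a s f ≤ ENNReal.ofReal ((k + 2) * S) := by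
  have e : ((k : ℝ) + 2) * S = (k + 1 : ℕ) * S + S := by push_cast; ring
  rw [e, ENNReal.ofReal_add (by positivity) hS, ENNReal.ofReal_mul (by positivity),
    ENNReal.ofReal_natCast]
  refine add_le_add ?_ ?_
  · have : (Finset.range (k + 1)).sum
        (fun i => ⨆ x ∈ s, (‖iteratedFDerivWithin ℝ i f s x‖₊ : ℝ≥0∞))
        ≤ (Finset.range (k + 1)).card • ENNReal.ofReal S := by
      refine Finset.sum_le_card_nsmul _ _ _ fun i hi => iSup₂_le fun x hx => ?_
      rw [← enorm_eq_nnnorm, ← ofReal_norm]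
      exact ENNReal.ofReal_le_ofReal (h.bd i (Nat.le_of_lt_succ (Finset.mem_range.1 hi)) x hx)
    simpa using this
  · refine iSup₂_le fun x hx => iSup₂_le fun y hy => ENNReal.ofReal_le_ofReal ?_
    exact div_le_of_le_mul₀ (by positivity) hS (h.hol x hx y hy)

lemma HBd.mono {T : ℝ} (h : HBd k a s f S) (hST : S ≤ T) : HBd k a s f T :=
  ⟨fun i hi x hx => (h.bd i hi x hx).trans hST, fun x hx y hy =>
    (h.hol x hx y hy).trans (mul_le_mul_of_nonneg_right hST (by positivity))⟩

lemma HBd.prodMk (hs : UniqueDiffOn ℝ s) (hfc : ContDiffOn ℝ k f s) (hgc : ContDiffOn ℝ k g s)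
    (hf : HBd k a s f S) (hg : HBd k a s g S) : HBd k a s (fun z => (f z, g z)) S := by
  have e : ∀ i ≤ k, ∀ x ∈ s, iteratedFDerivWithin ℝ i (fun z => (f z, g z)) s x
      = (iteratedFDerivWithin ℝ i f s x).prod (iteratedFDerivWithin ℝ i g s x) :=
    fun i hi x hx => iteratedFDerivWithin_prodMk (hfc x hx) (hgc x hx) hs hx (by exact_mod_cast hi)
  refine ⟨fun i hi x hx => ?_, fun x hx y hy => ?_⟩
  · rw [e i hi x hx, ContinuousMultilinearMap.opNorm_prod]
    exact max_le (hf.bd i hi x hx) (hg.bd i hi x hx)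
  · rw [e k le_rfl x hx, e k le_rfl y hy]
    have : (iteratedFDerivWithin ℝ k f s x).prod (iteratedFDerivWithin ℝ k g s x)
        - (iteratedFDerivWithin ℝ k f s y).prod (iteratedFDerivWithin ℝ k g s y)
        = (iteratedFDerivWithin ℝ k f s x - iteratedFDerivWithin ℝ k f s y).prod
          (iteratedFDerivWithin ℝ k g s x - iteratedFDerivWithin ℝ k g s y) := rfl
    rw [this, ContinuousMultilinearMap.opNorm_prod]
    exact max_le (hf.hol x hx y hy) (hg.hol x hx y hy)

lemma HBd.clm_comp (hs : UniqueDiffOn ℝ s) (hfc : ContDiffOn ℝ k f s) (hf : HBd k a s f S)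
    (T : F →L[ℝ] G) (hT : ‖T‖ ≤ 1) : HBd k a s (fun z => T (f z)) S := by
  have e : ∀ i ≤ k, ∀ x ∈ s, iteratedFDerivWithin ℝ i (fun z => T (f z)) s x
      = T.compContinuousMultilinearMap (iteratedFDerivWithin ℝ i f s x) :=
    fun i hi x hx => T.iteratedFDerivWithin_comp_left (hfc x hx) hs hx (by exact_mod_cast hi)
  have n : ∀ i, ∀ m : ContinuousMultilinearMap ℝ (fun _ : Fin i => E) F,
      ‖T.compContinuousMultilinearMap m‖ ≤ ‖m‖ := fun i m =>
    (T.norm_compContinuousMultilinearMap_le m).trans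
      (mul_le_of_le_one_left (norm_nonneg _) hT)
  refine ⟨fun i hi x hx => ?_, fun x hx y hy => ?_⟩
  · rw [e i hi x hx]
    exact (n i _).trans (hf.bd i hi x hx)
  · rw [e k le_rfl x hx, e k le_rfl y hy]
    have : T.compContinuousMultilinearMap (iteratedFDerivWithin ℝ k f s x)
        - T.compContinuousMultilinearMap (iteratedFDerivWithin ℝ k f s y)
        = T.compContinuousMultilinearMap
          (iteratedFDerivWithin ℝ k f s x - iteratedFDerivWithin ℝ k f s y) := by
      ext m; simp
    rw [this]
    exact (n k _).trans (hf.hol x hx y hy)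

/-- The second derivative within `s`. -/
def hess (s : Set E) (f : E → F) : E → E →L[ℝ] E →L[ℝ] F :=
  fderivWithin ℝ (fderivWithin ℝ f s) s

lemma norm_iteratedFDerivWithin_two_sub (hs : UniqueDiffOn ℝ s) {x y : E} (hx : x ∈ s)
    (hy : y ∈ s) : ‖iteratedFDerivWithin ℝ 2 f s x - iteratedFDerivWithin ℝ 2 f s y‖
      = ‖hess s f x - hess s f y‖ := by
  have e : ∀ x ∈ s, iteratedFDerivWithin ℝ 2 f s x
      = (continuousMultilinearCurryRightEquiv' ℝ 1 E F).symm
        ((continuousMultilinearCurryRightEquiv' ℝ 0 E (E →L[ℝ] F)).symm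
          ((continuousMultilinearCurryFin0 ℝ E (E →L[ℝ] E →L[ℝ] F)).symm (hess s f x))) :=
    fun x hx => by
      rw [iteratedFDerivWithin_succ_eq_comp_right hs hx, Function.comp_apply,
        iteratedFDerivWithin_succ_eq_comp_right hs hx, Function.comp_apply]
      rfl
  rw [e x hx, e y hy, ← LinearIsometryEquiv.map_sub, LinearIsometryEquiv.norm_map,
    ← LinearIsometryEquiv.map_sub, LinearIsometryEquiv.norm_map,
    ← LinearIsometryEquiv.map_sub, LinearIsometryEquiv.norm_map]

lemma norm_iteratedFDerivWithin_two (hs : UniqueDiffOn ℝ s) {x : E} (hx : x ∈ s) :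
    ‖iteratedFDerivWithin ℝ 2 f s x‖ = ‖hess s f x‖ := by
  rw [← norm_iteratedFDerivWithin_fderivWithin hs hx,
    norm_iteratedFDerivWithin_one _ (hs x hx), hess]

lemma hBd_two_iff (hs : UniqueDiffOn ℝ s) : HBd 2 a s f S ↔
    (∀ x ∈ s, ‖f x‖ ≤ S) ∧ (∀ x ∈ s, ‖fderivWithin ℝ f s x‖ ≤ S) ∧ (∀ x ∈ s, ‖hess s f x‖ ≤ S) ∧
      ∀ x ∈ s, ∀ y ∈ s, ‖hess s f x - hess s f y‖ ≤ S * ‖x - y‖ ^ a := by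
  constructor
  · intro h
    refine ⟨fun x hx => ?_, fun x hx => ?_, fun x hx => ?_, fun x hx y hy => ?_⟩
    · simpa using h.bd 0 (by norm_num) x hx
    · rw [← norm_iteratedFDerivWithin_one _ (hs x hx)]; exact h.bd 1 (by norm_num) x hx
    · rw [← norm_iteratedFDerivWithin_two hs hx]; exact h.bd 2 le_rfl x hx
    · rw [← norm_iteratedFDerivWithin_two_sub hs hx hy]; exact h.hol x hx y hy
  · rintro ⟨h0, h1, h2, h3⟩
    refine ⟨fun i hi x hx => ?_, fun x hx y hy => ?_⟩
    · interval_cases i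
      · simpa using h0 x hx
      · rw [norm_iteratedFDerivWithin_one _ (hs x hx)]; exact h1 x hx
      · rw [norm_iteratedFDerivWithin_two hs hx]; exact h2 x hx
    · rw [norm_iteratedFDerivWithin_two_sub hs hx hy]; exact h3 x hx y hy

end HolderNorms

section StripRegularity
open Filter Topology

variable {L a S : ℝ}

lemma uniqueDiffOn_strip (hL : 0 < L) : UniqueDiffOn ℝ (strip L) :=
  uniqueDiffOn_univ.prod (uniqueDiffOn_Icc hL)

lemma mem_strip {x y : ℝ} (hy : y ∈ Icc 0 L) : (x, y) ∈ strip L := ⟨mem_univ _, hy⟩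

lemma partials_of_differentiableOn {f : ℝ × ℝ → ℝ} (h : DifferentiableOn ℝ f (strip L)) :
    Partials L (fun y x => f (x, y)) (fun y x => pdx L f (x, y)) (fun y x => pdy L f (x, y)) := by
  constructor
  · intro y hy x
    have h1 := (h (x, y) (mem_strip hy)).hasFDerivWithinAt
    have h2 : HasDerivWithinAt (fun t : ℝ => (t, y)) (1, 0) univ x :=
      ((hasDerivAt_id x).prodMk (hasDerivAt_const x y)).hasDerivWithinAt
    exact (h1.comp_hasDerivWithinAt x h2 (fun t _ => mem_strip hy)).hasDerivAt univ_mem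
  · intro x y hy
    have h1 := (h (x, y) (mem_strip hy)).hasFDerivWithinAt
    have h2 : HasDerivWithinAt (fun t : ℝ => (x, t)) (0, 1) (Icc 0 L) y :=
      ((hasDerivAt_const y x).prodMk (hasDerivAt_id y)).hasDerivWithinAt
    exact h1.comp_hasDerivWithinAt y h2 (fun t ht => mem_strip ht)

lemma fderivWithin_apply_const {s : Set (ℝ × ℝ)} (hs : UniqueDiffOn ℝ s) {f : ℝ × ℝ → ℝ}
    (hf : ContDiffOn ℝ 2 f s) (e : ℝ × ℝ) :
    DifferentiableOn ℝ (fun z => fderivWithin ℝ f s z e) s ∧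
      ∀ z ∈ s, ∀ e', fderivWithin ℝ (fun z => fderivWithin ℝ f s z e) s z e' = hess s f z e' e := by
  have h1 : ContDiffOn ℝ 1 (fderivWithin ℝ f s) s := hf.fderivWithin hs (by norm_num)
  have h2 := h1.differentiableOn (by norm_num)
  have h3 : ∀ z ∈ s, HasFDerivWithinAt (fun z => fderivWithin ℝ f s z e)
      ((hess s f z).flip e) s z := fun z hz => by
    have := (h2 z hz).hasFDerivWithinAt.clm_apply (hasFDerivWithinAt_const e z s)
    rw [ContinuousLinearMap.comp_zero, zero_add] at this
    exact this
  refine ⟨fun z hz => (h3 z hz).differentiableWithinAt, fun z hz e' => ?_⟩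
  rw [(h3 z hz).fderivWithin (hs z hz)]
  rfl

lemma norm_rpow_le (x y : ℝ) : ‖((x, y) : ℝ × ℝ)‖ ^ a ≤ |x| ^ a + |y| ^ a := by
  have h1 : 0 ≤ |x| ^ a := by positivity
  have h2 : 0 ≤ |y| ^ a := by positivity
  rw [Prod.norm_mk, Real.norm_eq_abs, Real.norm_eq_abs]
  rcases max_cases |x| |y| with ⟨h, -⟩ | ⟨h, -⟩ <;> rw [h] <;> linarith

lemma reg2_of_hBd (hL : 0 < L) {f : ℝ × ℝ → ℝ} (hf : ContDiffOn ℝ 2 f (strip L))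
    (h : HBd 2 a (strip L) f S) :
    Reg2 L a S (fun y x => f (x, y)) (fun y x => pdx L f (x, y)) (fun y x => pdy L f (x, y))
      (fun y x => pdx L (pdx L f) (x, y)) (fun y x => pdy L (pdx L f) (x, y))
      (fun y x => pdx L (pdy L f) (x, y)) (fun y x => pdy L (pdy L f) (x, y)) := by
  have hs := uniqueDiffOn_strip hL
  obtain ⟨h0, h1, h2, h3⟩ := (hBd_two_iff hs).1 h
  have e1 : ‖((1, 0) : ℝ × ℝ)‖ = 1 := by simp [Prod.norm_mk]
  have e2 : ‖((0, 1) : ℝ × ℝ)‖ = 1 := by simp [Prod.norm_mk]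
  have n1 : ∀ (T : ℝ × ℝ →L[ℝ] ℝ) (e : ℝ × ℝ), ‖e‖ = 1 → |T e| ≤ ‖T‖ := fun T e he => by
    simpa [he] using T.le_opNorm e
  have n2 : ∀ (T : ℝ × ℝ →L[ℝ] ℝ × ℝ →L[ℝ] ℝ) (e e' : ℝ × ℝ), ‖e‖ = 1 → ‖e'‖ = 1 →
      |T e e'| ≤ ‖T‖ := fun T e e' he he' => by
    simpa [he, he'] using T.le_opNorm₂ e e'
  have key : ∀ e e' : ℝ × ℝ, ‖e‖ = 1 → ‖e'‖ = 1 → HS L a S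
      (fun y x => fderivWithin ℝ (fun z => fderivWithin ℝ f (strip L) z e) (strip L) (x, y) e') := by
    intro e e' he he'
    obtain ⟨-, k⟩ := fderivWithin_apply_const hs hf e
    have hS : 0 ≤ S := (norm_nonneg _).trans (h0 (0, 0) (mem_strip ⟨le_rfl, hL.le⟩))
    refine ⟨fun y hy x => ?_, fun y hy y' hy' x x' => ?_⟩
    · beta_reduce
      rw [k _ (mem_strip hy)]
      exact (n2 _ _ _ he' he).trans (h2 _ (mem_strip hy))
    · beta_reduce
      rw [k _ (mem_strip hy), k _ (mem_strip hy')]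
      refine (n2 (hess (strip L) f (x, y) - hess (strip L) f (x', y')) _ _ he' he).trans ?_
      refine (h3 _ (mem_strip hy) _ (mem_strip hy')).trans ?_
      exact mul_le_mul_of_nonneg_left (norm_rpow_le _ _) hS
  exact ⟨partials_of_differentiableOn (hf.differentiableOn (by norm_num)),
    partials_of_differentiableOn (fderivWithin_apply_const hs hf (1, 0)).1,
    partials_of_differentiableOn (fderivWithin_apply_const hs hf (0, 1)).1,
    fun y hy x => h0 _ (mem_strip hy),
    fun y hy x => (n1 _ _ e1).trans (h1 _ (mem_strip hy)),
    fun y hy x => (n1 _ _ e2).trans (h1 _ (mem_strip hy)),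
    key _ _ e1 e1, key _ _ e1 e2, key _ _ e2 e1, key _ _ e2 e2⟩

/-- The linear form with coefficients `p`, `q`. -/
def lf (p q : ℝ) : ℝ × ℝ →L[ℝ] ℝ :=
  p • ContinuousLinearMap.fst ℝ ℝ ℝ + q • ContinuousLinearMap.snd ℝ ℝ ℝ

lemma lf_apply (p q : ℝ) (e : ℝ × ℝ) : lf p q e = p * e.1 + q * e.2 := by simp [lf]

lemma norm_lf_le (p q : ℝ) : ‖lf p q‖ ≤ |p| + |q| := by
  refine ContinuousLinearMap.opNorm_le_bound _ (by positivity) fun e => ?_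
  rw [lf_apply, Real.norm_eq_abs, add_mul]
  refine (abs_add_le _ _).trans ?_
  rw [abs_mul, abs_mul]
  gcongr
  · exact norm_fst_le e
  · exact norm_snd_le e

lemma Partials.hasFDerivWithinAt (ha : 0 < a) {f fx fy : ℝ → ℝ → ℝ} (h : Partials L f fx fy)
    (hx : HS L a S fx) {z : ℝ × ℝ} (hz : z ∈ strip L) :
    HasFDerivWithinAt (fun z : ℝ × ℝ => f z.2 z.1) (lf (fx z.2 z.1) (fy z.2 z.1)) (strip L) z := by
  obtain ⟨x, y⟩ := z
  have hy : y ∈ Icc 0 L := hz.2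
  rw [hasFDerivWithinAt_iff_isLittleO, Asymptotics.isLittleO_iff]
  intro ε hε
  have h1 := hasDerivWithinAt_iff_isLittleO.1 (h.dy x y hy)
  rw [Asymptotics.isLittleO_iff] at h1
  have h2 := h1 (half_pos hε)
  have h3 := (hx.continuousOn ha) (y, x) ⟨hy, mem_univ _⟩
  obtain ⟨δ, hδ, H⟩ := Metric.continuousWithinAt_iff.1 h3 (ε / 2) (half_pos hε)
  rw [eventually_nhdsWithin_iff] at h2 ⊢
  have h4 : ∀ᶠ z : ℝ × ℝ in 𝓝 (x, y), z.2 ∈ Icc 0 L →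
      ‖f z.2 x - f y x - (z.2 - y) • fy y x‖ ≤ ε / 2 * ‖z.2 - y‖ :=
    (continuous_snd.tendsto (x, y)).eventually h2
  filter_upwards [h4, Metric.ball_mem_nhds (x, y) hδ] with z hz4 hzδ hzs
  obtain ⟨x', y'⟩ := z
  have hy' : y' ∈ Icc 0 L := hzs.2
  have hd : |x' - x| < δ ∧ |y' - y| < δ := by
    simpa [Prod.dist_eq, Real.dist_eq] using hzδ
  have h5 : |(f y' x' - fx y x * x') - (f y' x - fx y x * x)| ≤ ε / 2 * |x' - x| := by
    refine (convex_ball x δ).norm_image_sub_le_of_norm_hasDerivWithin_le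
      (f := fun t => f y' t - fx y x * t) (f' := fun t => fx y' t - fx y x)
      (fun t _ => ?_) (fun t ht => ?_) (Metric.mem_ball_self hδ) ?_
    · have := (h.dx y' hy' t).sub ((hasDerivAt_id t).const_mul (fx y x))
      rw [mul_one] at this
      exact this.hasDerivWithinAt
    · have := @H (y', t) ⟨hy', mem_univ _⟩ (by
        rw [Prod.dist_eq]; exact max_lt (by simpa [Real.dist_eq] using hd.2) ht)
      simpa [Real.dist_eq, Function.uncurry] using this.le
    · simpa [Real.dist_eq] using hd.1
  have h6 := hz4 hy'
  simp only [smul_eq_mul, Real.norm_eq_abs] at h6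
  have n1 : |x' - x| ≤ ‖(x', y') - (x, y)‖ := norm_fst_le ((x', y') - (x, y))
  have n2 : |y' - y| ≤ ‖(x', y') - (x, y)‖ := norm_snd_le ((x', y') - (x, y))
  have e : f y' x' - f y x - lf (fx y x) (fy y x) ((x', y') - (x, y))
      = ((f y' x' - fx y x * x') - (f y' x - fx y x * x)) + (f y' x - f y x - (y' - y) * fy y x) := by
    rw [lf_apply]
    simp only [Prod.mk_sub_mk]
    ring
  change ‖f y' x' - f y x - lf (fx y x) (fy y x) ((x', y') - (x, y))‖ ≤ _
  rw [e, Real.norm_eq_abs]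
  refine (abs_add_le _ _).trans ?_
  nlinarith

lemma Partials.hs (ha : a ∈ Ioo (0 : ℝ) 1) {f fx fy : ℝ → ℝ → ℝ} (h : Partials L f fx fy)
    (h0 : ∀ y ∈ Icc 0 L, ∀ x, |f y x| ≤ S) (hx : ∀ y ∈ Icc 0 L, ∀ x, |fx y x| ≤ S)
    (hy : ∀ y ∈ Icc 0 L, ∀ x, |fy y x| ≤ S) : HS L a (3 * S) f :=
  HS.of_lip ha h0 (fun y hy' => lip_of_hasDerivAt (h.dx y hy') (hx y hy'))
    (fun x _ hy1 _ hy2 => h.lip_y hy x hy1 hy2)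

/-- The bilinear form with coefficients `p`, `q`, `r`, `t`. -/
def bf (p q r t : ℝ) : ℝ × ℝ →L[ℝ] ℝ × ℝ →L[ℝ] ℝ :=
  (lf p q).smulRight (ContinuousLinearMap.fst ℝ ℝ ℝ)
    + (lf r t).smulRight (ContinuousLinearMap.snd ℝ ℝ ℝ)

lemma norm_bf_le (p q r t : ℝ) : ‖bf p q r t‖ ≤ |p| + |q| + |r| + |t| := by
  refine (norm_add_le ((lf p q).smulRight (ContinuousLinearMap.fst ℝ ℝ ℝ)) _).trans ?_
  rw [ContinuousLinearMap.norm_smulRight_apply, ContinuousLinearMap.norm_smulRight_apply]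
  have h1 := mul_le_mul (norm_lf_le p q) (ContinuousLinearMap.norm_fst_le ℝ ℝ ℝ) (norm_nonneg _)
    (by positivity)
  have h2 := mul_le_mul (norm_lf_le r t) (ContinuousLinearMap.norm_snd_le ℝ ℝ ℝ) (norm_nonneg _)
    (by positivity)
  linarith

lemma bf_sub (p q r t p' q' r' t' : ℝ) :
    bf p q r t - bf p' q' r' t' = bf (p - p') (q - q') (r - r') (t - t') := by
  ext <;> simp [bf, lf]

variable {f fx fy fxx fxy fyx fyy : ℝ → ℝ → ℝ}

lemma Reg2.nonneg (hL : 0 < L) (h : Reg2 L a S f fx fy fxx fxy fyx fyy) : 0 ≤ S := h.hxx.nonneg hL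

lemma Reg2.pd (ha : a ∈ Ioo (0 : ℝ) 1) (h : Reg2 L a S f fx fy fxx fxy fyx fyy)
    {z : ℝ × ℝ} (hz : z ∈ strip L) :
    HasFDerivWithinAt (fun z : ℝ × ℝ => f z.2 z.1) (lf (fx z.2 z.1) (fy z.2 z.1)) (strip L) z :=
  h.p.hasFDerivWithinAt ha.1 (h.px.hs ha h.bx h.hxx.1 h.hxy.1) hz

lemma Reg2.pd_bf (ha : a ∈ Ioo (0 : ℝ) 1) (h : Reg2 L a S f fx fy fxx fxy fyx fyy)
    {z : ℝ × ℝ} (hz : z ∈ strip L) :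
    HasFDerivWithinAt (fun z : ℝ × ℝ => lf (fx z.2 z.1) (fy z.2 z.1))
      (bf (fxx z.2 z.1) (fxy z.2 z.1) (fyx z.2 z.1) (fyy z.2 z.1)) (strip L) z :=
  ((h.px.hasFDerivWithinAt ha.1 h.hxx hz).smul_const (ContinuousLinearMap.fst ℝ ℝ ℝ)).add
    ((h.py.hasFDerivWithinAt ha.1 h.hyx hz).smul_const (ContinuousLinearMap.snd ℝ ℝ ℝ))

lemma Reg2.fderivWithin_eq (hL : 0 < L) (ha : a ∈ Ioo (0 : ℝ) 1)
    (h : Reg2 L a S f fx fy fxx fxy fyx fyy) :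
    EqOn (fderivWithin ℝ (fun z : ℝ × ℝ => f z.2 z.1) (strip L))
      (fun z => lf (fx z.2 z.1) (fy z.2 z.1)) (strip L) :=
  fun _ hz => (h.pd ha hz).fderivWithin (uniqueDiffOn_strip hL _ hz)

lemma Reg2.hess_eq (hL : 0 < L) (ha : a ∈ Ioo (0 : ℝ) 1)
    (h : Reg2 L a S f fx fy fxx fxy fyx fyy) :
    EqOn (hess (strip L) (fun z : ℝ × ℝ => f z.2 z.1))
      (fun z => bf (fxx z.2 z.1) (fxy z.2 z.1) (fyx z.2 z.1) (fyy z.2 z.1)) (strip L) :=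
  fun _ hz => (fderivWithin_congr (h.fderivWithin_eq hL ha) (h.fderivWithin_eq hL ha hz)).trans
    ((h.pd_bf ha hz).fderivWithin (uniqueDiffOn_strip hL _ hz))

lemma HS.continuousOn_strip (hf : HS L a S f) (ha : 0 < a) :
    ContinuousOn (fun z : ℝ × ℝ => f z.2 z.1) (strip L) :=
  (hf.continuousOn ha).comp (f := fun z : ℝ × ℝ => (z.2, z.1)) (by fun_prop)
    (fun _ hz => ⟨hz.2, mem_univ _⟩)

lemma Reg2.contDiffOn (hL : 0 < L) (ha : a ∈ Ioo (0 : ℝ) 1)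
    (h : Reg2 L a S f fx fy fxx fxy fyx fyy) :
    ContDiffOn ℝ 2 (fun z : ℝ × ℝ => f z.2 z.1) (strip L) := by
  have hs := uniqueDiffOn_strip hL
  have h1 : DifferentiableOn ℝ (fun z : ℝ × ℝ => f z.2 z.1) (strip L) :=
    fun z hz => (h.pd ha hz).differentiableWithinAt
  have h2 : DifferentiableOn ℝ (fderivWithin ℝ (fun z : ℝ × ℝ => f z.2 z.1) (strip L)) (strip L) :=
    DifferentiableOn.congr (fun z hz => (h.pd_bf ha hz).differentiableWithinAt)
      (h.fderivWithin_eq hL ha)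
  have h3 : ContinuousOn (hess (strip L) (fun z : ℝ × ℝ => f z.2 z.1)) (strip L) := by
    refine ContinuousOn.congr ?_ (h.hess_eq hL ha)
    unfold bf lf
    have c1 := h.hxx.continuousOn_strip ha.1
    have c2 := h.hxy.continuousOn_strip ha.1
    have c3 := h.hyx.continuousOn_strip ha.1
    have c4 := h.hyy.continuousOn_strip ha.1
    have l := fun (b : ℝ × ℝ →L[ℝ] ℝ) => (ContinuousLinearMap.smulRightL ℝ (ℝ × ℝ)
      (ℝ × ℝ →L[ℝ] ℝ)).flip b |>.continuous
    exact ((l _).comp_continuousOn ((c1.smul continuousOn_const).add (c2.smul continuousOn_const))).add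
      ((l _).comp_continuousOn ((c3.smul continuousOn_const).add (c4.smul continuousOn_const)))
  have e : (2 : WithTop ℕ∞) = 1 + 1 := by norm_num
  rw [e, contDiffOn_succ_iff_fderivWithin hs]
  refine ⟨h1, by simp, ?_⟩
  have e : (1 : WithTop ℕ∞) = 0 + 1 := by norm_num
  rw [e, contDiffOn_succ_iff_fderivWithin hs]
  exact ⟨h2, by simp, contDiffOn_zero.2 h3⟩

lemma Reg2.hBd (hL : 0 < L) (ha : a ∈ Ioo (0 : ℝ) 1)
    (h : Reg2 L a S f fx fy fxx fxy fyx fyy) :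
    HBd 2 a (strip L) (fun z : ℝ × ℝ => f z.2 z.1) (8 * S) := by
  have hS := h.nonneg hL
  refine (hBd_two_iff (uniqueDiffOn_strip hL)).2 ⟨fun z hz => ?_, fun z hz => ?_, fun z hz => ?_,
    fun z hz z' hz' => ?_⟩
  · exact (h.b _ hz.2 _).trans (by linarith)
  · rw [h.fderivWithin_eq hL ha hz]
    refine (norm_lf_le _ _).trans ?_
    linarith [h.bx _ hz.2 z.1, h.by' _ hz.2 z.1]
  · rw [h.hess_eq hL ha hz]
    refine (norm_bf_le _ _ _ _).trans ?_
    linarith [h.hxx.1 _ hz.2 z.1, h.hxy.1 _ hz.2 z.1, h.hyx.1 _ hz.2 z.1, h.hyy.1 _ hz.2 z.1]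
  · rw [h.hess_eq hL ha hz, h.hess_eq hL ha hz', bf_sub]
    refine (norm_bf_le _ _ _ _).trans ?_
    have h1 : |z.1 - z'.1| ^ a ≤ ‖z - z'‖ ^ a :=
      Real.rpow_le_rpow (abs_nonneg _) (norm_fst_le (z - z')) ha.1.le
    have h2 : |z.2 - z'.2| ^ a ≤ ‖z - z'‖ ^ a :=
      Real.rpow_le_rpow (abs_nonneg _) (norm_snd_le (z - z')) ha.1.le
    have h3 := mul_le_mul_of_nonneg_left (add_le_add h1 h2) hS
    linarith [h.hxx.2 _ hz.2 _ hz'.2 z.1 z'.1, h.hxy.2 _ hz.2 _ hz'.2 z.1 z'.1,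
      h.hyx.2 _ hz.2 _ hz'.2 z.1 z'.1, h.hyy.2 _ hz.2 _ hz'.2 z.1 z'.1]

lemma Reg2.pdx_eq (hL : 0 < L) (ha : a ∈ Ioo (0 : ℝ) 1)
    (h : Reg2 L a S f fx fy fxx fxy fyx fyy) {z : ℝ × ℝ} (hz : z ∈ strip L) :
    pdx L (fun z : ℝ × ℝ => f z.2 z.1) z = fx z.2 z.1 := by
  rw [pdx, h.fderivWithin_eq hL ha hz, lf_apply]; simp

lemma Reg2.pdy_eq (hL : 0 < L) (ha : a ∈ Ioo (0 : ℝ) 1)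
    (h : Reg2 L a S f fx fy fxx fxy fyx fyy) {z : ℝ × ℝ} (hz : z ∈ strip L) :
    pdy L (fun z : ℝ × ℝ => f z.2 z.1) z = fy z.2 z.1 := by
  rw [pdy, h.fderivWithin_eq hL ha hz, lf_apply]; simp

/-- Derivatives of `C^{2,α}` functions on the line. -/
lemma exists_deriv_of_hBd {h : ℝ → ℝ} (hc : ContDiffOn ℝ 2 h univ)
    (hb : HBd 2 a univ h S) : (∀ x, HasDerivAt h (deriv h x) x) ∧ (∀ x, |h x| ≤ S) ∧
      (∀ x, |deriv h x| ≤ S) ∧ DQ a S (deriv h) := by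
  rw [contDiffOn_univ] at hc
  obtain ⟨h0, h1, h2, h3⟩ := (hBd_two_iff uniqueDiffOn_univ).1 hb
  have d1 : Differentiable ℝ h := hc.differentiable (by norm_num)
  have e1 : fderivWithin ℝ h univ = fderiv ℝ h := fderivWithin_univ
  have d2 : Differentiable ℝ (fderiv ℝ h) :=
    (hc.fderiv_right (m := 1) (by norm_num)).differentiable (by norm_num)
  have e2 : ∀ x, HasDerivAt (deriv h) (hess univ h x 1 1) x := fun x => by
    have := (d2 x).hasFDerivAt.clm_apply (hasFDerivAt_const (1 : ℝ) x)
    rw [ContinuousLinearMap.comp_zero, zero_add] at this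
    have := this.hasDerivAt
    simpa [hess, e1] using this
  have n2 : ∀ T : ℝ →L[ℝ] ℝ →L[ℝ] ℝ, |T 1 1| ≤ ‖T‖ := fun T => by
    simpa using T.le_opNorm₂ 1 1
  refine ⟨fun x => (d1 x).hasDerivAt, fun x => h0 x (mem_univ _), fun x => ?_,
    DQ.of_hasDerivAt e2 ⟨fun x => (n2 _).trans (h2 x (mem_univ _)), fun x x' => ?_⟩⟩
  · have := h1 x (mem_univ _)
    rw [e1] at this
    have k := (fderiv ℝ h x).le_opNorm 1
    simp at k
    exact k.trans this
  · exact (n2 (hess univ h x - hess univ h x')).trans (h3 x (mem_univ _) x' (mem_univ _))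

end StripRegularity

section SolutionIsFixedPoint
open Filter Topology MeasureTheory

variable {a L η : ℝ} {d : Dat} {u v ux vx j p : ℝ → ℝ → ℝ}

/-- Normalised solutions of size `η`, extended constantly in `y` outside `[0, L]`. -/
structure NSol (L a η : ℝ) (d : Dat) (u v ux vx j p : ℝ → ℝ → ℝ) : Prop where
  lin : LinSol L d.β (vx L) j d.Φ u v ux vx
  cj : Continuous (Function.uncurry j)
  clj : ∀ y, j y = j (cl L y)
  cp : Continuous (Function.uncurry p)
  pp : ∀ y, Function.Periodic (p y) 1
  hp : Partials L p (fun y x => j y x * (1 + v y x)) (fun y x => -(j y x * u y x))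
  pj : ∀ y, Function.Periodic (j y) 1
  pux : ∀ y, Function.Periodic (ux y) 1
  pvx : ∀ y, Function.Periodic (vx y) 1
  hu : ∀ y, Hol a η (u y)
  hv : ∀ y, Hol a η (v y)
  hux : ∀ y, Hol a η (ux y)
  hvx : ∀ y, Hol a η (vx y)
  hj : ∀ y, Hol a η (j y)
  du : ∀ y, DQ a η (u y)
  dv : ∀ y, DQ a η (v y)
  dux : ∀ y, DQ a η (ux y)
  dvx : ∀ y, DQ a η (vx y)
  dj : ∀ y, DQ a η (j y)
  bot : ∀ x, j 0 x = d.gd x - u 0 x * ux 0 x - d.β x * j 0 x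
  top : ∀ x, vx L x = d.Gd x - (j L x + v L x * j L x) - u L x * ux L x - v L x * vx L x

/-- Functions constant along the field lines are determined by their values at the bottom. -/
lemma eq_zero_of_transport {e κ : ℝ → ℝ → ℝ} {β τ : ℝ → ℝ} {Φ : ℝ}
    (h : LinSol L β τ j Φ u v ux vx) (hv : ∀ y x, |v y x| ≤ 1 / 4)
    (ce : Continuous (Function.uncurry e)) (cκ : Continuous (Function.uncurry κ))
    (pe : ∀ y, Function.Periodic (e y) 1)
    (he : Partials L e (fun y x => κ y x * (1 + v y x)) (fun y x => -(κ y x * u y x)))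
    (h0 : ∀ x, e 0 x = 0) : ∀ y ∈ Icc 0 L, ∀ x, e y x = 0 := by
  intro Y hY x
  have hup : Partials L v vx (fun y x => -ux y x) :=
    ⟨fun y _ x => h.dv y x, fun x y hy => h.dvy x y hy⟩
  have hvpos : ∀ y x, 0 < 1 + v y x := fun y x => by linarith [(abs_le.1 (hv y x)).1]
  let R : ℝ → ℝ → ℝ := fun y x => 2 * e y x * κ y x * (1 + v y x) * u y x + e y x ^ 2 * ux y x
  have cR : Continuous (Function.uncurry R) := by
    have cu := h.cu
    have cv := h.cv
    have cux := h.cux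
    simp only [Function.uncurry_def] at *
    fun_prop
  have hR : ∀ y ∈ Icc 0 L, avg (R y) = 0 := fun y hy => by
    refine avg_deriv (f := fun x => e y x ^ 2 * u y x) (fun x => ?_) (fun x => ?_)
      (cR.comp (continuous_const.prodMk continuous_id))
    · beta_reduce
      rw [pe y x, h.pu y x]
    · refine (((he.dx y hy x).pow 2).mul (h.du y x)).congr_deriv ?_
      simp only [R, Pi.pow_apply]
      push_cast
      ring
  have hG : ∀ x, ∫ y in (0 : ℝ)..Y, R y x = -(e Y x ^ 2 * (1 + v Y x)) := fun x => by
    have hd : ∀ y ∈ Icc 0 L, HasDerivWithinAt (fun y => -(e y x ^ 2 * (1 + v y x))) (R y x)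
        (Icc 0 L) y := fun y hy => by
      refine (((he.dy x y hy).pow 2).mul ((hup.dy x y hy).const_add 1)).neg.congr_deriv ?_
      simp only [R, Pi.pow_apply]
      push_cast
      ring
    rw [intervalIntegral.integral_eq_sub_of_hasDerivAt_of_le
      (f := fun y => -(e y x ^ 2 * (1 + v y x))) hY.1]
    · rw [h0]; ring
    · exact fun y hy => ((hd y ⟨hy.1, hy.2.trans hY.2⟩).continuousWithinAt).mono
        (Icc_subset_Icc_right hY.2)
    · exact fun y hy => (hd y ⟨hy.1.le, hy.2.le.trans hY.2⟩).hasDerivAt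
        (Icc_mem_nhds hy.1 (hy.2.trans_le hY.2))
    · exact (cR.comp (continuous_id.prodMk continuous_const)).intervalIntegrable _ _
  have hz : ∫ x in (0 : ℝ)..1, e Y x ^ 2 * (1 + v Y x) = 0 := by
    have h1 : ∫ x in (0 : ℝ)..1, ∫ y in (0 : ℝ)..Y, R y x = 0 := by
      rw [integral_swap (f := fun x y => R y x) (cR.comp continuous_swap) zero_le_one hY.1]
      rw [intervalIntegral.integral_congr (g := fun _ => (0 : ℝ))]
      · simp
      · intro y hy
        rw [uIcc_of_le hY.1] at hy
        exact hR y ⟨hy.1, hy.2.trans hY.2⟩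
    simp_rw [hG] at h1
    rw [intervalIntegral.integral_neg] at h1
    linarith
  have hc : Continuous (fun x => e Y x ^ 2 * (1 + v Y x)) :=
    ((ce.comp (continuous_const.prodMk continuous_id)).pow 2).mul
      (continuous_const.add (h.cv.comp (continuous_const.prodMk continuous_id)))
  have h2 := eq_zero_of_integral_eq_zero hc zero_lt_one
    (fun x => mul_nonneg (sq_nonneg _) (hvpos Y x).le) hz
  have h3 : e Y (Int.fract x) = 0 := by
    have := h2 (Int.fract x) ⟨Int.fract_nonneg x, (Int.fract_lt_one x).le⟩
    simpa [(hvpos Y _).ne'] using this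
  have h4 := (pe Y).sub_zsmul_eq (x := x) ⌊x⌋
  rw [zsmul_one] at h4
  rw [← h4]
  exact h3

/-- Normalised solutions are fixed points of the iteration. -/
theorem NSol.exists_step (hL : 0 < L) (ha : a ∈ Ioo (0 : ℝ) 1) (hd : d.Ok a η) (hη : η ≤ 1 / 4)
    (h : NSol L a η d u v ux vx j p) :
    ∃ w : Cmp → ℝ → ℝ → ℝ, w .u = u ∧ w .v = v ∧ St a ((24 + 4 * L) * η) w ∧ Step L d w w ∧
      ∀ y ∈ Icc 0 L, ∀ x, p y x = p 0 (x + w .s y x) := by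
  have h0 := hd.nonneg
  have h0L : (0 : ℝ) ∈ Icc 0 L := ⟨le_rfl, hL.le⟩
  have hLL : L ∈ Icc 0 L := ⟨hL.le, le_rfl⟩
  have hβ : ∀ x, |d.β x| ≤ 1 / 2 := fun x => (hd.βH.1 x).trans (by linarith)
  obtain ⟨E, hE1, hE2, hE3⟩ := exists_inverse hd.hA hβ
  have cE : Continuous E := continuous_iff_continuousAt.2 fun x => (hE3 x).continuousAt
  have cA : Continuous d.A := continuous_iff_continuousAt.2 fun x => (hd.hA x).continuousAt
  have cβ : Continuous d.β := hd.βD.continuous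
  have cI : Continuous (fun z : ℝ × ℝ => ∫ r in (0 : ℝ)..cl L z.1, u r z.2) := by
    refine intervalIntegral.continuous_parametric_intervalIntegral_of_continuous (μ := volume)
      (f := fun (p : ℝ × ℝ) r => u r p.2) (a₀ := 0) (s := fun p => cl L p.1) ?_ ?_
    · exact h.lin.cu.comp (continuous_snd.prodMk (continuous_snd.comp continuous_fst))
    · exact (continuous_cl L).comp continuous_fst
  obtain ⟨θ, hθ⟩ : ∃ θ : ℝ → ℝ → ℝ, ∀ y x,
      θ y x = E (x + d.A x - ∫ r in (0 : ℝ)..cl L y, u r x) := ⟨_, fun _ _ => rfl⟩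
  have cθ : Continuous (Function.uncurry θ) := by
    have : Function.uncurry θ =
        fun z : ℝ × ℝ => E (z.2 + d.A z.2 - ∫ r in (0 : ℝ)..cl L z.1, u r z.2) := by
      funext z; exact hθ z.1 z.2
    rw [this]
    exact cE.comp ((continuous_snd.add (cA.comp continuous_snd)).sub cI)
  have hθp := h.lin.partials_label cβ hd.hA hE3 hθ
  have hθA : ∀ y x, θ y x + d.A (θ y x) = x + d.A x - ∫ r in (0 : ℝ)..cl L y, u r x :=
    fun y x => by rw [hθ, hE1]
  have hθ0 : ∀ x, θ 0 x = x := fun x => by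
    rw [hθ, cl_of_mem h0L, intervalIntegral.integral_same, sub_zero, hE2]
  have hθc : ∀ y, θ y = θ (cl L y) := fun y => by
    funext x; rw [hθ, hθ, cl_cl hL]
  have hA1 : ∀ x, d.A (x + 1) = d.A x + (d.A 1 - d.A 0) := fun x => by
    have := hd.A_add_one x 0
    rw [zero_add] at this
    linarith
  have hθ1 : ∀ y x, θ y (x + 1) = θ y x + 1 := fun y x => by
    have e1 : x + 1 + d.A (x + 1) - ∫ r in (0 : ℝ)..cl L y, u r (x + 1)
        = (θ y x + 1) + d.A (θ y x + 1) := by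
      have : ∫ r in (0 : ℝ)..cl L y, u r (x + 1) = ∫ r in (0 : ℝ)..cl L y, u r x := by
        congr 1; funext r; exact h.lin.pu r x
      rw [this, hA1, hA1]
      linarith [hθA y x]
    rw [hθ, e1, hE2]
  have hb : ∀ y x, |v y x| ≤ η := fun y x => (h.hv y).1 x
  have hk : ∀ x, |(1 + d.β x)⁻¹| ≤ 2 := (hd.βH.inv_one_add hη).1
  have hk0 : ∀ x, 1 + d.β x ≠ 0 := fun x => by
    linarith [(abs_le.1 (hβ x)).1]
  have hq : ∀ x, HasDerivAt (p 0) (j 0 x * (1 + d.β x)) x := fun x => by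
    have := h.hp.dx 0 h0L x
    beta_reduce at this
    rwa [h.lin.bot] at this
  have hqθ := hθp.comp hq
  have hjθ : ∀ y ∈ Icc 0 L, (∀ x, p y x = p 0 (θ y x)) ∧ ∀ x, j y x = j 0 (θ y x) := by
    have key := eq_zero_of_transport (e := fun y x => p y x - p 0 (θ y x))
      (κ := fun y x => j y x - j 0 (θ y x)) h.lin (fun y x => (hb y x).trans hη) ?_ ?_ ?_ ?_ ?_
    · intro y hy
      refine ⟨fun x => sub_eq_zero.1 (key y hy x), fun x => ?_⟩
      have h1 := (h.hp.sub hqθ).dx y hy x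
      have h2 : HasDerivAt (fun x => p y x - p 0 (θ y x)) 0 x := by
        have : (fun x => p y x - p 0 (θ y x)) = fun _ => 0 := funext (key y hy)
        rw [this]
        exact hasDerivAt_const _ _
      have h3 := h1.unique h2
      have h4 : (j y x - j 0 (θ y x)) * (1 + v y x) = 0 := by
        refine Eq.trans ?_ h3
        have := hk0 (θ y x)
        field_simp
      rcases mul_eq_zero.1 h4 with h5 | h5
      · exact sub_eq_zero.1 h5
      · linarith [(abs_le.1 (hb y x)).1]
    · exact h.cp.sub (h.cp.comp (continuous_const.prodMk cθ))
    · exact h.cj.sub (h.cj.comp (continuous_const.prodMk cθ))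
    · intro y x
      beta_reduce
      rw [hθ1, h.pp, h.pp]
    · have := h.hp.sub hqθ
      convert this using 3 with y x y x
      · have := hk0 (θ y x)
        field_simp
      · have := hk0 (θ y x)
        field_simp
        ring
    · intro x
      rw [hθ0, sub_self]
  have hjall : ∀ y x, j y x = j 0 (θ y x) := fun y x => by
    rw [h.clj y, hθc y]
    exact (hjθ _ (cl_mem hL y)).2 x
  obtain ⟨σ, hσ⟩ : ∃ σ : ℝ → ℝ → ℝ, ∀ y x, σ y x = θ y x - x := ⟨_, fun _ _ => rfl⟩
  have hθσ : ∀ y x, x + σ y x = θ y x := fun y x => by rw [hσ]; ring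
  have hσs : ∀ y x, σ y x = -(∫ r in (0 : ℝ)..cl L y, u r x) - (d.A (x + σ y x) - d.A x) :=
    fun y x => by
      rw [hθσ, hσ]
      linarith [hθA y x]
  have hσd : ∀ y x, HasDerivAt (σ y) ((1 + d.β (x + σ y x))⁻¹ * (v y x - d.β (x + σ y x))) x := by
    intro y x
    have e1 : σ y = fun x => θ (cl L y) x - x := by
      funext x; rw [hσ, ← hθc]
    rw [e1]
    refine ((hθp.dx _ (cl_mem hL y) x).sub (hasDerivAt_id x)).congr_deriv ?_
    beta_reduce
    rw [← hθc, ← h.lin.clv, show x + (θ y x - x) = θ y x by ring]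
    have := hk0 (θ y x)
    field_simp
    ring
  have hσl : ∀ y x x', |σ y x - σ y x'| ≤ |x - x'| := fun y x x' => by
    have := lip_of_hasDerivAt (hσd y) (S := 1) (fun x => ?_) x x'
    · rwa [one_mul] at this
    · have h1 := hk (x + σ y x)
      have h2 : |v y x - d.β (x + σ y x)| ≤ 1 / 2 :=
        (abs_sub _ _).trans (by linarith [hb y x, hd.βH.1 (x + σ y x), Real.norm_eq_abs (d.β (x + σ y x))])
      rw [Real.norm_eq_abs, abs_mul]
      nlinarith [abs_nonneg (v y x - d.β (x + σ y x))]
  have hσD : ∀ y, DQ a (24 * η) (σ y) := fun y => by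
    refine DQ.of_hasDerivAt (hσd y) ?_
    refine (((hd.βH.inv_one_add hη).comp ha (hσl y)).mul
      ((h.hv y).sub (hd.βH.comp ha (hσl y)))).mono ?_
    linarith
  have hσb : ∀ y x, |σ y x| ≤ 2 * L * η := fun y x => by
    have h1 : |∫ r in (0 : ℝ)..cl L y, u r x| ≤ η * L := by
      have h2 := intervalIntegral.norm_integral_le_of_norm_le_const (a := 0) (b := cl L y)
        (f := fun r => u r x) (C := η) (fun r _ => (h.hu r).1 x)
      rw [sub_zero, abs_of_nonneg (cl_mem hL y).1] at h2
      exact h2.trans (mul_le_mul_of_nonneg_left (cl_mem hL y).2 h0)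
    have h2 := hd.AD.lip (x + σ y x) x
    rw [show x + σ y x - x = σ y x by ring] at h2
    have h3 : |σ y x| ≤ |∫ r in (0 : ℝ)..cl L y, u r x| + |d.A (x + σ y x) - d.A x| := by
      conv_lhs => rw [hσs y x]
      exact (abs_sub _ _).trans (by rw [abs_neg])
    have h4 : η * |σ y x| ≤ 1 / 4 * |σ y x| := by gcongr
    have h5 : |d.A (x + σ y x) - d.A x| ≤ 1 / 4 * |σ y x| := by
      refine le_trans h2 ?_
      exact h4
    nlinarith [mul_nonneg h0 hL.le]
  have hσH : ∀ y, Hol a ((24 + 4 * L) * η) (σ y) := fun y =>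
    (hol_of_lip ha (hσb y) (fun x x' => (hσD y).lip x x')).mono (by nlinarith)
  have hηη : η ≤ (24 + 4 * L) * η := by nlinarith [mul_nonneg h0 hL.le]
  have hη24 : 24 * η ≤ (24 + 4 * L) * η := by nlinarith [mul_nonneg h0 hL.le]
  let w : Cmp → ℝ → ℝ → ℝ := fun i => match i with
    | .u => u | .v => v | .ux => ux | .vx => vx | .s => σ | .f => fun _ => j 0
  have hJ : stepJ w w = j := by
    funext y x
    change j 0 (x + σ y x) = j y x
    rw [hθσ, ← hjall]
  have hR : stepR L d w w = vx L := by
    funext x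
    unfold stepR
    rw [hJ]
    exact (h.top x).symm
  have havg : avg (vx L) = 0 := avg_deriv (h.lin.pv L) (h.lin.dv L)
    (h.lin.cvx.comp (continuous_const.prodMk continuous_id))
  refine ⟨w, rfl, rfl, ⟨?_, ?_, ?_, ?_⟩, ⟨fun y x => h.bot x, ?_, hσs⟩, fun y hy x => ?_⟩
  · rintro (_ | _ | _ | _ | _ | _) y
    exacts [(h.hu y).mono hηη, (h.hv y).mono hηη, (h.hux y).mono hηη, (h.hvx y).mono hηη, hσH y,
      (h.hj 0).mono hηη]
  · rintro (_ | _ | _ | _ | _ | _) y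
    exacts [(h.du y).mono hηη, (h.dv y).mono hηη, (h.dux y).mono hηη, (h.dvx y).mono hηη,
      (hσD y).mono hη24, (h.dj 0).mono hηη]
  · rintro (_ | _ | _ | _ | _ | _) y
    · exact h.lin.pu y
    · exact h.lin.pv y
    · exact h.pux y
    · exact h.pvx y
    · intro x
      change σ y (x + 1) = σ y x
      rw [hσ, hσ, hθ1]
      ring
    · exact h.pj 0
  · change Continuous (Function.uncurry σ)
    have : Function.uncurry σ = fun z : ℝ × ℝ => Function.uncurry θ z - z.2 := by
      funext z; exact hσ z.1 z.2
    rw [this]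
    exact cθ.sub continuous_snd
  · rw [hJ, hR, havg]
    simp only [sub_zero]
    exact h.lin
  · change p y x = p 0 (x + σ y x)
    rw [hθσ]
    exact (hjθ y hy).1 x

end SolutionIsFixedPoint

section NormalisedUniqueness
open Filter Topology MeasureTheory

variable {a L S T η c : ℝ} {d : Dat}
  {f fx fy fxx fxy fyx fyy g gx gy gxx gxy gyx gyy : ℝ → ℝ → ℝ}

lemma HS.const_mul (hf : HS L a S f) (c : ℝ) : HS L a (|c| * S) (fun y x => c * f y x) := by
  refine ⟨fun y hy x => ?_, fun y hy y' hy' x x' => ?_⟩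
  · rw [abs_mul]
    exact mul_le_mul_of_nonneg_left (hf.1 y hy x) (abs_nonneg c)
  · rw [← mul_sub, abs_mul, mul_assoc]
    exact mul_le_mul_of_nonneg_left (hf.2 y hy y' hy' x x') (abs_nonneg c)

lemma Partials.const_mul (hf : Partials L f fx fy) (c : ℝ) :
    Partials L (fun y x => c * f y x) (fun y x => c * fx y x) (fun y x => c * fy y x) :=
  ⟨fun y hy x => (hf.dx y hy x).const_mul c, fun x y hy => (hf.dy x y hy).const_mul c⟩

lemma Reg2.const_mul (hf : Reg2 L a S f fx fy fxx fxy fyx fyy) (c : ℝ) :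
    Reg2 L a (|c| * S) (fun y x => c * f y x) (fun y x => c * fx y x) (fun y x => c * fy y x)
      (fun y x => c * fxx y x) (fun y x => c * fxy y x) (fun y x => c * fyx y x)
      (fun y x => c * fyy y x) where
  p := hf.p.const_mul c
  px := hf.px.const_mul c
  py := hf.py.const_mul c
  b y hy x := by
    rw [abs_mul]; exact mul_le_mul_of_nonneg_left (hf.b y hy x) (abs_nonneg c)
  bx y hy x := by
    rw [abs_mul]; exact mul_le_mul_of_nonneg_left (hf.bx y hy x) (abs_nonneg c)
  by' y hy x := by
    rw [abs_mul]; exact mul_le_mul_of_nonneg_left (hf.by' y hy x) (abs_nonneg c)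
  hxx := hf.hxx.const_mul c
  hxy := hf.hxy.const_mul c
  hyx := hf.hyx.const_mul c
  hyy := hf.hyy.const_mul c

lemma Reg2.add (hf : Reg2 L a S f fx fy fxx fxy fyx fyy) (hg : Reg2 L a T g gx gy gxx gxy gyx gyy) :
    Reg2 L a (S + T) (fun y x => f y x + g y x) (fun y x => fx y x + gx y x)
      (fun y x => fy y x + gy y x) (fun y x => fxx y x + gxx y x) (fun y x => fxy y x + gxy y x)
      (fun y x => fyx y x + gyx y x) (fun y x => fyy y x + gyy y x) where
  p := hf.p.add hg.p
  px := hf.px.add hg.px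
  py := hf.py.add hg.py
  b y hy x := (abs_add_le _ _).trans (add_le_add (hf.b y hy x) (hg.b y hy x))
  bx y hy x := (abs_add_le _ _).trans (add_le_add (hf.bx y hy x) (hg.bx y hy x))
  by' y hy x := (abs_add_le _ _).trans (add_le_add (hf.by' y hy x) (hg.by' y hy x))
  hxx := hf.hxx.add hg.hxx
  hxy := hf.hxy.add hg.hxy
  hyx := hf.hyx.add hg.hyx
  hyy := hf.hyy.add hg.hyy

lemma HS.continuous_cl (hL : 0 < L) (ha : 0 < a) (hf : HS L a S f) :
    Continuous (Function.uncurry (fun y => f (cl L y))) := by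
  have h1 : Continuous (fun z : ℝ × ℝ => (cl L z.1, z.2)) :=
    ((EulerBVP.continuous_cl L).comp continuous_fst).prodMk continuous_snd
  exact (hf.continuousOn ha).comp_continuous h1 fun z => ⟨cl_mem hL z.1, mem_univ _⟩

lemma Partials.periodic_x (hf : Partials L f fx fy) (hp : ∀ y, Function.Periodic (f y) 1) {y : ℝ}
    (hy : y ∈ Icc 0 L) : Function.Periodic (fx y) 1 := fun x => by
  have h1 := (hf.dx y hy (x + 1)).comp_add_const x 1
  have h2 : (fun x => f y (x + 1)) = f y := funext (hp y)
  rw [h2] at h1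
  exact h1.unique (hf.dx y hy x)

lemma Partials.periodic_y (hL : 0 < L) (hf : Partials L f fx fy)
    (hp : ∀ y, Function.Periodic (f y) 1) {y : ℝ}
    (hy : y ∈ Icc 0 L) : Function.Periodic (fy y) 1 := fun x => by
  have h1 := hf.dy (x + 1) y hy
  have h2 : (fun y => f y (x + 1)) = fun y => f y x := funext fun y => hp y x
  rw [h2] at h1
  exact ((uniqueDiffOn_Icc hL) y hy).eq_deriv _ h1 (hf.dy x y hy)

/-- Normalised solutions of size `S` on the strip. -/
structure RSol (L a S : ℝ) (d : Dat) (Pm : ℝ → ℝ) (U Ux Uy V Vx Vy P : ℝ → ℝ → ℝ) : Prop where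
  rU : ∃ f₁ f₂ f₃ f₄, Reg2 L a S U Ux Uy f₁ f₂ f₃ f₄
  rV : ∃ f₁ f₂ f₃ f₄, Reg2 L a S V Vx Vy f₁ f₂ f₃ f₄
  rP : ∃ T Px Py f₁ f₂ f₃ f₄, Reg2 L a T P Px Py f₁ f₂ f₃ f₄ ∧
    (∀ y ∈ Icc 0 L, ∀ x, Px y x = (Vx y x - Uy y x) * (1 + V y x)) ∧
    (∀ y ∈ Icc 0 L, ∀ x, Py y x = -((Vx y x - Uy y x) * U y x))
  pU : ∀ y, Function.Periodic (U y) 1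
  pV : ∀ y, Function.Periodic (V y) 1
  pP : ∀ y, Function.Periodic (P y) 1
  div : ∀ y ∈ Icc 0 L, ∀ x, Vy y x = -Ux y x
  bot : ∀ x, V 0 x = d.β x
  flux : ∫ y in (0 : ℝ)..L, U y 0 = d.Φ
  pbot : ∀ x, P 0 x = Pm x - U 0 x ^ 2 / 2 - (1 + d.β x) ^ 2 / 2
  cbot : ∀ x, (Vx 0 x - Uy 0 x) * (1 + d.β x) + U 0 x * Ux 0 x = d.gd x
  ctop : ∀ x, (Vx L x - Uy L x) * (1 + V L x) + U L x * Ux L x + (1 + V L x) * Vx L x = d.Gd x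

variable {Pm : ℝ → ℝ} {U Ux Uy V Vx Vy P U' Ux' Uy' V' Vx' Vy' P' : ℝ → ℝ → ℝ}

lemma RSol.nsol (hL : 0 < L) (ha : a ∈ Ioo (0 : ℝ) 1) (hη : 6 * S ≤ η)
    (h : RSol L a S d Pm U Ux Uy V Vx Vy P) :
    NSol L a η d (fun y => U (cl L y)) (fun y => V (cl L y)) (fun y => Ux (cl L y))
      (fun y => Vx (cl L y)) (fun y x => Vx (cl L y) x - Uy (cl L y) x) (fun y => P (cl L y)) := by
  have h0L : (0 : ℝ) ∈ Icc 0 L := ⟨le_rfl, hL.le⟩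
  have hLL : L ∈ Icc 0 L := ⟨hL.le, le_rfl⟩
  have hc0 : cl L 0 = 0 := cl_of_mem h0L
  have hcL : cl L L = L := cl_of_mem hLL
  obtain ⟨T, Px, Py, k₁, k₂, k₃, k₄, hP, hPx, hPy⟩ := h.rP
  obtain ⟨f₁, f₂, f₃, f₄, hU⟩ := h.rU
  obtain ⟨g₁, g₂, g₃, g₄, hV⟩ := h.rV
  have hS := hU.nonneg hL
  have hm := cl_mem hL
  have sU := hU.p.hs ha hU.b hU.bx hU.by'
  have sV := hV.p.hs ha hV.b hV.bx hV.by'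
  have sP := hP.p.hs ha hP.b hP.bx hP.by'
  have sUx := hU.px.hs ha hU.bx hU.hxx.1 hU.hxy.1
  have sUy := hU.py.hs ha hU.by' hU.hyx.1 hU.hyy.1
  have sVx := hV.px.hs ha hV.bx hV.hxx.1 hV.hxy.1
  have h3 : 3 * S ≤ η := by linarith
  have h1 : S ≤ η := by linarith
  have hh : ∀ {f : ℝ → ℝ → ℝ} {S : ℝ}, HS L a S f → ∀ y, Hol a S (f (cl L y)) :=
    fun hf y => hf.hol ha.1 (hm y)
  constructor
  · constructor
    · exact sU.continuous_cl hL ha.1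
    · exact sV.continuous_cl hL ha.1
    · exact sUx.continuous_cl hL ha.1
    · exact sVx.continuous_cl hL ha.1
    · exact fun y => by rw [cl_cl hL]
    · exact fun y => by rw [cl_cl hL]
    · exact fun y => by rw [cl_cl hL]
    · exact fun y => by rw [cl_cl hL]
    · exact fun y => h.pU _
    · exact fun y => h.pV _
    · exact fun y x => hU.p.dx _ (hm y) x
    · exact fun y x => hV.p.dx _ (hm y) x
    · intro x y hy
      refine ((hU.p.dy x y hy).congr (fun z hz => by rw [cl_of_mem hz]) (by rw [cl_of_mem hy])).congr_deriv ?_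
      rw [cl_of_mem hy]
      ring
    · intro x y hy
      refine ((hV.p.dy x y hy).congr (fun z hz => by rw [cl_of_mem hz]) (by rw [cl_of_mem hy])).congr_deriv ?_
      rw [cl_of_mem hy, h.div y hy]
    · intro x
      rw [hc0, h.bot]
    · exact fun x => rfl
    · rw [← h.flux]
      refine intervalIntegral.integral_congr fun y hy => ?_
      rw [uIcc_of_le hL.le] at hy
      rw [cl_of_mem hy]
  · exact (sVx.continuous_cl hL ha.1).sub (sUy.continuous_cl hL ha.1)
  · exact fun y => by rw [cl_cl hL]
  · exact sP.continuous_cl hL ha.1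
  · exact fun y => h.pP _
  · constructor
    · intro y hy x
      rw [cl_of_mem hy]
      exact (hP.p.dx y hy x).congr_deriv (hPx y hy x)
    · intro x y hy
      refine ((hP.p.dy x y hy).congr (fun z hz => by rw [cl_of_mem hz]) (by rw [cl_of_mem hy])).congr_deriv ?_
      rw [cl_of_mem hy]
      exact hPy y hy x
  · intro y x
    beta_reduce
    rw [hV.p.periodic_x h.pV (hm y), hU.p.periodic_y hL h.pU (hm y)]
  · exact fun y => hU.p.periodic_x h.pU (hm y)
  · exact fun y => hV.p.periodic_x h.pV (hm y)
  · exact fun y => (hh sU y).mono h3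
  · exact fun y => (hh sV y).mono h3
  · exact fun y => (hh sUx y).mono h3
  · exact fun y => (hh sVx y).mono h3
  · exact fun y => ((hh sVx y).sub (hh sUy y)).mono (by linarith)
  · exact fun y => (DQ.of_hasDerivAt (hU.p.dx _ (hm y)) (hh sUx y)).mono h3
  · exact fun y => (DQ.of_hasDerivAt (hV.p.dx _ (hm y)) (hh sVx y)).mono h3
  · exact fun y => (DQ.of_hasDerivAt (hU.px.dx _ (hm y)) (hh hU.hxx y)).mono h1
  · exact fun y => (DQ.of_hasDerivAt (hV.px.dx _ (hm y)) (hh hV.hxx y)).mono h1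
  · exact fun y => ((DQ.of_hasDerivAt (hV.px.dx _ (hm y)) (hh hV.hxx y)).sub
      (DQ.of_hasDerivAt (hU.py.dx _ (hm y)) (hh hU.hyx y))).mono (by linarith)
  · intro x
    rw [hc0]
    linarith [h.cbot x]
  · intro x
    rw [hcL]
    linarith [h.ctop x]

/-- Uniqueness of small normalised solutions. -/
theorem RSol.unique (hL : 0 < L) (ha : a ∈ Ioo (0 : ℝ) 1) (hη : 6 * S ≤ η)
    (hηL : 2 * rc L a * ((24 + 4 * L) * η) ≤ 1) (hd : d.Ok a η)
    (h : RSol L a S d Pm U Ux Uy V Vx Vy P) (h' : RSol L a S d Pm U' Ux' Uy' V' Vx' Vy' P') :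
    ∀ y ∈ Icc 0 L, ∀ x, U y x = U' y x ∧ V y x = V' y x ∧ P y x = P' y x := by
  have h0 := hd.nonneg
  have hr : 1 ≤ rc L a := (sc_ge hL ha).trans (rc_ge hL ha)
  have hη4 : η ≤ 1 / 4 := by
    nlinarith [mul_nonneg h0 hL.le, mul_nonneg (mul_nonneg h0 hL.le) (by linarith : 0 ≤ rc L a - 1),
      mul_nonneg h0 (by linarith : 0 ≤ rc L a - 1)]
  have hηη : η ≤ (24 + 4 * L) * η := by nlinarith [mul_nonneg h0 hL.le]
  obtain ⟨w, hwu, hwv, hw, hs, hp⟩ := (h.nsol hL ha hη).exists_step hL ha hd hη4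
  obtain ⟨w', hwu', hwv', hw', hs', hp'⟩ := (h'.nsol hL ha hη).exists_step hL ha hd hη4
  have e : w = w' := fixedPoint_unique hL ha hηL (hd.mono hηη) hw hw' hs hs'
  subst e
  have hU : ∀ y ∈ Icc 0 L, U y = U' y := fun y hy => by
    have := congrFun (hwu.symm.trans hwu') y
    beta_reduce at this
    rwa [cl_of_mem hy] at this
  have hV : ∀ y ∈ Icc 0 L, V y = V' y := fun y hy => by
    have := congrFun (hwv.symm.trans hwv') y
    beta_reduce at this
    rwa [cl_of_mem hy] at this
  have h0L : (0 : ℝ) ∈ Icc 0 L := ⟨le_rfl, hL.le⟩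
  intro y hy x
  refine ⟨by rw [hU y hy], by rw [hV y hy], ?_⟩
  have h1 := hp y hy x
  have h2 := hp' y hy x
  rw [cl_of_mem hy, cl_of_mem h0L] at h1 h2
  rw [h1, h2, h.pbot, h'.pbot, hU 0 h0L]

end NormalisedUniqueness

section NormalisedData
open Filter Topology MeasureTheory

variable {a L δ κ c J μ : ℝ} {b₁ b₁x b₁y b₂ b₂x b₂y : ℝ → ℝ → ℝ} {h hm hp fm : ℝ → ℝ}

/-- Normalised reference states: deviations of size `δ` from the vertical field. -/
structure NBase (L a δ : ℝ) (b₁ b₁x b₁y b₂ b₂x b₂y : ℝ → ℝ → ℝ) : Prop where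
  r₁ : ∃ f₁ f₂ f₃ f₄, Reg2 L a δ b₁ b₁x b₁y f₁ f₂ f₃ f₄
  r₂ : ∃ f₁ f₂ f₃ f₄, Reg2 L a δ b₂ b₂x b₂y f₁ f₂ f₃ f₄
  p₁ : ∀ y, Function.Periodic (b₁ y) 1
  p₂ : ∀ y, Function.Periodic (b₂ y) 1

/-- Periodic boundary data of size `κ`. -/
structure BDat (a κ : ℝ) (h : ℝ → ℝ) : Prop where
  d : ∀ x, HasDerivAt h (deriv h x) x
  b : ∀ x, |h x| ≤ κ
  bd : ∀ x, |deriv h x| ≤ κ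
  dq : DQ a κ (deriv h)
  per : Function.Periodic h 1

lemma BDat.hol (hh : BDat a κ h) (ha : a ∈ Ioo (0 : ℝ) 1) : Hol a (3 * κ) h :=
  (hol_of_lip ha hh.b (lip_of_hasDerivAt hh.d hh.bd)).mono (by linarith)

lemma BDat.holD (hh : BDat a κ h) (ha : a ∈ Ioo (0 : ℝ) 1) : Hol a (3 * κ) (deriv h) :=
  (hol_of_lip ha hh.bd hh.dq.lip).mono (by linarith)

lemma BDat.perD (hh : BDat a κ h) : Function.Periodic (deriv h) 1 := fun x => by
  have h1 := (hh.d (x + 1)).comp_add_const x 1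
  have h2 : (fun x => h (x + 1)) = h := funext hh.per
  rw [h2] at h1
  exact h1.unique (hh.d x)

/-- Normalisation of the data of the boundary value problem. -/
def mkDat (L c J : ℝ) (b₁ b₁x b₂ b₂x : ℝ → ℝ → ℝ) (hm hp fm : ℝ → ℝ) : Dat where
  gd x := b₁ 0 x * b₁x 0 x + (1 + b₂ 0 x) * b₂x 0 x + (c ^ 2)⁻¹ * deriv hm x
    - (1 + (b₂ 0 x - c⁻¹ * fm x)) * (b₂x 0 x - c⁻¹ * deriv fm x)
  Gd x := b₁ L x * b₁x L x + (1 + b₂ L x) * b₂x L x + (c ^ 2)⁻¹ * deriv hp x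
  β x := b₂ 0 x - c⁻¹ * fm x
  βd x := b₂x 0 x - c⁻¹ * deriv fm x
  A x := ∫ t in (0 : ℝ)..x, (b₂ 0 t - c⁻¹ * fm t)
  Φ := -J / c

lemma mkDat_ok (hL : 0 < L) (ha : a ∈ Ioo (0 : ℝ) 1) (hb : NBase L a δ b₁ b₁x b₁y b₂ b₂x b₂y)
    (hhm : BDat a κ hm) (hhp : BDat a κ hp) (hfm : BDat a κ fm)
    (hμ : 3 * δ + 3 * (|c|⁻¹ * κ) + 3 * (|c ^ 2|⁻¹ * κ) ≤ μ) (hμ1 : μ ≤ 1) :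
    (mkDat L c J b₁ b₁x b₂ b₂x hm hp fm).Ok a (16 * μ) := by
  have h0L : (0 : ℝ) ∈ Icc 0 L := ⟨le_rfl, hL.le⟩
  have hLL : L ∈ Icc 0 L := ⟨hL.le, le_rfl⟩
  obtain ⟨f₁, f₂, f₃, f₄, r₁⟩ := hb.r₁
  obtain ⟨g₁, g₂, g₃, g₄, r₂⟩ := hb.r₂
  have hδ := r₁.nonneg hL
  have hκ : 0 ≤ κ := (abs_nonneg _).trans (hhm.b 0)
  have k1 : 0 ≤ |c|⁻¹ * κ := by positivity
  have k2 : 0 ≤ |c ^ 2|⁻¹ * κ := by positivity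
  have hμ0 : 0 ≤ μ := by linarith
  have s₁ : ∀ y ∈ Icc 0 L, Hol a μ (b₁ y) := fun y hy =>
    ((r₁.p.hs ha r₁.b r₁.bx r₁.by').hol ha.1 hy).mono (by linarith)
  have s₁x : ∀ y ∈ Icc 0 L, Hol a μ (b₁x y) := fun y hy =>
    ((r₁.px.hs ha r₁.bx r₁.hxx.1 r₁.hxy.1).hol ha.1 hy).mono (by linarith)
  have s₂ : ∀ y ∈ Icc 0 L, Hol a (3 * δ) (b₂ y) := fun y hy =>
    (r₂.p.hs ha r₂.b r₂.bx r₂.by').hol ha.1 hy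
  have s₂x : ∀ y ∈ Icc 0 L, Hol a (3 * δ) (b₂x y) := fun y hy =>
    (r₂.px.hs ha r₂.bx r₂.hxx.1 r₂.hxy.1).hol ha.1 hy
  have q₁ : ∀ y ∈ Icc 0 L, DQ a μ (b₁ y) := fun y hy =>
    DQ.of_hasDerivAt (r₁.p.dx y hy) (s₁x y hy)
  have q₁x : ∀ y ∈ Icc 0 L, DQ a μ (b₁x y) := fun y hy =>
    (DQ.of_hasDerivAt (r₁.px.dx y hy) (r₁.hxx.hol ha.1 hy)).mono (by linarith)
  have q₂ : ∀ y ∈ Icc 0 L, DQ a μ (b₂ y) := fun y hy =>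
    (DQ.of_hasDerivAt (r₂.p.dx y hy) (s₂x y hy)).mono (by linarith)
  have q₂x : ∀ y ∈ Icc 0 L, DQ a δ (b₂x y) := fun y hy =>
    DQ.of_hasDerivAt (r₂.px.dx y hy) (r₂.hxx.hol ha.1 hy)
  have βH : Hol a μ (fun x => b₂ 0 x - c⁻¹ * fm x) :=
    ((s₂ 0 h0L).sub ((hfm.hol ha).const_mul c⁻¹)).mono (by rw [abs_inv]; linarith)
  have βdH : Hol a μ (fun x => b₂x 0 x - c⁻¹ * deriv fm x) :=
    ((s₂x 0 h0L).sub ((hfm.holD ha).const_mul c⁻¹)).mono (by rw [abs_inv]; linarith)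
  have βdD : DQ a μ (fun x => b₂x 0 x - c⁻¹ * deriv fm x) :=
    ((q₂x 0 h0L).sub (hfm.dq.const_mul c⁻¹)).mono (by rw [abs_inv]; linarith)
  have hβ : ∀ x, HasDerivAt (fun x => b₂ 0 x - c⁻¹ * fm x) (b₂x 0 x - c⁻¹ * deriv fm x) x :=
    fun x => (r₂.p.dx 0 h0L x).sub ((hfm.d x).const_mul _)
  have βD := DQ.of_hasDerivAt hβ βdH
  have cβ : Continuous (fun x => b₂ 0 x - c⁻¹ * fm x) := βH.continuous ha.1
  have p₁ := hb.p₁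
  have p₂ := hb.p₂
  have p₁x := fun y (hy : y ∈ Icc 0 L) => r₁.p.periodic_x hb.p₁ hy
  have p₂x := fun y (hy : y ∈ Icc 0 L) => r₂.p.periodic_x hb.p₂ hy
  have hG : ∀ y ∈ Icc 0 L, ∀ h : ℝ → ℝ, BDat a κ h →
      Hol a (6 * μ) (fun x => b₁ y x * b₁x y x + (1 + b₂ y x) * b₂x y x + (c ^ 2)⁻¹ * deriv h x) ∧
      DQ a (10 * μ)
        (fun x => b₁ y x * b₁x y x + (1 + b₂ y x) * b₂x y x + (c ^ 2)⁻¹ * deriv h x) := by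
    intro y hy h hh
    have t₂ := (s₂ y hy).mono (by linarith : 3 * δ ≤ μ)
    have t₂x := (s₂x y hy).mono (by linarith : 3 * δ ≤ μ)
    have u₂x := (q₂x y hy).mono (by linarith : δ ≤ μ)
    constructor
    · simp only [add_mul, one_mul]
      refine ((((s₁ y hy).mul (s₁x y hy)).add (t₂x.add (t₂.mul t₂x))).add
        (((hh.holD ha).const_mul (c ^ 2)⁻¹).mono (T := μ) ?_)).mono ?_
      · rw [abs_inv]; linarith
      · nlinarith
    · simp only [add_mul, one_mul]
      refine (((DQ.mul (s₁ y hy) (q₁ y hy) (s₁x y hy) (q₁x y hy)).add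
        (u₂x.add (DQ.mul t₂ (q₂ y hy) t₂x u₂x))).add
        ((hh.dq.const_mul (c ^ 2)⁻¹).mono (T := μ) ?_)).mono ?_
      · rw [abs_inv]; linarith
      · nlinarith
  constructor
  · exact hβ
  · intro x
    exact intervalIntegral.integral_hasDerivAt_right (cβ.intervalIntegrable _ _)
      cβ.stronglyMeasurable.stronglyMeasurableAtFilter cβ.continuousAt
  · intro x
    simp only [mkDat]
    rw [p₁, p₂, p₁x 0 h0L, p₂x 0 h0L, hhm.perD, hfm.per, hfm.perD]
  · intro x
    simp only [mkDat]
    rw [p₁, p₂, p₁x L hLL, p₂x L hLL, hhp.perD]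
  · intro x
    simp only [mkDat]
    rw [p₂, hfm.per]
  · have e : (mkDat L c J b₁ b₁x b₂ b₂x hm hp fm).gd = fun x => (b₁ 0 x * b₁x 0 x
        + (1 + b₂ 0 x) * b₂x 0 x + (c ^ 2)⁻¹ * deriv hm x) - ((b₂x 0 x - c⁻¹ * deriv fm x)
        + (b₂ 0 x - c⁻¹ * fm x) * (b₂x 0 x - c⁻¹ * deriv fm x)) := by
      funext x; simp only [mkDat]; ring
    rw [e]
    exact ((hG 0 h0L hm hhm).1.sub (βdH.add (βH.mul βdH))).mono (by nlinarith)
  · have e : (mkDat L c J b₁ b₁x b₂ b₂x hm hp fm).gd = fun x => (b₁ 0 x * b₁x 0 x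
        + (1 + b₂ 0 x) * b₂x 0 x + (c ^ 2)⁻¹ * deriv hm x) - ((b₂x 0 x - c⁻¹ * deriv fm x)
        + (b₂ 0 x - c⁻¹ * fm x) * (b₂x 0 x - c⁻¹ * deriv fm x)) := by
      funext x; simp only [mkDat]; ring
    rw [e]
    exact ((hG 0 h0L hm hhm).2.sub (βdD.add (DQ.mul βH βD βdH βdD))).mono (by nlinarith)
  · exact (hG L hLL hp hhp).1.mono (by linarith)
  · exact (hG L hLL hp hhp).2.mono (by linarith)
  · exact βH.mono (by linarith)
  · exact βdH.mono (by linarith)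
  · exact βdD.mono (by linarith)

end NormalisedData

section Normalisation
open Filter Topology MeasureTheory

variable {a L S T M ε κ vb c J : ℝ} {f fx fy fxx fxy fyx fyy gx gy : ℝ → ℝ → ℝ}

lemma Partials.congr {g : ℝ → ℝ → ℝ} (hf : Partials L f fx fy)
    (h : ∀ y ∈ Icc 0 L, ∀ x, g y x = f y x) : Partials L g fx fy := by
  refine ⟨fun y hy x => ?_, fun x y hy => ?_⟩
  · rw [show g y = f y from funext (h y hy)]
    exact hf.dx y hy x
  · exact (hf.dy x y hy).congr (fun t ht => h t ht x) (h y hy x)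

lemma Partials.unique (hL : 0 < L) (hf : Partials L f fx fy) (hg : Partials L f gx gy) :
    (∀ y ∈ Icc 0 L, ∀ x, gx y x = fx y x) ∧ ∀ y ∈ Icc 0 L, ∀ x, gy y x = fy y x :=
  ⟨fun y hy x => (hg.dx y hy x).unique (hf.dx y hy x), fun y hy x =>
    ((uniqueDiffOn_Icc hL) y hy).eq_deriv _ (hg.dy x y hy) (hf.dy x y hy)⟩

lemma Reg2.congr_partials (hL : 0 < L) (hf : Reg2 L a S f fx fy fxx fxy fyx fyy)
    (hg : Partials L f gx gy) : Reg2 L a S f gx gy fxx fxy fyx fyy := by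
  obtain ⟨h1, h2⟩ := hf.p.unique hL hg
  exact ⟨hg, hf.px.congr h1, hf.py.congr h2, hf.b, fun y hy x => by rw [h1 y hy]; exact hf.bx y hy x,
    fun y hy x => by rw [h2 y hy]; exact hf.by' y hy x, hf.hxx, hf.hxy, hf.hyx, hf.hyy⟩

lemma Reg2.mono (hf : Reg2 L a S f fx fy fxx fxy fyx fyy) (h : S ≤ T) :
    Reg2 L a T f fx fy fxx fxy fyx fyy :=
  ⟨hf.p, hf.px, hf.py, fun y hy x => (hf.b y hy x).trans h, fun y hy x => (hf.bx y hy x).trans h,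
    fun y hy x => (hf.by' y hy x).trans h, hf.hxx.mono h, hf.hxy.mono h, hf.hyx.mono h,
    hf.hyy.mono h⟩

/-- Normalised first component of a field. -/
def nU (c : ℝ) (B : ℝ × ℝ → ℝ × ℝ) (y x : ℝ) : ℝ := c⁻¹ * (B (x, y)).1

/-- Normalised deviation of the second component of a field from `c`. -/
def nV (c : ℝ) (B : ℝ × ℝ → ℝ × ℝ) (y x : ℝ) : ℝ := c⁻¹ * ((B (x, y)).2 - c)

/-- Normalised `x`-derivative. -/
def nX (L c : ℝ) (f : ℝ × ℝ → ℝ) (y x : ℝ) : ℝ := c⁻¹ * pdx L f (x, y)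

/-- Normalised `y`-derivative. -/
def nY (L c : ℝ) (f : ℝ × ℝ → ℝ) (y x : ℝ) : ℝ := c⁻¹ * pdy L f (x, y)

variable {B B₀ : ℝ × ℝ → ℝ × ℝ} {p p₀ : ℝ × ℝ → ℝ} {hm hp fm : ℝ → ℝ}

lemma contDiffOn_c1 (h : ContDiffOn ℝ 2 B (strip L)) : ContDiffOn ℝ 2 (c1 B) (strip L) := h.fst

lemma contDiffOn_c2 (h : ContDiffOn ℝ 2 B (strip L)) : ContDiffOn ℝ 2 (c2 B) (strip L) := h.snd

lemma partials_of_contDiffOn {f : ℝ × ℝ → ℝ} (h : ContDiffOn ℝ 2 f (strip L)) :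
    Partials L (fun y x => f (x, y)) (fun y x => pdx L f (x, y)) (fun y x => pdy L f (x, y)) :=
  partials_of_differentiableOn (h.differentiableOn (by norm_num))

lemma partials_nU (h : ContDiffOn ℝ 2 B (strip L)) :
    Partials L (nU c B) (nX L c (c1 B)) (nY L c (c1 B)) :=
  (partials_of_contDiffOn (contDiffOn_c1 h)).const_mul c⁻¹

lemma partials_nV (h : ContDiffOn ℝ 2 B (strip L)) :
    Partials L (nV c B) (nX L c (c2 B)) (nY L c (c2 B)) := by
  have h1 := ((partials_of_contDiffOn (contDiffOn_c2 h)).const_mul c⁻¹).const_add (-(c⁻¹ * c))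
  refine h1.congr fun y _ x => ?_
  simp only [nV, c2]
  ring

/-- Fluxless reference fields close to a vertical one. -/
structure IsRef (L a vb ε : ℝ) (B₀ : ℝ × ℝ → ℝ × ℝ) (p₀ : ℝ × ℝ → ℝ) : Prop where
  bp : BP L 2 a B₀ p₀
  mhs : MHS L B₀ p₀
  curl : ∀ z ∈ strip L, curlF L B₀ z = 0
  low : ∀ z ∈ strip L, vb ≤ |(B₀ z).2|
  small : HBd 2 a (strip L) (c1 B₀) ε

lemma IsRef.nbase (hL : 0 < L) (h : IsRef L a vb ε B₀ p₀) (c : ℝ) (hc : c = (B₀ (0, 0)).2) :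
    NBase L a (|c⁻¹| * ((2 + L) * ε)) (nU c B₀) (nX L c (c1 B₀)) (nY L c (c1 B₀))
      (nV c B₀) (nX L c (c2 B₀)) (nY L c (c2 B₀)) := by
  have h0L : (0 : ℝ) ∈ Icc 0 L := ⟨le_rfl, hL.le⟩
  have hC := h.bp.2.2.1.1
  have r₁ := reg2_of_hBd hL (contDiffOn_c1 hC) h.small
  have hε := r₁.nonneg hL
  have hle : ε ≤ (2 + L) * ε := by nlinarith [mul_nonneg hε hL.le]
  have r₁' := r₁.mono hle
  have ex : ∀ y ∈ Icc 0 L, ∀ x, pdx L (c2 B₀) (x, y) = pdy L (c1 B₀) (x, y) := fun y hy x => by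
    have := h.curl (x, y) (mem_strip hy)
    rw [curlF] at this
    linarith
  have ey : ∀ y ∈ Icc 0 L, ∀ x, pdy L (c2 B₀) (x, y) = -pdx L (c1 B₀) (x, y) := fun y hy x => by
    have := (h.mhs (x, y) (mem_strip hy)).2.2
    rw [divF] at this
    linarith
  have hp2 := partials_of_contDiffOn (contDiffOn_c2 hC)
  have per : ∀ x y, B₀ (x + 1, y) = B₀ (x, y) := h.bp.1
  refine ⟨⟨_, _, _, _, r₁'.const_mul c⁻¹⟩, ?_, fun y x => ?_, fun y x => ?_⟩
  · have hb : ∀ y ∈ Icc 0 L, ∀ x, |(B₀ (x, y)).2 - c| ≤ (2 + L) * ε := fun y hy x => by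
      have h1 := hp2.lip_y (N := ε) (fun y hy x => by
        rw [ey y hy, abs_neg]; exact r₁.bx y hy x) x hy h0L
      have h2 : |c2 B₀ (x, 0) - c2 B₀ (0, 0)| ≤ ε :=
        abs_sub_le_of_per (f := fun x => c2 B₀ (x, 0)) (fun x => by
          simp only [c2]; rw [per]) (lip_of_hasDerivAt (hp2.dx 0 h0L) (fun x => by
          rw [ex 0 h0L]; exact r₁.by' 0 h0L x)) x 0
      have h3 : |y - 0| ≤ L := by rw [sub_zero, abs_of_nonneg hy.1]; exact hy.2
      have h4 := abs_sub_le (c2 B₀ (x, y)) (c2 B₀ (x, 0)) (c2 B₀ (0, 0))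
      have h5 : ε * |y - 0| ≤ ε * L := by gcongr
      have h6 : (B₀ (x, y)).2 - c = c2 B₀ (x, y) - c2 B₀ (0, 0) := by rw [hc]; rfl
      rw [h6]
      nlinarith
    have r₂ : Reg2 L a ((2 + L) * ε) (fun y x => (B₀ (x, y)).2 - c)
        (fun y x => pdx L (c2 B₀) (x, y)) (fun y x => pdy L (c2 B₀) (x, y)) _ _ _ _ :=
      ⟨(hp2.const_add (-c)).congr fun y _ x => by simp only [c2]; ring,
        r₁'.py.congr ex, r₁'.px.neg.congr ey, hb,
        fun y hy x => by rw [ex y hy]; exact r₁'.by' y hy x,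
        fun y hy x => by rw [ey y hy, abs_neg]; exact r₁'.bx y hy x,
        r₁'.hyx, r₁'.hyy, r₁'.hxx.neg, r₁'.hxy.neg⟩
    exact ⟨_, _, _, _, r₂.const_mul c⁻¹⟩
  · simp only [nU]; rw [per]
  · simp only [nV]; rw [per]

/-- Derivative of the total pressure along horizontal lines. -/
lemma hasDerivAt_totalPressure (hB : ContDiffOn ℝ 2 B (strip L)) (hp : ContDiffOn ℝ 2 p (strip L))
    (hM : MHS L B p) {y : ℝ} (hy : y ∈ Icc 0 L) (x : ℝ) :
    HasDerivAt (fun t => p (t, y) + sq B (t, y) / 2)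
      ((B (x, y)).2 * curlF L B (x, y) + (B (x, y)).1 * pdx L (c1 B) (x, y)
        + (B (x, y)).2 * pdx L (c2 B) (x, y)) x := by
  have h1 := (partials_of_contDiffOn (contDiffOn_c1 hB)).dx y hy x
  have h2 := (partials_of_contDiffOn (contDiffOn_c2 hB)).dx y hy x
  have h3 := (partials_of_contDiffOn hp).dx y hy x
  have h4 := (hM (x, y) (mem_strip hy)).1
  refine (h3.add (((h1.pow 2).add (h2.pow 2)).div_const 2)).congr_deriv ?_
  simp only [c1, c2]
  have : pdx L p (x, y) = (B (x, y)).2 * curlF L B (x, y) := by linarith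
  rw [this]
  push_cast
  ring

end Normalisation

section Reduction
open Filter Topology MeasureTheory

variable {a L S T M ε κ vb c J : ℝ} {B B₀ : ℝ × ℝ → ℝ × ℝ} {p p₀ : ℝ × ℝ → ℝ} {h hm hp fm : ℝ → ℝ}

/-- Normalised data attached to the boundary data and a reference field. -/
def fieldDat (L c J : ℝ) (B₀ : ℝ × ℝ → ℝ × ℝ) (hm hp fm : ℝ → ℝ) : Dat :=
  mkDat L c J (nU c B₀) (nX L c (c1 B₀)) (nV c B₀) (nX L c (c2 B₀)) hm hp fm

/-- Normalised total pressure of the reference state at height `y`, perturbed by `h`. -/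
def refPressure (c : ℝ) (B₀ : ℝ × ℝ → ℝ × ℝ) (p₀ : ℝ × ℝ → ℝ) (h : ℝ → ℝ) (y x : ℝ) : ℝ :=
  (c ^ 2)⁻¹ * (p₀ (x, y) + sq B₀ (x, y) / 2 + h x)

lemma one_add_nV (hc : c ≠ 0) (B : ℝ × ℝ → ℝ × ℝ) (y x : ℝ) : 1 + nV c B y x = c⁻¹ * (B (x, y)).2 := by
  rw [nV]; field_simp; ring

lemma IsRef.hasDerivAt_refPressure (hB : IsRef L a vb ε B₀ p₀) (hc : c ≠ 0) (hh : BDat a κ h)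
    {y : ℝ} (hy : y ∈ Icc 0 L) (x : ℝ) :
    HasDerivAt (refPressure c B₀ p₀ h y) (nU c B₀ y x * nX L c (c1 B₀) y x
      + (1 + nV c B₀ y x) * nX L c (c2 B₀) y x + (c ^ 2)⁻¹ * deriv h x) x := by
  have h1 := ((hasDerivAt_totalPressure hB.bp.2.2.1.1 hB.bp.2.2.2.1 hB.mhs hy x).add
    (hh.d x)).const_mul (c ^ 2)⁻¹
  refine h1.congr_deriv ?_
  rw [hB.curl _ (mem_strip hy), one_add_nV hc, nU, nX, nX]
  ring

lemma IsRef.periodic_refPressure (hB : IsRef L a vb ε B₀ p₀) (hh : BDat a κ h) (y : ℝ) :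
    Function.Periodic (refPressure c B₀ p₀ h y) 1 := fun x => by
  have h1 : ∀ x y, B₀ (x + 1, y) = B₀ (x, y) := hB.bp.1
  have h2 : ∀ x y, p₀ (x + 1, y) = p₀ (x, y) := hB.bp.2.1
  simp only [refPressure, sq, h1, h2, hh.per x]

lemma SolMCmod.rSol (hL : 0 < L) (ha : a ∈ Ioo (0 : ℝ) 1) (hB : IsRef L a vb ε B₀ p₀)
    (hc0 : c ≠ 0) (hc : c = (B₀ (0, 0)).2) (hM : 0 ≤ M) (hhm : BDat a κ hm)
    (hfm : BDat a κ fm) (h : SolMCmod L a M B₀ p₀ hm hp fm J B p) :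
    RSol L a (|c⁻¹| * M + |c⁻¹| * ((2 + L) * ε)) (fieldDat L c J B₀ hm hp fm)
      (refPressure c B₀ p₀ hm 0) (nU c B) (nX L c (c1 B)) (nY L c (c1 B))
      (nV c B) (nX L c (c2 B)) (nY L c (c2 B)) (fun y x => (c ^ 2)⁻¹ * p (x, y)) := by
  have h0L : (0 : ℝ) ∈ Icc 0 L := ⟨le_rfl, hL.le⟩
  have hLL : L ∈ Icc 0 L := ⟨hL.le, le_rfl⟩
  obtain ⟨⟨perB, perp, ⟨hBC, -⟩, hpm⟩, hMHS, hclose, hbot, htop, hvel, hflux⟩ := h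
  have hs := uniqueDiffOn_strip hL
  have hN := hB.nbase hL c hc
  have hB₀C := hB.bp.2.2.1.1
  have hDC : ContDiffOn ℝ 2 (fun z => B z - B₀ z) (strip L) := hBC.sub hB₀C
  have hD := HBd.of_hNorm ha.1 hM hclose
  have n1 : ‖ContinuousLinearMap.fst ℝ ℝ ℝ‖ ≤ 1 := ContinuousLinearMap.norm_fst_le ..
  have n2 : ‖ContinuousLinearMap.snd ℝ ℝ ℝ‖ ≤ 1 := ContinuousLinearMap.norm_snd_le ..
  have D1 := reg2_of_hBd hL (contDiffOn_c1 hDC) (hD.clm_comp hs hDC (ContinuousLinearMap.fst ℝ ℝ ℝ) n1)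
  have D2 := reg2_of_hBd hL (contDiffOn_c2 hDC) (hD.clm_comp hs hDC (ContinuousLinearMap.snd ℝ ℝ ℝ) n2)
  obtain ⟨f₁, f₂, f₃, f₄, r₁⟩ := hN.r₁
  obtain ⟨g₁, g₂, g₃, g₄, r₂⟩ := hN.r₂
  have e₁ := (D1.const_mul c⁻¹).add r₁
  have e₂ := (D2.const_mul c⁻¹).add r₂
  have k₁ : (fun y x => c⁻¹ * c1 (fun z => B z - B₀ z) (x, y) + nU c B₀ y x) = nU c B := by
    funext y x; simp only [c1, nU, Prod.fst_sub]; ring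
  have k₂ : (fun y x => c⁻¹ * c2 (fun z => B z - B₀ z) (x, y) + nV c B₀ y x) = nV c B := by
    funext y x; simp only [c2, nV, Prod.snd_sub]; ring
  rw [k₁] at e₁
  rw [k₂] at e₂
  obtain ⟨T, -, hT⟩ := hpm.exists_bd ha.1
  have hP := (reg2_of_hBd hL hpm.1 hT).const_mul (c ^ 2)⁻¹
  have hv : ∀ x, (B (x, 0)).2 = (B₀ (x, 0)).2 - fm x := fun x => by linarith [hvel x]
  have hβ : ∀ x, 1 + (fieldDat L c J B₀ hm hp fm).β x = c⁻¹ * (B (x, 0)).2 := fun x => by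
    change 1 + (nV c B₀ 0 x - c⁻¹ * fm x) = _
    rw [← add_sub_assoc, one_add_nV hc0, hv]; ring
  have hβd : ∀ x, nX L c (c2 B₀) 0 x - c⁻¹ * deriv fm x = nX L c (c2 B) 0 x := fun x => by
    have i1 := (partials_of_contDiffOn (contDiffOn_c2 hBC)).dx 0 h0L x
    have i2 := ((partials_of_contDiffOn (contDiffOn_c2 hB₀C)).dx 0 h0L x).sub (hfm.d x)
    have i3 : (fun x => c2 B (x, 0)) = (fun x => c2 B₀ (x, 0)) - fm := funext fun x => hv x
    rw [i3] at i1
    simp only [nX]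
    rw [i1.unique i2]
    ring
  refine ⟨⟨_, _, _, _, e₁.congr_partials hL (partials_nU hBC)⟩,
    ⟨_, _, _, _, e₂.congr_partials hL (partials_nV hBC)⟩,
    ⟨_, _, _, _, _, _, _, hP, fun y hy x => ?_, fun y hy x => ?_⟩, fun y x => ?_, fun y x => ?_,
    fun y x => ?_, fun y hy x => ?_, fun x => ?_, ?_, fun x => ?_, fun x => ?_, fun x => ?_⟩
  · have := (hMHS _ (mem_strip (x := x) hy)).1
    rw [curlF] at this
    have i : pdx L p (x, y) = (B (x, y)).2 * (pdx L (c2 B) (x, y) - pdy L (c1 B) (x, y)) := by linarith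
    rw [one_add_nV hc0, nX, nY, i]
    ring
  · have := (hMHS _ (mem_strip (x := x) hy)).2.1
    rw [curlF] at this
    have i : pdy L p (x, y) = -((B (x, y)).1 * (pdx L (c2 B) (x, y) - pdy L (c1 B) (x, y))) := by linarith
    rw [nU, nX, nY, i]
    ring
  · simp only [nU]; rw [show B (x + 1, y) = B (x, y) from perB x y]
  · simp only [nV]; rw [show B (x + 1, y) = B (x, y) from perB x y]
  · rw [show p (x + 1, y) = p (x, y) from perp x y]
  · have := (hMHS _ (mem_strip (x := x) hy)).2.2
    rw [divF] at this
    rw [nX, nY, show pdy L (c2 B) (x, y) = -pdx L (c1 B) (x, y) by linarith]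
    ring
  · have := hβ x
    rw [← one_add_nV hc0] at this
    linarith
  · change ∫ y in (0 : ℝ)..L, c⁻¹ * (B (0, y)).1 = -J / c
    rw [intervalIntegral.integral_const_mul, ← hflux, fluxC]
    ring
  · rw [hβ, refPressure, ← hbot x, sq, nU]
    ring
  · have i1 := hasDerivAt_totalPressure hBC hpm.1 hMHS h0L x
    have i2 := (hasDerivAt_totalPressure hB₀C hB.bp.2.2.2.1 hB.mhs h0L x).add (hhm.d x)
    have i3 : (fun t => p (t, 0) + sq B (t, 0) / 2)
      = (fun t => p₀ (t, 0) + sq B₀ (t, 0) / 2) + hm := funext fun x => hbot x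
    rw [i3] at i1
    have i4 := i1.unique i2
    rw [hB.curl _ (mem_strip h0L)] at i4
    have i5 : (fieldDat L c J B₀ hm hp fm).gd x = nU c B₀ 0 x * nX L c (c1 B₀) 0 x
      + (1 + nV c B₀ 0 x) * nX L c (c2 B₀) 0 x + (c ^ 2)⁻¹ * deriv hm x
      - (1 + (fieldDat L c J B₀ hm hp fm).β x) * (nX L c (c2 B₀) 0 x - c⁻¹ * deriv fm x) := rfl
    rw [i5, hβd, hβ, one_add_nV hc0]
    simp only [nU, nX, nY]
    rw [curlF] at i4
    linear_combination (c⁻¹ ^ 2) * i4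
  · have i1 := (hasDerivAt_totalPressure hBC hpm.1 hMHS hLL x).deriv
    have i2 := (hasDerivAt_totalPressure hB₀C hB.bp.2.2.2.1 hB.mhs hLL x).deriv
    have i4 := htop x
    rw [i1, i2, hB.curl _ (mem_strip hLL)] at i4
    have i5 : (fieldDat L c J B₀ hm hp fm).Gd x = nU c B₀ L x * nX L c (c1 B₀) L x
      + (1 + nV c B₀ L x) * nX L c (c2 B₀) L x + (c ^ 2)⁻¹ * deriv hp x := rfl
    rw [i5, one_add_nV hc0, one_add_nV hc0]
    simp only [nU, nX, nY]
    rw [curlF] at i4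
    linear_combination (c⁻¹ ^ 2) * i4

end Reduction

section Existence
open Filter Topology MeasureTheory

variable {a L S T M ε κ vb c J η : ℝ} {B B₀ : ℝ × ℝ → ℝ × ℝ} {p p₀ : ℝ × ℝ → ℝ}
  {h hm hp fm : ℝ → ℝ} {f fx fy fxx fxy fyx fyy : ℝ → ℝ → ℝ}

lemma Reg2.const_add (hf : Reg2 L a S f fx fy fxx fxy fyx fyy) (c : ℝ) :
    Reg2 L a (|c| + S) (fun y x => c + f y x) fx fy fxx fxy fyx fyy := by
  have h : S ≤ |c| + S := by linarith [abs_nonneg c]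
  exact ⟨hf.p.const_add c, hf.px, hf.py,
    fun y hy x => (abs_add_le _ _).trans (add_le_add le_rfl (hf.b y hy x)),
    fun y hy x => (hf.bx y hy x).trans h, fun y hy x => (hf.by' y hy x).trans h, hf.hxx.mono h,
    hf.hxy.mono h, hf.hyx.mono h, hf.hyy.mono h⟩

lemma HBd.memC {k : ℕ} {s : Set (ℝ × ℝ)} {E : Type*} [NormedAddCommGroup E] [NormedSpace ℝ E]
    {g : ℝ × ℝ → E} (hS : 0 ≤ S) (hc : ContDiffOn ℝ k g s) (h : HBd k a s g S) : MemC k a s g :=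
  ⟨hc, (h.hNorm_le hS).trans_lt ENNReal.ofReal_lt_top⟩

lemma IsRef.exists_solMCmod (hL : 0 < L) (ha : a ∈ Ioo (0 : ℝ) 1) (hB : IsRef L a vb ε B₀ p₀)
    (hc0 : c ≠ 0) (hc : c = (B₀ (0, 0)).2) (hhm : BDat a κ hm) (hhp : BDat a κ hp)
    {ηd : ℝ} (hd : (fieldDat L c J B₀ hm hp fm).Ok a ηd)
    (hΦ : |J / c| ≤ ηd) (h4 : 4 * rc L a * ηd ≤ η) (h2 : 2 * rc L a * η ≤ 1) (hη : η ≤ 1 / 4)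
    (hM : 32 * (|c| * (300 * η + |c⁻¹| * ((2 + L) * ε))) ≤ M) :
    ∃ B p, SolMCmod L a M B₀ p₀ hm hp fm J B p := by
  have h0L : (0 : ℝ) ∈ Icc 0 L := ⟨le_rfl, hL.le⟩
  have hLL : L ∈ Icc 0 L := ⟨hL.le, le_rfl⟩
  have hs := uniqueDiffOn_strip hL
  set d := fieldDat L c J B₀ hm hp fm with hd_def
  have hdΦ : d.Φ = -J / c := rfl
  obtain ⟨w, hw, hst⟩ := exists_fixedPoint hL ha h2 hd (by rw [hdΦ, neg_div, abs_neg]; exact hΦ) h4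
  have hle : ηd ≤ η := by
    have := hd.nonneg
    nlinarith [sc_ge hL ha, rc_ge hL ha]
  have hN := hB.nbase hL c hc
  obtain ⟨p, j, ⟨_, _, _, _, r₁⟩, ⟨_, _, _, _, r₂⟩, ⟨T, _, _, _, _, rp⟩, pp, hbot, htop⟩ :=
    hst.exists_solution hL ha (hd.mono hle) hη hw
      (Pm := refPressure c B₀ p₀ hm 0) (PT := refPressure c B₀ p₀ hp L)
      (fun x => (hB.hasDerivAt_refPressure hc0 hhm h0L x).congr_deriv (by
        rw [hd_def, fieldDat, mkDat]; ring)) (hB.periodic_refPressure hhm 0)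
      (fun x => hB.hasDerivAt_refPressure hc0 hhp hLL x) (hB.periodic_refPressure hhp L)
  have lin := hst.lin
  have R1 := r₁.const_mul c
  have R2 := (r₂.const_add 1).const_mul c
  have RP := rp.const_mul (c ^ 2)
  obtain ⟨_, _, _, _, b₁⟩ := hN.r₁
  obtain ⟨_, _, _, _, b₂⟩ := hN.r₂
  have D1 := (r₁.add (b₁.const_mul (-1))).const_mul c
  have D2 := (r₂.add (b₂.const_mul (-1))).const_mul c
  have e1 : |(-1 : ℝ)| = 1 := by norm_num
  rw [e1, one_mul] at D1 D2
  set B : ℝ × ℝ → ℝ × ℝ := fun z => (c * w .u z.2 z.1, c * (1 + w .v z.2 z.1)) with hBdef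
  have hB1 : c1 B = fun z => c * w .u z.2 z.1 := rfl
  have hB2 : c2 B = fun z => c * (1 + w .v z.2 z.1) := rfl
  have cB : ContDiffOn ℝ 2 B (strip L) := (R1.contDiffOn hL ha).prodMk (R2.contDiffOn hL ha)
  have nB : ∃ S, 0 ≤ S ∧ HBd 2 a (strip L) B S := by
    have n1 := R1.nonneg hL
    have n2 := R2.nonneg hL
    refine ⟨8 * (|c| * (300 * η)) + 8 * (|c| * (|1| + 300 * η)), by positivity, ?_⟩
    exact HBd.prodMk hs (R1.contDiffOn hL ha) (R2.contDiffOn hL ha)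
      ((R1.hBd hL ha).mono (by linarith)) ((R2.hBd hL ha).mono (by linarith))
  obtain ⟨S, hS, nB⟩ := nB
  have hD : (fun z => B z - B₀ z) = fun z => (c * (w .u z.2 z.1 + -1 * nU c B₀ z.2 z.1),
      c * (w .v z.2 z.1 + -1 * nV c B₀ z.2 z.1)) := by
    funext z
    refine Prod.ext ?_ ?_
    · simp only [hBdef, nU, Prod.fst_sub]; field_simp; ring
    · simp only [hBdef, nV, Prod.snd_sub]; field_simp; ring
  have nD : HBd 2 a (strip L) (fun z => B z - B₀ z)
      (8 * (|c| * (300 * η + |c⁻¹| * ((2 + L) * ε)))) := by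
    rw [hD]
    exact HBd.prodMk hs (D1.contDiffOn hL ha) (D2.contDiffOn hL ha) (D1.hBd hL ha) (D2.hBd hL ha)
  have n1 := D1.nonneg hL
  have x1 : ∀ z ∈ strip L, pdx L (c1 B) z = c * w .ux z.2 z.1 := fun z hz => R1.pdx_eq hL ha hz
  have y1 : ∀ z ∈ strip L, pdy L (c1 B) z = c * (w .vx z.2 z.1 - j z.2 z.1) :=
    fun z hz => R1.pdy_eq hL ha hz
  have x2 : ∀ z ∈ strip L, pdx L (c2 B) z = c * w .vx z.2 z.1 := fun z hz => R2.pdx_eq hL ha hz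
  have y2 : ∀ z ∈ strip L, pdy L (c2 B) z = c * -w .ux z.2 z.1 := fun z hz => R2.pdy_eq hL ha hz
  have cP := RP.contDiffOn hL ha
  have hcurl : ∀ z ∈ strip L, curlF L B z = c * j z.2 z.1 := fun z hz => by
    rw [curlF, x2 z hz, y1 z hz]; ring
  have hMHS : MHS L B (fun z => c ^ 2 * p z.2 z.1) := fun z hz => by
    rw [hcurl z hz, divF, x1 z hz, y2 z hz, RP.pdx_eq hL ha hz, RP.pdy_eq hL ha hz]
    refine ⟨?_, ?_, ?_⟩ <;> ring
  refine ⟨B, fun z => c ^ 2 * p z.2 z.1, ⟨fun x y => ?_, fun x y => ?_, nB.memC hS cB,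
    (RP.hBd hL ha).memC (by linarith [RP.nonneg hL]) cP⟩, hMHS, ?_, fun x => ?_, fun x => ?_,
    fun x => ?_, ?_⟩
  · simp only [hBdef, lin.pu y x, lin.pv y x]
  · simp only [pp y x]
  · refine (nD.hNorm_le (by linarith)).trans (ENNReal.ofReal_le_ofReal ?_)
    push_cast
    linarith
  · have := hbot x
    rw [refPressure] at this
    have hv : w .v 0 x = d.β x := lin.bot x
    simp only [sq, hBdef, hv, this]
    field_simp
    ring
  · rw [(hasDerivAt_totalPressure cB cP hMHS hLL x).deriv,
      (hasDerivAt_totalPressure hB.bp.2.2.1.1 hB.bp.2.2.2.1 hB.mhs hLL x).deriv,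
      hcurl _ (mem_strip hLL), hB.curl _ (mem_strip hLL), x1 _ (mem_strip hLL),
      x2 _ (mem_strip hLL)]
    have i5 : d.Gd x = nU c B₀ L x * nX L c (c1 B₀) L x
      + (1 + nV c B₀ L x) * nX L c (c2 B₀) L x + (c ^ 2)⁻¹ * deriv hp x := rfl
    have := htop x
    rw [i5, one_add_nV hc0] at this
    simp only [nU, nX] at this
    simp only [hBdef]
    have k : c * (c⁻¹) = 1 := mul_inv_cancel₀ hc0
    field_simp at this
    linear_combination this
  · have hv : w .v 0 x = nV c B₀ 0 x - c⁻¹ * fm x := lin.bot x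
    simp only [hBdef, hv, nV]
    field_simp
    ring
  · have : ∫ y in (0 : ℝ)..L, w .u y 0 = -J / c := lin.flux
    rw [fluxC]
    change -∫ y in (0 : ℝ)..L, c * w .u y 0 = J
    rw [intervalIntegral.integral_const_mul, this]
    field_simp

end Existence

section Main
open Filter Topology MeasureTheory

variable {a L S T M ε κ vb c J η : ℝ} {B B' B₀ : ℝ × ℝ → ℝ × ℝ} {p p' p₀ : ℝ × ℝ → ℝ}
  {h hm hp fm : ℝ → ℝ}

/-- Choice of the smallness constants. -/
lemma exists_constants (hL : 0 < L) (ha : a ∈ Ioo (0 : ℝ) 1) (hvb : 0 < vb) :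
    ∃ M > (0 : ℝ), ∃ K > (0 : ℝ), ∀ c : ℝ, vb ≤ |c| → ∃ μ ηd η η₁ : ℝ,
      3 * (|c⁻¹| * ((2 + L) * (K * M))) + 3 * (|c|⁻¹ * (K * M)) + 3 * (|c ^ 2|⁻¹ * (K * M)) ≤ μ ∧
      μ ≤ 1 ∧ 16 * μ ≤ ηd ∧ |c|⁻¹ * ((1 + L) * (K * M)) ≤ ηd ∧ 4 * rc L a * ηd ≤ η ∧
      2 * rc L a * η ≤ 1 ∧ η ≤ 1 / 4 ∧
      32 * (|c| * (300 * η + |c⁻¹| * ((2 + L) * (K * M)))) ≤ M ∧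
      6 * (|c⁻¹| * M + |c⁻¹| * ((2 + L) * (K * M))) ≤ η₁ ∧ ηd ≤ η₁ ∧
      2 * rc L a * ((24 + 4 * L) * η₁) ≤ 1 := by
  have hr : 1 ≤ rc L a := (sc_ge hL ha).trans (rc_ge hL ha)
  set r := rc L a with hr_def
  set m : ℝ := 3 * (2 + L) + 3 + 3 * vb⁻¹ with hm
  set C : ℝ := 16 * m + (1 + L) with hC
  set D : ℝ := 6 + 6 * (2 + L) + C with hD
  have hv : 0 < vb⁻¹ := by positivity
  have hm1 : 0 < m := by positivity
  have hC0 : 0 < C := by positivity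
  have hD0 : 0 < D := by positivity
  set N : ℝ := 16 * r ^ 2 * ((24 + 4 * L) * D) with hN
  have hN0 : 0 < N := by positivity
  set E : ℝ := 32 * (1200 * r * C + (2 + L)) with hE
  have hE0 : 0 < E := by positivity
  have hE1 : 1 ≤ E := by
    have : 0 ≤ 1200 * r * C := by positivity
    linarith
  refine ⟨vb / N, by positivity, E⁻¹, by positivity, fun c hc => ?_⟩
  set M := vb / N with hM
  have hM0 : 0 < M := by positivity
  have hc0 : 0 < |c| := hvb.trans_le hc
  set i := |c|⁻¹ with hi
  have hi0 : 0 < i := by positivity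
  have hiv : i ≤ vb⁻¹ := inv_anti₀ hvb hc
  set κ := E⁻¹ * M with hκ
  have hκ0 : 0 < κ := by positivity
  have hκM : κ ≤ M := by
    have : E⁻¹ ≤ 1 := inv_le_one_of_one_le₀ hE1
    nlinarith
  set q := i * κ with hq
  have hq0 : 0 < q := by positivity
  have hqM : q ≤ i * M := mul_le_mul_of_nonneg_left hκM hi0.le
  have hiM : N * (i * M) ≤ 1 := by
    have : N * (i * M) = i * vb := by rw [hM]; field_simp
    rw [this]
    calc i * vb ≤ vb⁻¹ * vb := by gcongr
      _ = 1 := inv_mul_cancel₀ hvb.ne'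
  have hiM0 : 0 < i * M := by positivity
  have e1 : |c⁻¹| = i := abs_inv c
  have e2 : |c ^ 2|⁻¹ = i ^ 2 := by rw [abs_pow, hi, inv_pow]
  have hDq : 16 * r ^ 2 * (D * q) ≤ 1 := by
    have h1 : 16 * r ^ 2 * (D * q) ≤ 16 * r ^ 2 * (D * (i * M)) := by gcongr
    have h2 : 16 * r ^ 2 * (D * (i * M)) ≤ N * (i * M) := by
      have : 0 ≤ 16 * r ^ 2 * (D * (i * M)) := by positivity
      rw [hN]; nlinarith
    linarith
  have hCq : 16 * r ^ 2 * (C * q) ≤ 1 := by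
    have : C ≤ D := by linarith
    have : 16 * r ^ 2 * (C * q) ≤ 16 * r ^ 2 * (D * q) := by gcongr
    linarith
  have hCq0 : 0 < C * q := by positivity
  have hCr : r * (C * q) ≤ r ^ 2 * (C * q) := by
    have : r ≤ r ^ 2 := by nlinarith
    gcongr
  have hC1 : C * q ≤ r * (C * q) := le_mul_of_one_le_left hCq0.le hr
  refine ⟨m * q, C * q, 4 * r * (C * q), D * (i * M), ?_, ?_, ?_, ?_, le_rfl, ?_, ?_, ?_, ?_, ?_, ?_⟩
  · rw [e1, e2]
    have : i * q ≤ vb⁻¹ * q := by gcongr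
    have e : m * q = 3 * (i * ((2 + L) * κ)) + 3 * (i * κ) + 3 * (vb⁻¹ * q) := by rw [hm, hq]; ring
    have e' : i ^ 2 * κ = i * q := by rw [hq]; ring
    rw [e, e']
    linarith
  · have : m * q ≤ C * q := by
      gcongr; linarith
    linarith
  · have e : C * q = 16 * (m * q) + (1 + L) * q := by rw [hC]; ring
    have : 0 ≤ (1 + L) * q := by positivity
    linarith
  · have e : C * q = 16 * (m * q) + i * ((1 + L) * κ) := by rw [hC, hq]; ring
    have : 0 ≤ m * q := by positivity
    linarith
  · linarith
  · linarith
  · rw [e1]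
    have h1 : |c| * i = 1 := mul_inv_cancel₀ hc0.ne'
    have h2 : 32 * (|c| * (300 * (4 * r * (C * q)) + i * ((2 + L) * κ)))
        = (|c| * i) * (E * κ) := by rw [hq, hE]; ring
    rw [h2, h1, one_mul, hκ, ← mul_assoc, mul_inv_cancel₀ hE0.ne', one_mul]
  · rw [e1]
    have h1 : (2 + L) * q ≤ (2 + L) * (i * M) := by gcongr
    have h2 : 0 ≤ C * (i * M) := by positivity
    have e : D * (i * M) = 6 * (i * M) + 6 * ((2 + L) * (i * M)) + C * (i * M) := by rw [hD]; ring
    have e' : i * ((2 + L) * κ) = (2 + L) * q := by rw [hq]; ring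
    rw [e, e']
    linarith
  · have : C ≤ D := by linarith
    gcongr
  · have : r ≤ r ^ 2 := by nlinarith
    have h1 : 2 * r * ((24 + 4 * L) * (D * (i * M))) ≤ 16 * r ^ 2 * ((24 + 4 * L) * (D * (i * M))) := by
      gcongr; norm_num
    have h2 : 16 * r ^ 2 * ((24 + 4 * L) * (D * (i * M))) = N * (i * M) := by rw [hN]; ring
    linarith

lemma BData.bDat (ha : a ∈ Ioo (0 : ℝ) 1) (hκ : 0 ≤ κ) (h1 : BData 2 a h)
    (h2 : hNorm 2 a univ h ≤ ENNReal.ofReal κ) : BDat a κ h := by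
  obtain ⟨d, b, bd, dq⟩ := exists_deriv_of_hBd h1.2.1 (HBd.of_hNorm ha.1 hκ h2)
  exact ⟨d, b, bd, dq, h1.1⟩

lemma IsRef.abs_fluxC_le (hL : 0 < L) (hB : IsRef L a vb ε B₀ p₀) : |fluxC L B₀| ≤ ε * L := by
  have r := reg2_of_hBd hL (contDiffOn_c1 hB.bp.2.2.1.1) hB.small
  have := intervalIntegral.norm_integral_le_of_norm_le_const (a := 0) (b := L) (C := ε)
    (f := fun y => (B₀ (0, y)).1) (fun y hy => by
      rw [uIoc_of_le hL.le] at hy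
      exact r.b y ⟨hy.1.le, hy.2⟩ 0)
  rw [fluxC, abs_neg]
  rwa [sub_zero, abs_of_pos hL] at this

lemma SolMCmod.unique (hL : 0 < L) (ha : a ∈ Ioo (0 : ℝ) 1) (hB : IsRef L a vb ε B₀ p₀)
    (hc0 : c ≠ 0) (hc : c = (B₀ (0, 0)).2) (hM : 0 ≤ M) (hhm : BDat a κ hm)
    (hfm : BDat a κ fm) (hη : 6 * (|c⁻¹| * M + |c⁻¹| * ((2 + L) * ε)) ≤ η)
    (hηL : 2 * rc L a * ((24 + 4 * L) * η) ≤ 1) (hd : (fieldDat L c J B₀ hm hp fm).Ok a η)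
    (h : SolMCmod L a M B₀ p₀ hm hp fm J B p) (h' : SolMCmod L a M B₀ p₀ hm hp fm J B' p') :
    EqOn B B' (strip L) ∧ EqOn p p' (strip L) := by
  have key := (h.rSol hL ha hB hc0 hc hM hhm hfm).unique hL ha hη hηL hd
    (h'.rSol hL ha hB hc0 hc hM hhm hfm)
  have hi : c⁻¹ ≠ 0 := inv_ne_zero hc0
  refine ⟨fun z hz => ?_, fun z hz => ?_⟩ <;> obtain ⟨k1, k2, k3⟩ := key z.2 hz.2 z.1
  · exact Prod.ext (mul_left_cancel₀ hi k1) (sub_left_injective (mul_left_cancel₀ hi k2))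
  · exact mul_left_cancel₀ (inv_ne_zero (pow_ne_zero 2 hc0)) k3

lemma SolMC.solMCmod (hL : 0 < L) (hB : IsRef L a vb ε B₀ p₀) (hhp : BDat a κ hp)
    (h : SolMC L a M B₀ p₀ hm hp fm J B p) : SolMCmod L a M B₀ p₀ hm hp fm J B p := by
  obtain ⟨h1, h2, h3, h4, h5, h6⟩ := h
  refine ⟨h1, h2, h3, h4, fun x => ?_, h6⟩
  have e : (fun t => p (t, L) + sq B (t, L) / 2)
      = (fun t => p₀ (t, L) + sq B₀ (t, L) / 2) + hp := funext h5
  have d := hasDerivAt_totalPressure hB.bp.2.2.1.1 hB.bp.2.2.2.1 hB.mhs ⟨hL.le, le_rfl⟩ x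
  rw [e, (d.add (hhp.d x)).deriv, d.deriv]

lemma SolMCmod.solMC (hL : 0 < L) (hB : IsRef L a vb ε B₀ p₀) (hhp : BDat a κ hp)
    (h : SolMCmod L a M B₀ p₀ hm hp fm J B p)
    (h0 : hp 0 = (p (0, L) + sq B (0, L) / 2) - (p₀ (0, L) + sq B₀ (0, L) / 2)) :
    SolMC L a M B₀ p₀ hm hp fm J B p := by
  obtain ⟨h1, h2, h3, h4, h5, h6⟩ := h
  refine ⟨h1, h2, h3, h4, fun x => ?_, h6⟩
  have hLL : L ∈ Icc 0 L := ⟨hL.le, le_rfl⟩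
  have d := fun x => hasDerivAt_totalPressure h1.2.2.1.1 h1.2.2.2.1 h2 hLL x
  have d₀ := fun x => hasDerivAt_totalPressure hB.bp.2.2.1.1 hB.bp.2.2.2.1 hB.mhs hLL x
  have d' := fun x => (d x).sub ((d₀ x).add (hhp.d x))
  have e := is_const_of_deriv_eq_zero (fun x => (d' x).differentiableAt) (fun x => by
    rw [(d' x).deriv, ← (d x).deriv, ← (d₀ x).deriv, h5 x, sub_self]) x 0
  simp only [Pi.sub_apply, Pi.add_apply] at e
  linarith

end Main

theorem mhs_bvp_C_compatibility (L a vb : ℝ) (hL : 0 < L) (ha : a ∈ Set.Ioo (0 : ℝ) 1)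
    (hvb : 0 < vb) :
    ∃ ε > (0 : ℝ), ∃ M > (0 : ℝ), ∃ K > (0 : ℝ),
      ∀ (B₀ : ℝ × ℝ → ℝ × ℝ) (p₀ : ℝ × ℝ → ℝ),
        BP L 2 a B₀ p₀ → MHS L B₀ p₀ →
        (∀ z ∈ strip L, curlF L B₀ z = 0) →
        (∀ z ∈ strip L, vb ≤ |(B₀ z).2|) →
        hNorm 2 a (strip L) (c1 B₀) ≤ ENNReal.ofReal ε →
        ∀ (hm hp fm : ℝ → ℝ) (J : ℝ),
          BData 2 a hm → BData 2 a hp → BData 2 a fm →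
          hNorm 2 a (Set.univ : Set ℝ) hm + hNorm 2 a (Set.univ : Set ℝ) hp
              + hNorm 2 a (Set.univ : Set ℝ) fm
              + ENNReal.ofReal |J - fluxC L B₀| ≤ ENNReal.ofReal (K * M) →
          (∃ Bt pt, SolMCmod L a M B₀ p₀ hm hp fm J Bt pt) ∧
          ∀ Bt pt, SolMCmod L a M B₀ p₀ hm hp fm J Bt pt →
            ((∃ B p, SolMC L a M B₀ p₀ hm hp fm J B p ∧
                ∀ B' p', SolMC L a M B₀ p₀ hm hp fm J B' p' →
                  Set.EqOn B B' (strip L) ∧ Set.EqOn p p' (strip L))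
              ↔ hp 0 = (pt (0, L) + sq Bt (0, L) / 2) - (p₀ (0, L) + sq B₀ (0, L) / 2)) := by
  obtain ⟨M, hM, K, hK, hconst⟩ := exists_constants hL ha hvb
  have hKM : 0 < K * M := mul_pos hK hM
  refine ⟨K * M, hKM, M, hM, K, hK, fun B₀ p₀ hbp hmhs hcurl hlow hsmall hm hp fm J bhm bhp bfm
    hdata => ?_⟩
  have hB : IsRef L a vb (K * M) B₀ p₀ :=
    ⟨hbp, hmhs, hcurl, hlow, HBd.of_hNorm ha.1 hKM.le hsmall⟩
  have hhm : BDat a (K * M) hm := bhm.bDat ha hKM.le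
    (((le_self_add.trans le_self_add).trans le_self_add).trans hdata)
  have hhp : BDat a (K * M) hp := bhp.bDat ha hKM.le
    (((le_add_self.trans le_self_add).trans le_self_add).trans hdata)
  have hfm : BDat a (K * M) fm := bfm.bDat ha hKM.le ((le_add_self.trans le_self_add).trans hdata)
  have hJ : |J - fluxC L B₀| ≤ K * M :=
    (ENNReal.ofReal_le_ofReal_iff hKM.le).1 (le_add_self.trans hdata)
  obtain ⟨c, hc⟩ : ∃ c, c = (B₀ (0, 0)).2 := ⟨_, rfl⟩
  have hcv : vb ≤ |c| := hc ▸ hlow (0, 0) (mem_strip ⟨le_rfl, hL.le⟩)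
  have hc0 : c ≠ 0 := abs_pos.1 (hvb.trans_le hcv)
  obtain ⟨μ, ηd, η, η₁, k1, k2, k3, k4, k5, k6, k7, k8, k9, k10, k11⟩ := hconst c hcv
  have hd : (fieldDat L c J B₀ hm hp fm).Ok a ηd :=
    (mkDat_ok hL ha (hB.nbase hL c hc) hhm hhp hfm k1 k2).mono k3
  have hΦ : |J / c| ≤ ηd := by
    have h1 := hB.abs_fluxC_le hL
    have h2 : |J| ≤ (1 + L) * (K * M) := by
      have := abs_sub_abs_le_abs_sub J (fluxC L B₀)
      linarith
    rw [abs_div, div_eq_inv_mul]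
    exact (mul_le_mul_of_nonneg_left h2 (by positivity)).trans k4
  have huniq := fun {B B' : ℝ × ℝ → ℝ × ℝ} {p p' : ℝ × ℝ → ℝ} h h' =>
    SolMCmod.unique (B := B) (B' := B') (p := p) (p' := p') hL ha hB hc0 hc hM.le hhm hfm k9 k11
      (hd.mono k10) h h'
  refine ⟨hB.exists_solMCmod hL ha hc0 hc hhm hhp hd hΦ k5 k6 k7 k8, fun Bt pt ht =>
    ⟨fun ⟨B, p, h, _⟩ => ?_, fun h0 => ⟨Bt, pt, ht.solMC hL hB hhp h0, fun B' p' h' =>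
      huniq ht (h'.solMCmod hL hB hhp)⟩⟩⟩
  obtain ⟨e1, e2⟩ := huniq ht (h.solMCmod hL hB hhp)
  have hz : ((0 : ℝ), L) ∈ strip L := mem_strip ⟨hL.le, le_rfl⟩
  have := h.2.2.2.2.1 0
  simp only [sq] at this ⊢
  rw [e1 hz, e2 hz]
  linarith

end EulerBVP
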